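/- arXiv:1711.01106 — 2 statements merged into one kernel-verified Lean document; each statement's English description precedes it below -/
import Mathlib

section
/- Let K be an algebraically closed field of characteristic 0, let n ≥ 3 and k ≥ 0 be integers, let R = K[x_1,…,x_{2n−k}], and let X be a (2×n)-matrix with exactly k zero entries, all lying outside the (2×2)-submatrix formed by columns n−1 and n, whose remaining 2n−k entries are exactly the pairwise distinct indeterminates x_1,…,x_{2n−k}. Then ara I_2(X) = cd I_2(X) = 2n − 3 − k. -/
/-- The ideal generated by the `t × t` minors of a matrix. -/
def minorsIdeal {R : Type*} [CommRing R] {m n : ℕ} (t : ℕ)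
    (X : Matrix (Fin m) (Fin n) R) : Ideal R :=
  Ideal.span { d | ∃ (r : Fin t → Fin m) (c : Fin t → Fin n),
    Function.Injective r ∧ Function.Injective c ∧ d = (X.submatrix r c).det }

/-- The arithmetical rank of an ideal: the least number of elements generating it
up to radical. -/
noncomputable def araRank {R : Type*} [CommRing R] (I : Ideal R) : ℕ :=
  sInf { r | ∃ f : Fin r → R, (Ideal.span (Set.range f)).radical = I.radical }

/-- The cohomological dimension of an ideal: the largest `i` such that the local
cohomology module `H^i_I(R)` is nonzero. -/
noncomputable def cohDim {R : Type*} [CommRing R] (I : Ideal R) : ℕ :=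
  sSup { i | Nontrivial ((localCohomology I i).obj (ModuleCat.of R R)) }

namespace LC
universe u
set_option linter.unusedSectionVars false
set_option linter.unusedSimpArgs false

/-- elements annihilated by powers of all elements of `J` -/
def Gam {R : Type*} [CommRing R] (J : Ideal R) (M : Type*) [AddCommGroup M] [Module R M] :
    Submodule R M where
  carrier := {x | J ≤ (Ideal.torsionOf R M x).radical}
  zero_mem' := by
    intro j _
    exact ⟨0, by simp⟩
  add_mem' := by
    intro a b ha hb j hj
    obtain ⟨n, hn⟩ := ha hj
    obtain ⟨m, hm⟩ := hb hj
    refine ⟨n + m, ?_⟩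
    rw [Ideal.mem_torsionOf_iff] at *
    rw [smul_add, pow_add, mul_smul, mul_smul, smul_comm (j ^ n) (j ^ m) a, hn, hm]
    simp
  smul_mem' := by
    intro c x hx j hj
    obtain ⟨n, hn⟩ := hx hj
    refine ⟨n, ?_⟩
    rw [Ideal.mem_torsionOf_iff] at *
    rw [smul_comm, hn, smul_zero]

section gam
variable {R : Type*} [CommRing R] {M : Type*} [AddCommGroup M] [Module R M]

lemma mem_Gam {J : Ideal R} {x : M} :
    x ∈ Gam J M ↔ J ≤ (Ideal.torsionOf R M x).radical := Iff.rfl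

lemma Gam_mono {J J' : Ideal R} (h : J ≤ J'.radical) : Gam J' M ≤ Gam J M := by
  intro x hx
  rw [mem_Gam] at *
  refine h.trans ?_
  rw [← Ideal.radical_idem (Ideal.torsionOf R M x)]
  exact Ideal.radical_mono hx

lemma Gam_mono' {J J' : Ideal R} (h : J ≤ J') : Gam J' M ≤ Gam J M :=
  Gam_mono (h.trans Ideal.le_radical)

lemma mem_Gam_sup {J J' : Ideal R} {x : M} :
    x ∈ Gam (J ⊔ J') M ↔ x ∈ Gam J M ∧ x ∈ Gam J' M := by
  simp [mem_Gam]

lemma mem_Gam_span {f : R} {x : M} :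
    x ∈ Gam (Ideal.span {f}) M ↔ ∃ n, f ^ n • x = 0 := by
  rw [mem_Gam, Ideal.span_singleton_le_iff_mem]
  rfl

lemma Gam_bot : Gam (⊥ : Ideal R) M = ⊤ := by
  ext x; simp [mem_Gam]

lemma mem_Gam_iff_pow [IsNoetherianRing R] {J : Ideal R} {x : M} :
    x ∈ Gam J M ↔ ∃ n, ∀ j ∈ J ^ n, j • x = 0 := by
  constructor
  · intro h
    obtain ⟨n, hn⟩ := Ideal.exists_pow_le_of_le_radical_of_fg h (IsNoetherian.noetherian J)
    exact ⟨n, fun j hj => hn hj⟩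
  · rintro ⟨n, hn⟩ j hj
    exact ⟨n, hn _ (Ideal.pow_mem_pow hj n)⟩

lemma Gam_map {N : Type*} [AddCommGroup N] [Module R N] {J : Ideal R} {x : M} (φ : M →ₗ[R] N)
    (hx : x ∈ Gam J M) : φ x ∈ Gam J N := by
  intro j hj
  obtain ⟨n, hn⟩ := hx hj
  refine ⟨n, ?_⟩
  rw [Ideal.mem_torsionOf_iff] at *
  rw [← map_smul, hn, map_zero]

lemma Gam_div [IsNoetherianRing R] [IsDomain R] (hM : Module.Baer R M) {J : Ideal R} {x : M}
    (hx : x ∈ Gam J M) {f : R} (hf : f ≠ 0) : ∃ y ∈ Gam J M, f • y = x := by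
  obtain ⟨n, hn⟩ := mem_Gam_iff_pow.1 hx
  obtain ⟨k, hk⟩ := Ideal.exists_pow_inf_eq_pow_smul J (Ideal.span {f})
  have hk' := hk (k + n) (by omega)
  let a : R →ₗ.[R] M := LinearPMap.mkSpanSingleton' f x (by
    intro c hc
    have : c = 0 := by simpa [hf] using hc
    simp [this])
  let b : R →ₗ.[R] M := ⟨J ^ (k + n), 0⟩
  have hab : ∀ (p : a.domain) (q : b.domain), (p : R) = q → a p = b q := by
    rintro ⟨p, hp⟩ ⟨q, hq⟩ hpq
    change p = q at hpq
    subst hpq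
    change a ⟨p, hp⟩ = 0
    have hp' : p ∈ Ideal.span {f} := hp
    have h1 : p ∈ (J ^ (k + n) • (⊤ : Ideal R) ⊓ Ideal.span {f}) := by
      refine ⟨?_, hp'⟩
      have : p ∈ J ^ (k+n) := hq
      simpa using this
    rw [hk'] at h1
    have h2 : p ∈ J ^ n * Ideal.span {f} := by
      have : (J ^ (k + n - k) • (J ^ k • (⊤ : Ideal R) ⊓ Ideal.span {f})) ≤
          J ^ n * Ideal.span {f} := by
        rw [Nat.add_sub_cancel_left, smul_eq_mul]
        exact Ideal.mul_mono_right inf_le_right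
      exact this h1
    rw [Ideal.mem_mul_span_singleton] at h2
    obtain ⟨z, hz, rfl⟩ := h2
    have := LinearPMap.mkSpanSingleton'_apply f x (by
      intro c hc
      have : c = 0 := by simpa [hf] using hc
      simp [this]) z hp
    exact this.trans (hn z hz)
  let c := LinearPMap.sup a b hab
  obtain ⟨g, hg⟩ := hM c.domain c.toFun
  have hca : ∀ (p : R) (hp : p ∈ a.domain), g p = a ⟨p, hp⟩ := by
    intro p hp
    have h1 := (LinearPMap.left_le_sup a b hab).1 hp
    rw [hg p h1]
    exact ((LinearPMap.left_le_sup a b hab).2 (x := ⟨p, hp⟩) (y := ⟨p, h1⟩) rfl).symm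
  have hcb : ∀ (p : R) (hp : p ∈ b.domain), g p = b ⟨p, hp⟩ := by
    intro p hp
    have h1 := (LinearPMap.right_le_sup a b hab).1 hp
    rw [hg p h1]
    exact ((LinearPMap.right_le_sup a b hab).2 (x := ⟨p, hp⟩) (y := ⟨p, h1⟩) rfl).symm
  refine ⟨g 1, mem_Gam_iff_pow.2 ⟨k + n, fun j hj => ?_⟩, ?_⟩
  · rw [← map_smul, smul_eq_mul, mul_one, hcb j hj]; rfl
  · rw [← map_smul, smul_eq_mul, mul_one, hca f (Ideal.mem_span_singleton_self f)]
    have H : ∀ c : R, c • f = 0 → (RingHom.id R c) • x = 0 := by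
      intro c hc
      have : c = 0 := by simpa [hf] using hc
      simp [this]
    have := LinearPMap.mkSpanSingleton'_apply f x H (1 : R)
      (by simp [Submodule.mem_span_singleton_self])
    simp only [one_smul, map_one] at this
    exact this

end gam

/-- elementary form of an injective resolution of `R` -/
structure IRes (R : Type u) [CommRing R] where
  E : ℕ → Type u
  [acg : ∀ i, AddCommGroup (E i)]
  [md : ∀ i, Module R (E i)]
  d : ∀ i, E i →ₗ[R] E (i + 1)
  ι : R →ₗ[R] E 0
  ι_inj : Function.Injective ι
  ex0 : Function.Exact ι (d 0)
  ex : ∀ i, Function.Exact (d i) (d (i + 1))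
  baer : ∀ i, Module.Baer R (E i)

attribute [instance] IRes.acg IRes.md

section
variable {R : Type u} [CommRing R] (I : IRes R)

def Z (J : Ideal R) (i : ℕ) (ξ : I.E i) : Prop := ξ ∈ Gam J (I.E i) ∧ I.d i ξ = 0

def B (J : Ideal R) : (i : ℕ) → I.E i → Prop
  | 0, ξ => ξ = 0
  | i + 1, ξ => ∃ w ∈ Gam J (I.E i), I.d i w = ξ

def Van (J : Ideal R) (i : ℕ) : Prop := ∀ ξ, Z I J i ξ → B I J i ξ

variable {I}

lemma dd (i : ℕ) (x : I.E i) : I.d (i + 1) (I.d i x) = 0 := (I.ex i).apply_apply_eq_zero x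

lemma B_Z {J : Ideal R} {i : ℕ} {ξ : I.E i} (h : B I J i ξ) : Z I J i ξ := by
  cases i with
  | zero => cases h; exact ⟨zero_mem _, map_zero _⟩
  | succ i =>
    obtain ⟨w, hw, rfl⟩ := h
    exact ⟨Gam_map _ hw, dd _ _⟩

lemma B_zero {J : Ideal R} {i : ℕ} : B I J i 0 := by
  cases i with
  | zero => rfl
  | succ i => exact ⟨0, zero_mem _, map_zero _⟩

lemma B_add {J : Ideal R} {i : ℕ} {ξ η : I.E i} (h : B I J i ξ) (h' : B I J i η) :
    B I J i (ξ + η) := by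
  cases i with
  | zero => cases h; cases h'; exact add_zero _
  | succ i =>
    obtain ⟨w, hw, rfl⟩ := h
    obtain ⟨w', hw', rfl⟩ := h'
    exact ⟨w + w', add_mem hw hw', map_add _ _ _⟩

lemma B_mono {J J' : Ideal R} (hJ : J ≤ J'.radical) {i : ℕ} {ξ : I.E i} (h : B I J' i ξ) :
    B I J i ξ := by
  cases i with
  | zero => exact h
  | succ i =>
    obtain ⟨w, hw, rfl⟩ := h
    exact ⟨w, Gam_mono hJ hw, rfl⟩

lemma Z_mono {J J' : Ideal R} (hJ : J ≤ J'.radical) {i : ℕ} {ξ : I.E i} (h : Z I J' i ξ) :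
    Z I J i ξ := ⟨Gam_mono hJ h.1, h.2⟩

lemma Van_congr {J J' : Ideal R} (hJ : J.radical = J'.radical) {i : ℕ} (h : Van I J i) :
    Van I J' i := by
  intro ξ hξ
  have h1 : J ≤ J'.radical := hJ ▸ Ideal.le_radical
  have h2 : J' ≤ J.radical := hJ ▸ Ideal.le_radical
  exact B_mono h2 (h ξ (Z_mono h1 hξ))

variable [IsNoetherianRing R] [IsDomain R]

lemma B_div {J : Ideal R} {i : ℕ} {ξ : I.E i} (h : B I J i ξ) {f : R} (hf : f ≠ 0) :
    ∃ η, B I J i η ∧ f • η = ξ := by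
  cases i with
  | zero => cases h; exact ⟨0, rfl, smul_zero _⟩
  | succ i =>
    obtain ⟨w, hw, rfl⟩ := h
    obtain ⟨y, hy, rfl⟩ := Gam_div (I.baer i) hw hf
    exact ⟨I.d i y, ⟨y, hy, rfl⟩, (map_smul _ _ _).symm⟩

def VJ (I : IRes R) (J : Ideal R) (z : R) (i : ℕ) : Prop :=
  ∀ ξ, Z I J i ξ → ∃ s : ℕ, B I J i (z ^ s • ξ)

lemma VJ_of {g J : Ideal R} {z : R} {i : ℕ} (hg : g ≤ J) (hz : ∀ j ∈ J, z * j ∈ g.radical)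
    (h : Van I g i) : VJ I J z i := by
  intro ξ hξ
  have h1 := h ξ (Z_mono (hg.trans Ideal.le_radical) hξ)
  cases i with
  | zero => exact ⟨0, by cases h1; exact smul_zero _⟩
  | succ i =>
    obtain ⟨y, hy, rfl⟩ := h1
    have hle : Ideal.span {z} * J ≤ g.radical := by
      rw [Ideal.mul_le]
      intro r hr s hs
      obtain ⟨a, rfl⟩ := Ideal.mem_span_singleton.1 hr
      rw [mul_right_comm]
      exact Ideal.mul_mem_right _ _ (hz s hs)
    have := Gam_mono hle hy
    obtain ⟨s, hs⟩ := mem_Gam_iff_pow.1 this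
    refine ⟨s, z ^ s • y, mem_Gam_iff_pow.2 ⟨s, fun j hj => ?_⟩, map_smul _ _ _⟩
    rw [← mul_smul]
    apply hs
    rw [mul_pow, mul_comm j]
    exact Ideal.mul_mem_mul (Ideal.pow_mem_pow (Ideal.mem_span_singleton_self z) s) hj

lemma step_down {J : Ideal R} {z : R} (hz : z ≠ 0) {c : ℕ} (h1 : VJ I J z c)
    (h2 : Van I (J ⊔ Ideal.span {z}) c) : Van I J c := by
  intro ξ hξ
  obtain ⟨s, hs⟩ := h1 ξ hξ
  obtain ⟨η, hη, he⟩ := B_div hs (pow_ne_zero s hz)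
  have h3 := h2 (ξ - η) ⟨mem_Gam_sup.2 ⟨sub_mem hξ.1 (B_Z hη).1, mem_Gam_span.2 ⟨s, by
    rw [smul_sub, he, sub_self]⟩⟩, by rw [map_sub, hξ.2, (B_Z hη).2, sub_zero]⟩
  have h4 : B I J c (ξ - η) := B_mono (le_sup_left.trans Ideal.le_radical) h3
  simpa using B_add h4 hη

lemma step_up {J : Ideal R} {z : R} (hz : z ≠ 0) {c : ℕ} (h1 : VJ I J z c)
    (h2 : Van I J (c + 1)) : Van I (J ⊔ Ideal.span {z}) (c + 1) := by
  intro ξ hξ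
  obtain ⟨y, hy, rfl⟩ := h2 ξ (Z_mono (le_sup_left.trans Ideal.le_radical) hξ)
  obtain ⟨m, hm⟩ := mem_Gam_span.1 (mem_Gam_sup.1 hξ.1).2
  obtain ⟨s, hs⟩ := h1 (z ^ m • y) ⟨Submodule.smul_mem _ _ hy, by rw [map_smul, hm]⟩
  rw [← mul_smul] at hs
  obtain ⟨η, hη, he⟩ := B_div hs (mul_ne_zero (pow_ne_zero s hz) (pow_ne_zero m hz))
  refine ⟨y - η, mem_Gam_sup.2 ⟨sub_mem hy (B_Z hη).1, mem_Gam_span.2 ⟨s + m, ?_⟩⟩, ?_⟩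
  · rw [smul_sub, pow_add, he, sub_self]
  · rw [map_sub, (B_Z hη).2, sub_zero]

/-- span of a list -/
def sp (l : List R) : Ideal R := Ideal.span {x | x ∈ l}

lemma sp_nil : sp ([] : List R) = ⊥ := by simp [sp]

lemma sp_cons (f : R) (l : List R) : sp (f :: l) = sp l ⊔ Ideal.span {f} := by
  rw [sp, sp, ← Ideal.span_union]
  congr 1
  ext x; simp [or_comm]

lemma van_list (l : List R) : ∀ i, l.length < i → Van I (sp l) i := by
  induction l with
  | nil =>
    intro i hi ξ hξ
    obtain ⟨i, rfl⟩ : ∃ j, i = j + 1 := ⟨i - 1, by simp at hi; omega⟩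
    obtain ⟨w, rfl⟩ := (I.ex i ξ).1 hξ.2
    exact ⟨w, by rw [sp_nil, Gam_bot]; trivial, rfl⟩
  | cons f l ih =>
    intro i hi
    simp only [List.length_cons] at hi
    obtain ⟨i, rfl⟩ : ∃ j, i = j + 1 := ⟨i - 1, by omega⟩
    rw [sp_cons]
    by_cases hf : f = 0
    · subst hf
      simp only [Ideal.span_singleton_zero, bot_le, sup_of_le_left]
      exact ih _ (by omega)
    · exact step_up hf (fun ξ hξ => ⟨0, by simpa using ih i (by omega) ξ hξ⟩) (ih _ (by omega))

/-! ### Cech-type criterion -/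

def pw : List R → ℕ → Ideal R
  | [], _ => ⊥
  | f :: l, M => pw l M ⊔ Ideal.span {f ^ M}

lemma pw_mul (l : List R) (M : ℕ) {x : R} (hx : x ∈ pw l M) (k : ℕ) :
    l.prod ^ k * x ∈ pw l (M + k) := by
  induction l generalizing x with
  | nil => simp only [pw, Ideal.mem_bot] at *; simp [hx]
  | cons f l ih =>
    obtain ⟨a, ha, b, hb, rfl⟩ := Submodule.mem_sup.1 hx
    obtain ⟨c, rfl⟩ := Ideal.mem_span_singleton.1 hb
    rw [List.prod_cons, mul_add]
    refine Submodule.add_mem_sup ?_ ?_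
    · rw [mul_pow, mul_assoc]
      exact Ideal.mul_mem_left _ _ (ih ha)
    · exact Ideal.mem_span_singleton.2 ⟨l.prod ^ k * c, by ring⟩

def Q (l : List R) (L : ℕ) (x : R) : Prop := ∃ N, l.prod ^ N * x ∈ pw l (N + L)

variable (I) in
def rho : (l : List R) → ℕ → R → I.E l.length → Prop
  | [], _, x, ξ => ξ = I.ι x
  | f :: l, L, x, ξ => ∃ u ∈ Gam (sp l) (I.E l.length), ∃ v ∈ Gam (sp (f :: l)) (I.E l.length),
      rho l L x (f ^ L • u) ∧ ξ = I.d _ u + I.d _ v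

lemma rho_Z (l : List R) {L : ℕ} {x : R} {ξ : I.E l.length} (h : rho I l L x ξ) :
    Z I (sp l) l.length ξ := by
  induction l with
  | nil =>
    cases h
    exact ⟨by rw [sp_nil, Gam_bot]; trivial, I.ex0.apply_apply_eq_zero x⟩
  | cons f l ih =>
    obtain ⟨u, hu, v, hv, hr, rfl⟩ := h
    have := ih hr
    refine ⟨add_mem ?_ (Gam_map _ hv), by
      change I.d (l.length + 1) _ = 0
      rw [map_add, dd, dd, add_zero]⟩
    rw [sp_cons, mem_Gam_sup]
    exact ⟨Gam_map _ hu, mem_Gam_span.2 ⟨L, by rw [← map_smul, this.2]⟩⟩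

lemma rho_add (l : List R) {L : ℕ} {x y : R} {ξ η : I.E l.length} (h : rho I l L x ξ)
    (h' : rho I l L y η) : rho I l L (x + y) (ξ + η) := by
  induction l generalizing x y with
  | nil => cases h; cases h'; exact (map_add _ _ _).symm
  | cons f l ih =>
    obtain ⟨u, hu, v, hv, hr, rfl⟩ := h
    obtain ⟨u', hu', v', hv', hr', rfl⟩ := h'
    refine ⟨u + u', add_mem hu hu', v + v', add_mem hv hv', ?_, ?_⟩
    · rw [smul_add]; exact ih hr hr'
    · rw [map_add, map_add, add_add_add_comm]

lemma rho_smul (l : List R) {L : ℕ} {x : R} (c : R) {ξ : I.E l.length} (h : rho I l L x ξ) :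
    rho I l L (c * x) (c • ξ) := by
  induction l generalizing x with
  | nil => cases h; exact (map_smul _ c x).symm
  | cons f l ih =>
    obtain ⟨u, hu, v, hv, hr, rfl⟩ := h
    refine ⟨c • u, Submodule.smul_mem _ _ hu, c • v, Submodule.smul_mem _ _ hv, ?_, ?_⟩
    · rw [smul_comm]; exact ih hr
    · rw [map_smul, map_smul, smul_add]

lemma rho_sub (l : List R) {L : ℕ} {x y : R} {ξ η : I.E l.length} (h : rho I l L x ξ)
    (h' : rho I l L y η) : rho I l L (x - y) (ξ - η) := by
  have := rho_add l h (rho_smul l (-1) h')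
  simpa [sub_eq_add_neg] using this

lemma rho_shift (l : List R) {L : ℕ} {x : R} {ξ : I.E l.length} (h : rho I l L x ξ) (k : ℕ) :
    rho I l (L + k) (l.prod ^ k * x) ξ := by
  induction l generalizing x with
  | nil => cases h; simp [rho]
  | cons f l ih =>
    obtain ⟨u, hu, v, hv, hr, rfl⟩ := h
    refine ⟨u, hu, v, hv, ?_, rfl⟩
    have := rho_smul l (f ^ k) (ih hr)
    rw [List.prod_cons, mul_pow, mul_assoc, pow_add, mul_comm (f ^ L), mul_smul]
    exact this

lemma rho_ex (l : List R) (hl : ∀ f ∈ l, f ≠ 0) (L : ℕ) (x : R) : ∃ ξ, rho I l L x ξ := by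
  induction l with
  | nil => exact ⟨_, rfl⟩
  | cons f l ih =>
    obtain ⟨ζ, hζ⟩ := ih (fun g hg => hl g (List.mem_cons_of_mem _ hg))
    obtain ⟨u, hu, rfl⟩ := Gam_div (I.baer _) (rho_Z l hζ).1
      (pow_ne_zero L (hl f (List.mem_cons_self)))
    exact ⟨_, u, hu, 0, zero_mem _, hζ, rfl⟩

lemma rho_surj (l : List R) (ξ : I.E l.length) (h : Z I (sp l) l.length ξ) :
    ∃ L x, rho I l L x ξ := by
  induction l with
  | nil =>
    obtain ⟨x, hx⟩ := (I.ex0 ξ).1 h.2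
    exact ⟨0, x, hx.symm⟩
  | cons f l ih =>
    have h' := h
    simp only [sp_cons] at h'
    obtain ⟨u, hu, rfl⟩ := van_list l (l.length + 1) (by omega) ξ
      (Z_mono (le_sup_left.trans Ideal.le_radical) h')
    obtain ⟨L, hL⟩ := mem_Gam_span.1 (mem_Gam_sup.1 h'.1).2
    obtain ⟨L1, x, hx⟩ := ih (f ^ L • u) ⟨Submodule.smul_mem _ _ hu, by
      rw [map_smul]; exact hL⟩
    refine ⟨L1 + L, f ^ L1 * (l.prod ^ L * x), u, hu, 0, zero_mem _, ?_, by
      rw [map_zero, add_zero]⟩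
    rw [pow_add, mul_smul]
    exact rho_smul l _ (rho_shift l hx L)

lemma rho_B (l : List R) (hl : ∀ f ∈ l, f ≠ 0) {L : ℕ} {x : R} {ξ : I.E l.length}
    (h : rho I l L x ξ) : B I (sp l) l.length ξ ↔ Q l L x := by
  induction l generalizing L x with
  | nil =>
    cases h
    simp only [Q, pw, List.prod_nil, one_pow, one_mul, Ideal.mem_bot, exists_const]
    exact map_eq_zero_iff _ I.ι_inj
  | cons f l ih =>
    have ih := fun L x ξ => @ih (fun g hg => hl g (List.mem_cons_of_mem _ hg)) L x ξ
    have hf : f ≠ 0 := hl f List.mem_cons_self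
    obtain ⟨u, hu, v, hv, hr, rfl⟩ := h
    constructor
    · rintro ⟨w, hw, he⟩
      have hvw := sub_mem hv hw
      rw [sp_cons, mem_Gam_sup] at hvw
      obtain ⟨hvw1, hvw2⟩ := hvw
      obtain ⟨m, hm⟩ := mem_Gam_span.1 hvw2
      obtain ⟨L1, y, hy⟩ := rho_surj l (u + (v - w)) ⟨add_mem hu hvw1, by
        rw [map_add, map_sub, he]; abel⟩
      have e1 := rho_smul l (f ^ (m + L)) hy
      have e2 := rho_smul l (f ^ m) hr
      have e1' := rho_shift l e1 L
      have e2' := rho_shift l e2 L1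
      rw [add_comm L1] at e1'
      have e3 := rho_sub l e2' e1'
      have hz : f ^ m • f ^ L • u - f ^ (m + L) • (u + (v - w)) = 0 := by
        rw [smul_add, pow_add, mul_smul, mul_smul, smul_comm (f ^ m) (f ^ L) (v - w), hm,
          smul_zero, add_zero, sub_self]
      rw [hz] at e3
      obtain ⟨N, hN⟩ := (ih _ _ _ e3).1 B_zero
      refine ⟨N + L1 + m, ?_⟩
      have key := pw_mul l _ hN m
      have : (f :: l).prod ^ (N + L1 + m) * x =
          f ^ (N + L1) * (l.prod ^ m * (l.prod ^ N * (l.prod ^ L1 * (f ^ m * x) -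
            l.prod ^ L * (f ^ (m + L) * y)))) +
          f ^ (N + L1 + m + L) * (l.prod ^ (m + N + L) * y) := by
        rw [List.prod_cons]; ring
      rw [this]
      refine Submodule.add_mem_sup (Ideal.mul_mem_left _ _ ?_)
        (Ideal.mul_mem_right _ _ (Ideal.mem_span_singleton_self _))
      convert key using 2
      ring
    · rintro ⟨N, hN⟩
      obtain ⟨b, hb, c, hc, he⟩ := Submodule.mem_sup.1 hN
      obtain ⟨a, rfl⟩ := Ideal.mem_span_singleton.1 hc
      have e1 := rho_smul l (f ^ N) (rho_shift l hr N)
      obtain ⟨ξa, ha⟩ := rho_ex (I := I) l (fun g hg => hl g (List.mem_cons_of_mem _ hg)) (L + N) a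
      have e2 := rho_sub l e1 (rho_smul l (f ^ (N + L)) ha)
      have hx : f ^ N * (l.prod ^ N * x) - f ^ (N + L) * a = b := by
        rw [List.prod_cons] at he
        linear_combination -he
      have hy : f ^ N • f ^ L • u - f ^ (N + L) • ξa = f ^ (N + L) • (u - ξa) := by
        rw [smul_sub, pow_add, mul_smul, mul_smul]
      rw [hx, hy] at e2
      obtain ⟨η, hη, hη'⟩ := B_div ((ih _ _ _ e2).2 ⟨0, by
        simpa [add_comm] using hb⟩) (pow_ne_zero (N + L) hf)
      refine ⟨u - ξa - η + v, add_mem ?_ hv, ?_⟩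
      · rw [sp_cons, mem_Gam_sup]
        refine ⟨sub_mem (sub_mem hu (rho_Z l ha).1) (B_Z hη).1, mem_Gam_span.2 ⟨N + L, ?_⟩⟩
        rw [smul_sub, hη', sub_self]
      · rw [map_add, map_sub, map_sub, (rho_Z l ha).2, (B_Z hη).2, sub_zero, sub_zero]

lemma van_iff (l : List R) (hl : ∀ f ∈ l, f ≠ 0) :
    Van I (sp l) l.length ↔ ∀ L x, Q l L x := by
  constructor
  · intro h L x
    obtain ⟨ξ, hξ⟩ := rho_ex (I := I) l hl L x
    exact (rho_B l hl hξ).1 (h ξ (rho_Z l hξ))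
  · intro h ξ hξ
    obtain ⟨L, x, hx⟩ := rho_surj l ξ hξ
    exact (rho_B l hl hx).2 (h L x)

end
end LC

namespace LC
open CategoryTheory Limits Opposite
universe u

section rep
variable {R : Type u} [CommRing R] (A : ChainComplex (ModuleCat.{u} R)ᵒᵖ ℕ) (n : ℕ)

def Rep (φ : (A.X n).unop) (a : (A.homology n).unop) : Prop :=
  ∃ c : (A.opcycles n).unop, (A.pOpcycles n).unop c = φ ∧ (A.homologyι n).unop c = a

lemma rep_surj (a : (A.homology n).unop) : ∃ φ, Rep A n φ a := by
  have : Function.Surjective (A.homologyι n).unop :=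
    (ModuleCat.epi_iff_surjective _).1 inferInstance
  obtain ⟨c, hc⟩ := this a
  exact ⟨_, c, rfl, hc⟩

lemma pOp_inj : Function.Injective (A.pOpcycles n).unop :=
    (ModuleCat.mono_iff_injective _).1 inferInstance

lemma rep_cocycle {φ : (A.X n).unop} {a : (A.homology n).unop} (h : Rep A n φ a) :
    (A.d (n + 1) n).unop φ = 0 := by
  obtain ⟨c, rfl, -⟩ := h
  have : (A.pOpcycles n).unop ≫ (A.d (n + 1) n).unop = 0 := by
    rw [← unop_comp, A.d_pOpcycles]; rfl
  exact congr($this c)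

lemma rep_of_cocycle (φ : (A.X n).unop) (h : (A.d (n + 1) n).unop φ = 0) :
    ∃ a, Rep A n φ a := by
  let S := ShortComplex.mk (A.d (n + 1) n) (A.pOpcycles n) (by simp)
  have hS : S.Exact := ShortComplex.exact_of_g_is_cokernel _
    (A.opcyclesIsCokernel (n + 1) n (by simp))
  have := hS.unop
  rw [ShortComplex.moduleCat_exact_iff] at this
  obtain ⟨c, hc⟩ := this φ h
  exact ⟨_, c, hc, rfl⟩

lemma rep_zero_iff {φ : (A.X (n + 1)).unop} {a : (A.homology (n + 1)).unop}
    (h : Rep A (n + 1) φ a) : a = 0 ↔ ∃ ψ, (A.d (n + 1) n).unop ψ = φ := by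
  obtain ⟨c, rfl, rfl⟩ := h
  let S := ShortComplex.mk (A.homologyι (n + 1)) (A.fromOpcycles (n + 1) n) (by simp)
  have hS : S.Exact := ShortComplex.exact_of_f_is_kernel _
    (A.homologyIsKernel (n + 1) n (by simp))
  have h1 := hS.unop
  rw [ShortComplex.moduleCat_exact_iff] at h1
  have h2 : (A.fromOpcycles (n + 1) n).unop ≫ (A.pOpcycles (n + 1)).unop
    = (A.d (n + 1) n).unop := by rw [← unop_comp, A.p_fromOpcycles]
  have h3 : (A.fromOpcycles (n + 1) n).unop ≫ (A.homologyι (n + 1)).unop = 0 := by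
    rw [← unop_comp, A.homologyι_comp_fromOpcycles]; rfl
  constructor
  · intro h
    obtain ⟨ψ, hψ⟩ := h1 c h
    refine ⟨ψ, ?_⟩
    rw [← h2]
    exact congrArg _ hψ
  · rintro ⟨ψ, hψ⟩
    rw [← h2] at hψ
    have := pOp_inj A (n + 1) hψ
    rw [← this]
    exact congr($h3 ψ)

lemma rep_nat {A A' : ChainComplex (ModuleCat.{u} R)ᵒᵖ ℕ} (f : A' ⟶ A) {n : ℕ}
    {φ : (A.X n).unop} {a : (A.homology n).unop} (h : Rep A n φ a) :
    Rep A' n ((f.f n).unop φ) ((HomologicalComplex.homologyMap f n).unop a) := by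
  obtain ⟨c, rfl, rfl⟩ := h
  refine ⟨(HomologicalComplex.opcyclesMap f n).unop c, ?_, ?_⟩
  · have : (HomologicalComplex.opcyclesMap f n).unop ≫ (A'.pOpcycles n).unop =
        (A.pOpcycles n).unop ≫ (f.f n).unop := by
      rw [← unop_comp, ← unop_comp, HomologicalComplex.p_opcyclesMap]
    exact congr($this c)
  · have : (HomologicalComplex.opcyclesMap f n).unop ≫ (A'.homologyι n).unop =
        (A.homologyι n).unop ≫ (HomologicalComplex.homologyMap f n).unop := by
      rw [← unop_comp, ← unop_comp, HomologicalComplex.homologyι_naturality]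
    exact congr($this c)
end rep

section ext
variable {R : Type u} [CommRing R]

noncomputable abbrev cx (P : ChainComplex (ModuleCat.{u} R) ℕ) (Y : ModuleCat.{u} R) :
    ChainComplex (ModuleCat.{u} R)ᵒᵖ ℕ :=
  (((linearYoneda R (ModuleCat.{u} R)).obj Y).rightOp.mapHomologicalComplex _).obj P

/-- relation between old Ext classes and new Ext classes -/
def Rel (X Y : ModuleCat.{u} R) (i : ℕ)
    (a : ((_root_.Ext R (ModuleCat.{u} R) i).obj (op X)).obj Y) (α : Abelian.Ext.{u} X Y i) : Prop :=
  ∃ (φ : (projectiveResolution X).complex.X i ⟶ Y)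
    (h : (projectiveResolution X).complex.d (i + 1) i ≫ φ = 0),
    Rep (cx (projectiveResolution X).complex Y) i φ
      (((projectiveResolution X).isoLeftDerivedObj
        ((linearYoneda R (ModuleCat.{u} R)).obj Y).rightOp i).inv.unop a) ∧
    (projectiveResolution X).extMk φ (i + 1) rfl h = α

lemma rel_left (X Y : ModuleCat.{u} R) (i : ℕ)
    (a : ((_root_.Ext R (ModuleCat.{u} R) i).obj (op X)).obj Y) : ∃ α, Rel X Y i a α := by
  obtain ⟨φ, hφ⟩ := rep_surj (cx (projectiveResolution X).complex Y) i
    (((projectiveResolution X).isoLeftDerivedObj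
        ((linearYoneda R (ModuleCat.{u} R)).obj Y).rightOp i).inv.unop a)
  exact ⟨_, φ, rep_cocycle _ _ hφ, hφ, rfl⟩

lemma rel_right (X Y : ModuleCat.{u} R) (i : ℕ) (α : Abelian.Ext.{u} X Y i) :
    ∃ a, Rel X Y i a α := by
  obtain ⟨φ, hφ, rfl⟩ := (projectiveResolution X).extMk_surjective α (i + 1) rfl
  obtain ⟨a, ha⟩ := rep_of_cocycle (cx (projectiveResolution X).complex Y) i φ hφ
  refine ⟨((projectiveResolution X).isoLeftDerivedObj
        ((linearYoneda R (ModuleCat.{u} R)).obj Y).rightOp i).hom.unop a, φ, hφ, ?_, rfl⟩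
  have : ((projectiveResolution X).isoLeftDerivedObj
        ((linearYoneda R (ModuleCat.{u} R)).obj Y).rightOp i).hom.unop ≫
        ((projectiveResolution X).isoLeftDerivedObj
        ((linearYoneda R (ModuleCat.{u} R)).obj Y).rightOp i).inv.unop = 𝟙 _ := by
    rw [← unop_comp, Iso.inv_hom_id]; rfl
  have h2 := congr($this a)
  exact Eq.mpr (congrArg (Rep (cx (projectiveResolution X).complex Y) i φ) h2) ha

lemma rel_zero (X Y : ModuleCat.{u} R) (i : ℕ)
    (a : ((_root_.Ext R (ModuleCat.{u} R) (i + 1)).obj (op X)).obj Y)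
    (α : Abelian.Ext.{u} X Y (i + 1)) (h : Rel X Y (i + 1) a α) : a = 0 ↔ α = 0 := by
  obtain ⟨φ, hφ, hr, rfl⟩ := h
  have h1 := rep_zero_iff _ _ hr
  rw [ProjectiveResolution.extMk_eq_zero_iff _ _ _ _ _ i rfl]
  refine Iff.trans ?_ h1
  constructor
  · rintro rfl
    exact map_zero _
  · intro h
    have : ((projectiveResolution X).isoLeftDerivedObj
        ((linearYoneda R (ModuleCat.{u} R)).obj Y).rightOp (i + 1)).inv.unop ≫
        ((projectiveResolution X).isoLeftDerivedObj
        ((linearYoneda R (ModuleCat.{u} R)).obj Y).rightOp (i + 1)).hom.unop = 𝟙 _ := by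
      rw [← unop_comp, Iso.hom_inv_id]; rfl
    have h2 := congr($this a)
    refine h2.symm.trans ?_
    refine (congrArg (((projectiveResolution X).isoLeftDerivedObj
        ((linearYoneda R (ModuleCat.{u} R)).obj Y).rightOp (i + 1)).hom.unop) h).trans ?_
    exact map_zero _

lemma rel_nat {X X' : ModuleCat.{u} R} (g : X' ⟶ X) (Y : ModuleCat.{u} R) (i : ℕ)
    (a : ((_root_.Ext R (ModuleCat.{u} R) i).obj (op X)).obj Y)
    (α : Abelian.Ext.{u} X Y i) (h : Rel X Y i a α) :
    Rel X' Y i (((_root_.Ext R (ModuleCat.{u} R) i).map g.op).app Y a)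
      ((Abelian.Ext.mk₀ g).comp α (zero_add _)) := by
  obtain ⟨φ, hφ, hr, rfl⟩ := h
  let f : ProjectiveResolution.Hom (projectiveResolution X') (projectiveResolution X) g :=
    ⟨ProjectiveResolution.lift g _ _, by
      rw [ProjectiveResolution.lift_commutes_zero]; simp⟩
  rw [ProjectiveResolution.mk₀_comp_extMk _ _ _ _ f]
  refine ⟨f.hom.f i ≫ φ, _, ?_, rfl⟩
  have h1 := rep_nat ((((linearYoneda R (ModuleCat.{u} R)).obj Y).rightOp.mapHomologicalComplex
    _).map f.hom) hr
  have h2 := ProjectiveResolution.isoLeftDerivedObj_inv_naturality g (projectiveResolution X')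
    (projectiveResolution X) f.hom (ProjectiveResolution.lift_commutes_zero _ _ _)
    ((linearYoneda R (ModuleCat.{u} R)).obj Y).rightOp i
  have h3 := congrArg Quiver.Hom.unop h2
  have h4 := congr($h3 a)
  exact Eq.mpr (congrArg (Rep (cx (projectiveResolution X').complex Y) i (f.hom.f i ≫ φ)) h4) h1

end ext
end LC

namespace LC
open CategoryTheory Limits Opposite
universe u

section
variable {R : Type u} [CommRing R]

noncomputable def toIRes (I : InjectiveResolution (ModuleCat.of R R)) : IRes R where
  E i := I.cocomplex.X i
  d i := (I.cocomplex.d i (i + 1)).hom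
  ι := (I.ι.f 0).hom
  ι_inj := (ModuleCat.mono_iff_injective (I.ι.f 0)).1 inferInstance
  ex0 := (ShortComplex.ShortExact.moduleCat_exact_iff_function_exact _).1 I.exact₀
  ex i := (ShortComplex.ShortExact.moduleCat_exact_iff_function_exact _).1 (I.exact_succ i)
  baer i := by
    have := I.injective i
    rw [Module.Baer.iff_injective]
    exact (Module.injective_iff_injective_object R _).2 this

variable (R) in
noncomputable def theI : InjectiveResolution (ModuleCat.of R R) := injectiveResolution _

variable (R) in
noncomputable def theRes : IRes R := toIRes (theI R)

lemma colim_sub {D : Type} [SmallCategory D] [IsFiltered D]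
    (F : D ⥤ ModuleCat.{u} R ⥤ ModuleCat.{u} R) [HasColimit F] (M : ModuleCat.{u} R) :
    Subsingleton ((colimit F).obj M) ↔
      ∀ (j : D) (a : (F.obj j).obj M), ∃ (k : D) (f : j ⟶ k), (F.map f).app M a = 0 := by
  have hp : PreservesFilteredColimitsOfSize.{0, 0} (forget (ModuleCat.{u} R)) :=
    preservesFilteredColimitsOfSize_shrink.{0, u, 0, u} _
  have hc := isColimitOfPreserves ((evaluation _ _).obj M) (colimit.isColimit F)
  constructor
  · intro h j a
    obtain ⟨k, f, g, hfg⟩ := Concrete.isColimit_exists_of_rep_eq _ hc (i := j) (j := j) a 0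
      (@Subsingleton.elim _ h _ _)
    refine ⟨k, f, ?_⟩
    refine Eq.trans hfg ?_
    exact map_zero _
  · intro h
    refine subsingleton_of_forall_eq 0 ?_
    intro x
    obtain ⟨j, y, rfl⟩ := Concrete.isColimit_exists_rep _ hc x
    obtain ⟨k, f, hf⟩ := h j y
    have := ((((evaluation _ _).obj M).mapCocone (colimit.cocone F)).w f)
    have h2 := congr($this y)
    refine h2.symm.trans ?_
    refine Eq.trans (congrArg ((((evaluation _ _).obj M).mapCocone (colimit.cocone F)).ι.app k) hf)
      ?_
    exact map_zero _

/-- the transition maps -/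
noncomputable def tr (J : Ideal R) {n m : ℕ} (h : n ≤ m) :
    ModuleCat.of R (R ⧸ J ^ m) ⟶ ModuleCat.of R (R ⧸ J ^ n) :=
  ModuleCat.ofHom <| Submodule.mapQ _ _ LinearMap.id (Ideal.pow_le_pow_right h)

lemma lc_sub (J : Ideal R) (i : ℕ) (M : ModuleCat.{u} R) :
    Subsingleton ((localCohomology J i).obj M) ↔
      ∀ n (a : ((_root_.Ext R (ModuleCat.{u} R) i).obj (op (ModuleCat.of R (R ⧸ J ^ n)))).obj M),
        ∃ (m : ℕ) (h : n ≤ m), ((_root_.Ext R (ModuleCat.{u} R) i).map (tr J h).op).app M a = 0 := by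
  have := localCohomology.hasColimitDiagram.{u, 0} (localCohomology.idealPowersDiagram J) i
  refine (colim_sub (localCohomology.diagram (localCohomology.idealPowersDiagram J) i) M).trans ?_
  constructor
  · intro h n a
    obtain ⟨k, f, hf⟩ := h (op (op n)) a
    exact ⟨k.unop.unop, f.unop.unop.down.down, hf⟩
  · intro h j a
    obtain ⟨m, hm, h⟩ := h j.unop.unop a
    exact ⟨op (op m), (homOfLE hm).op.op, h⟩

lemma lc_sub' (J : Ideal R) (i : ℕ) (M : ModuleCat.{u} R) :
    Subsingleton ((localCohomology J (i + 1)).obj M) ↔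
      ∀ n (α : Abelian.Ext.{u} (ModuleCat.of R (R ⧸ J ^ n)) M (i + 1)),
        ∃ (m : ℕ) (h : n ≤ m), (Abelian.Ext.mk₀ (tr J h)).comp α (zero_add _) = 0 := by
  rw [lc_sub]
  constructor
  · intro h n α
    obtain ⟨a, ha⟩ := rel_right _ _ _ α
    obtain ⟨m, hm, h0⟩ := h n a
    exact ⟨m, hm, (rel_zero _ _ _ _ _ (rel_nat (tr J hm) _ _ _ _ ha)).1 h0⟩
  · intro h n a
    obtain ⟨α, ha⟩ := rel_left _ _ _ a
    obtain ⟨m, hm, h0⟩ := h n α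
    exact ⟨m, hm, (rel_zero _ _ _ _ _ (rel_nat (tr J hm) _ _ _ _ ha)).2 h0⟩

/-- map from a cyclic module -/
noncomputable def cyc (J : Ideal R) (N : ModuleCat.{u} R) (x : N) (hx : ∀ j ∈ J, j • x = 0) :
    ModuleCat.of R (R ⧸ J) ⟶ N :=
  ModuleCat.ofHom (Submodule.liftQ _ (LinearMap.toSpanSingleton R N x) (fun j hj => hx j hj))

lemma cyc_one (J : Ideal R) (N : ModuleCat.{u} R) (x : N) (hx : ∀ j ∈ J, j • x = 0) :
    cyc J N x hx (Ideal.Quotient.mk J 1) = x := by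
  exact one_smul R x

lemma cyc_ext (J : Ideal R) (N : ModuleCat.{u} R) (f g : ModuleCat.of R (R ⧸ J) ⟶ N)
    (h : f (Ideal.Quotient.mk J 1) = g (Ideal.Quotient.mk J 1)) : f = g := by
  apply ModuleCat.hom_ext
  apply LinearMap.ext
  intro x
  obtain ⟨r, rfl⟩ := Ideal.Quotient.mk_surjective x
  have : (Ideal.Quotient.mk J r) = r • (Ideal.Quotient.mk J 1) := by
    rw [← mul_one r, map_mul, mul_one]; rfl
  rw [this]
  refine (f.hom.map_smul r _).trans (Eq.trans ?_ (g.hom.map_smul r _).symm)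
  exact congrArg (r • ·) h

lemma cyc_kill (J : Ideal R) (N : ModuleCat.{u} R) (f : ModuleCat.of R (R ⧸ J) ⟶ N) (j : R)
    (hj : j ∈ J) : j • f (Ideal.Quotient.mk J 1) = 0 := by
  refine (f.hom.map_smul j _).symm.trans ?_
  have : j • (Ideal.Quotient.mk J 1) = 0 := by
    change Ideal.Quotient.mk J (j * 1) = 0
    rw [mul_one]; exact Ideal.Quotient.eq_zero_iff_mem.2 hj
  exact (congrArg f.hom this).trans (map_zero _)

lemma tr_one (J : Ideal R) {n m : ℕ} (h : n ≤ m) :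
    tr J h (Ideal.Quotient.mk _ 1) = Ideal.Quotient.mk _ 1 := rfl

theorem bridge [IsNoetherianRing R] (J : Ideal R) (i : ℕ) :
    Subsingleton ((localCohomology J (i + 1)).obj (ModuleCat.of R R)) ↔
      Van (theRes R) J (i + 1) := by
  rw [lc_sub']
  constructor
  · rintro h (x : (theI R).cocomplex.X (i + 1)) ⟨hx1, hx2⟩
    obtain ⟨n, hn⟩ := mem_Gam_iff_pow.1 hx1
    let f := cyc (J ^ n) ((theI R).cocomplex.X (i + 1)) x hn
    have hf : f ≫ (theI R).cocomplex.d (i + 1) (i + 2) = 0 := by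
      apply cyc_ext
      refine (congrArg ((theI R).cocomplex.d (i + 1) (i + 2)) (cyc_one _ _ x hn)).trans hx2
    obtain ⟨m, hm, h0⟩ := h n ((theI R).extMk f (i + 2) rfl hf)
    rw [InjectiveResolution.mk₀_comp_extMk,
      InjectiveResolution.extMk_eq_zero_iff _ _ _ _ _ i rfl] at h0
    obtain ⟨g, hg⟩ := h0
    refine ⟨g (Ideal.Quotient.mk _ 1), mem_Gam_iff_pow.2 ⟨m, fun j hj => cyc_kill _ _ g j hj⟩, ?_⟩
    have h2 := congr($hg (Ideal.Quotient.mk _ 1))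
    refine Eq.trans h2 ?_
    exact cyc_one _ _ x hn
  · intro h n α
    obtain ⟨f, hf, rfl⟩ := (theI R).extMk_surjective α (i + 2) rfl
    obtain ⟨w, hw, hd⟩ := h (f (Ideal.Quotient.mk _ 1)) ⟨mem_Gam_iff_pow.2 ⟨n, fun j hj =>
      cyc_kill _ _ f j hj⟩, congr($hf (Ideal.Quotient.mk _ 1))⟩
    obtain ⟨m, hm⟩ := mem_Gam_iff_pow.1 hw
    refine ⟨n + m, Nat.le_add_right _ _, ?_⟩
    rw [InjectiveResolution.mk₀_comp_extMk,
      InjectiveResolution.extMk_eq_zero_iff _ _ _ _ _ i rfl]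
    refine ⟨cyc (J ^ (n + m)) ((theI R).cocomplex.X i) w
      (fun j hj => hm j (Ideal.pow_le_pow_right (Nat.le_add_left _ _) hj)), ?_⟩
    apply cyc_ext
    refine (congrArg ((theI R).cocomplex.d i (i + 1)) (cyc_one _ _ w _)).trans hd
end
end LC

namespace LC
universe u
open Classical in
lemma van_iff' {R : Type u} [CommRing R] {I : IRes R} [IsNoetherianRing R] [IsDomain R]
    (l : List R) : Van I (sp l) l.length ↔ ∀ L x, Q l L x := by
  by_cases h : (0 : R) ∈ l
  · constructor
    · intro _ L x
      refine ⟨1, ?_⟩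
      rw [List.prod_eq_zero h]
      simp
    · intro _
      have h1 : sp l = sp (l.erase 0) := by
        apply le_antisymm
        · refine Ideal.span_le.2 ?_
          intro x hx
          by_cases hx0 : x = 0
          · subst hx0; exact zero_mem _
          · exact Ideal.subset_span ((List.mem_erase_of_ne hx0).2 hx)
        · exact Ideal.span_mono (fun x hx => List.mem_of_mem_erase hx)
      rw [h1]
      refine van_list _ _ ?_
      rw [List.length_erase_of_mem h]
      have := List.length_pos_of_mem h
      omega
  · exact van_iff l (fun f hf hf0 => h (hf0 ▸ hf))

section ara
variable {S : Type*} [CommRing S]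

/-- the two-by-two minor -/
def mn (c c' : S × S) : S := c.1 * c'.2 - c'.1 * c.2

def cg (P : Ideal S) (c c' : S × S) : Prop := c.1 - c'.1 ∈ P ∧ c.2 - c'.2 ∈ P

lemma cg_refl (P : Ideal S) (c : S × S) : cg P c c := by simp [cg]

lemma cg_symm {P : Ideal S} {c c' : S × S} (h : cg P c c') : cg P c' c :=
  ⟨by simpa using neg_mem h.1, by simpa using neg_mem h.2⟩

lemma mn_cg {P : Ideal S} {c c' e e' : S × S} (h : cg P c c') (h' : cg P e e')
    (hm : mn c e ∈ P) : mn c' e' ∈ P := by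
  have : mn c' e' = mn c e - (c.1 - c'.1) * e.2 - (e.2 - e'.2) * c'.1 + (e.1 - e'.1) * c.2 +
      (c.2 - c'.2) * e'.1 := by
    simp only [mn]; ring
  rw [this]
  refine add_mem (add_mem (sub_mem (sub_mem hm ?_) ?_) ?_) ?_ <;>
    apply Ideal.mul_mem_right
  exacts [h.1, h'.2, h'.1, h.2]

lemma mn_zero_right (c : S × S) : mn c (0, 0) = 0 := by simp [mn]

lemma mn_of_col {P : Ideal S} [P.IsPrime] {c a b : S × S} (hc : ¬ (c.1 ∈ P ∧ c.2 ∈ P))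
    (ha : mn c a ∈ P) (hb : mn c b ∈ P) : mn a b ∈ P := by
  have h1 : c.1 * mn a b ∈ P := by
    have : c.1 * mn a b = a.1 * mn c b - b.1 * mn c a := by simp only [mn]; ring
    rw [this]
    exact sub_mem (Ideal.mul_mem_left _ _ hb) (Ideal.mul_mem_left _ _ ha)
  have h2 : c.2 * mn a b ∈ P := by
    have : c.2 * mn a b = a.2 * mn c b - b.2 * mn c a := by simp only [mn]; ring
    rw [this]
    exact sub_mem (Ideal.mul_mem_left _ _ hb) (Ideal.mul_mem_left _ _ ha)
  by_contra hn
  exact hc ⟨(Ideal.IsPrime.mem_or_mem inferInstance h1).resolve_right hn,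
    (Ideal.IsPrime.mem_or_mem inferInstance h2).resolve_right hn⟩

lemma mn_anti (a b : S × S) : mn a b = - mn b a := by simp only [mn]; ring

lemma mn_self (a : S × S) : mn a a = 0 := by simp only [mn]; ring

/-- the new functions after adding a column -/
def nextG (c : S × S) (p : ℕ → S × S) (G : ℕ → S) : ℕ → S
  | 0 => mn c (p 0)
  | 1 => mn c (p 1)
  | i + 2 => mn c (p (i + 2)) + G i

def consP (c : S × S) (p : ℕ → S × S) : ℕ → S × S
  | 0 => c
  | i + 1 => p i

structure Inv (L : List (S × S)) (p : ℕ → S × S) (G : ℕ → S) (r : ℕ) : Prop where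
  hr : 1 ≤ r
  Gz : ∀ i, r ≤ i → G i = 0
  pz : ∀ i, r + 1 ≤ i → p i = (0, 0)
  T : ∀ P : Ideal S, P.IsPrime → ∀ i, (∀ a b, a ≤ i + 1 → b ≤ i + 1 → mn (p a) (p b) ∈ P) → G i ∈ P
  U : ∀ P : Ideal S, P.IsPrime → (∀ i, G i ∈ P) → ∀ a b, mn (p a) (p b) ∈ P
  V1 : ∀ P : Ideal S, P.IsPrime → (∀ i, G i ∈ P) → ∀ j, ∃ c ∈ (0, 0) :: L, cg P c (p j)
  V2 : ∀ P : Ideal S, P.IsPrime → (∀ i, G i ∈ P) → ∀ c ∈ L, ∃ j, cg P (p j) c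
  W : ∀ P : Ideal S, P.IsPrime → (∀ c ∈ L, ∀ c' ∈ L, mn c c' ∈ P) → ∀ i, G i ∈ P

lemma inv_step {L : List (S × S)} {p : ℕ → S × S} {G : ℕ → S} {r : ℕ} (h : Inv L p G r)
    (c c' : S × S) (G' : ℕ → S) (s : ℕ) (hs : r ≤ s + 1) (hs1 : 1 ≤ s) (hs2 : ∀ i, s ≤ i + 2 → G' i = 0)
    (ha : ∀ P : Ideal S, P.IsPrime → ∀ i, G i ∈ P → G' i ∈ P)
    (hb : ∀ P : Ideal S, P.IsPrime → c'.1 ∈ P → c'.2 ∈ P → (∀ i, G' i ∈ P) → ∀ i, G i ∈ P)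
    (hc : ∀ P : Ideal S, P.IsPrime → (∀ i, G i ∈ P) → cg P c' c) (hrs : r < s) :
    Inv (c :: L) (consP c' p) (nextG c' p G') s := by
  have hG'T : ∀ P : Ideal S, P.IsPrime → ∀ i,
      (∀ a b, a ≤ i + 1 → b ≤ i + 1 → mn (p a) (p b) ∈ P) → G' i ∈ P :=
    fun P hP i hi => ha P hP i (h.T P hP i hi)
  have hU : ∀ P : Ideal S, P.IsPrime → (∀ i, nextG c' p G' i ∈ P) →
      (∀ a b, mn (p a) (p b) ∈ P) ∧ ∀ a, mn c' (p a) ∈ P := by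
    intro P hP hG
    by_cases hc' : c'.1 ∈ P ∧ c'.2 ∈ P
    · have h0 : ∀ e, mn c' e ∈ P := by
        intro e
        exact sub_mem (Ideal.mul_mem_right _ _ hc'.1) (Ideal.mul_mem_left _ _ hc'.2)
      refine ⟨h.U P hP (hb P hP hc'.1 hc'.2 ?_), fun a => h0 _⟩
      intro i
      have := hG (i + 2)
      simp only [nextG] at this
      exact (Ideal.add_mem_iff_right P (h0 _)).1 this
    · have key : ∀ i, ∀ j ≤ i, mn c' (p j) ∈ P := by
        intro i
        induction i with
        | zero =>
          intro j hj
          obtain rfl : j = 0 := by omega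
          exact hG 0
        | succ i ih =>
          intro j hj
          rcases Nat.lt_or_ge j (i + 1) with hlt | hge
          · exact ih j (by omega)
          · obtain rfl : j = i + 1 := by omega
            cases i with
            | zero => exact hG 1
            | succ i =>
              have h1 : G' i ∈ P := hG'T P hP i (fun a b ha hb =>
                mn_of_col hc' (ih a ha) (ih b hb))
              have := hG (i + 2)
              simp only [nextG] at this
              exact (Ideal.add_mem_iff_left P h1).1 this
      have key' : ∀ j, mn c' (p j) ∈ P := fun j => key j j le_rfl
      exact ⟨fun a b => mn_of_col hc' (key' a) (key' b), key'⟩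
  have hGall : ∀ P : Ideal S, P.IsPrime → (∀ i, nextG c' p G' i ∈ P) → ∀ i, G i ∈ P := by
    intro P hP hG i
    exact h.T P hP i (fun a b _ _ => (hU P hP hG).1 a b)
  refine ⟨hs1, ?_, ?_, ?_, ?_, ?_, ?_, ?_⟩
  · intro i hi
    match i, hi with
    | 0, hi => omega
    | 1, hi => 
      have := h.hr
      omega
    | i + 2, hi =>
      simp only [nextG]
      rw [h.pz (i + 2) (by omega), mn_zero_right, hs2 i hi, add_zero]
  · intro i hi
    match i, hi with
    | 0, hi => omega
    | i + 1, hi => exact h.pz i (by omega)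
  · intro P hP i hi
    match i, hi with
    | 0, hi => exact hi 0 1 (by omega) (by omega)
    | 1, hi => exact hi 0 2 (by omega) (by omega)
    | i + 2, hi =>
      refine add_mem (hi 0 (i + 3) (by omega) (by omega)) (hG'T P hP i ?_)
      intro a b ha hb
      exact hi (a + 1) (b + 1) (by omega) (by omega)
  · intro P hP hG a b
    obtain ⟨h1, h2⟩ := hU P hP hG
    match a, b with
    | 0, 0 => simp [mn_self]
    | 0, b + 1 => exact h2 b
    | a + 1, 0 => rw [mn_anti]; exact neg_mem (h2 a)
    | a + 1, b + 1 => exact h1 a b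
  · intro P hP hG j
    have hG := hGall P hP hG
    match j with
    | 0 => exact ⟨c, by simp, cg_symm (hc P hP hG)⟩
    | j + 1 =>
      obtain ⟨e, he, he'⟩ := h.V1 P hP hG j
      exact ⟨e, by simp at he ⊢; tauto, he'⟩
  · intro P hP hG e he
    have hG := hGall P hP hG
    rcases List.mem_cons.1 he with rfl | he
    · exact ⟨0, hc P hP hG⟩
    · obtain ⟨j, hj⟩ := h.V2 P hP hG e he
      exact ⟨j + 1, hj⟩
  · intro P hP hL i
    have hG := h.W P hP (fun a ha b hb => hL a (List.mem_cons_of_mem _ ha) b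
      (List.mem_cons_of_mem _ hb))
    have hm : ∀ j, mn c' (p j) ∈ P := by
      intro j
      obtain ⟨e, he, he'⟩ := h.V1 P hP hG j
      refine mn_cg (cg_symm (hc P hP hG)) he' ?_
      rcases List.mem_cons.1 he with rfl | he
      · rw [mn_zero_right]; exact zero_mem _
      · exact hL _ List.mem_cons_self _ (List.mem_cons_of_mem _ he)
    match i with
    | 0 => exact hm 0
    | 1 => exact hm 1
    | i + 2 => exact add_mem (hm _) (ha P hP i (hG i))

lemma inv_base (y z : S × S) : Inv [y, z] (consP y (consP z (fun _ => (0, 0))))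
    (fun i => if i = 0 then mn y z else 0) 1 := by
  refine ⟨le_rfl, ?_, ?_, ?_, ?_, ?_, ?_, ?_⟩
  · intro i hi; simp; omega
  · intro i hi
    match i, hi with
    | i + 2, _ => rfl
  · intro P hP i hi
    split_ifs with h0
    · exact hi 0 1 (by omega) (by omega)
    · exact zero_mem _
  · intro P hP hG
    have h0 : mn y z ∈ P := by simpa using hG 0
    have h0' : mn z y ∈ P := by rw [mn_anti]; exact neg_mem h0
    have hz : ∀ e : S × S, mn (0, 0) e ∈ P := by intro e; simp [mn]
    have hz' : ∀ e : S × S, mn e (0, 0) ∈ P := by intro e; simp [mn]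
    intro a b
    match a, b with
    | 0, 0 => simp [mn_self]
    | 1, 1 => simp [mn_self]
    | 0, 1 => exact h0
    | 1, 0 => exact h0'
    | _ + 2, _ => exact hz _
    | _, _ + 2 => exact hz' _
  · intro P hP hG j
    match j with
    | 0 => exact ⟨y, by simp, cg_refl _ _⟩
    | 1 => exact ⟨z, by simp, cg_refl _ _⟩
    | j + 2 => exact ⟨(0, 0), by simp, cg_refl _ _⟩
  · intro P hP hG e he
    simp only [List.mem_cons, List.not_mem_nil, or_false] at he
    rcases he with rfl | rfl
    · exact ⟨0, cg_refl _ _⟩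
    · exact ⟨1, cg_refl _ _⟩
  · intro P hP hL i
    split_ifs
    · exact hL _ (by simp) _ (by simp)
    · exact zero_mem _

open Classical in
/-- number of zero entries of a column -/
noncomputable def nz (c : S × S) : ℕ := (if c.1 = 0 then 1 else 0) + (if c.2 = 0 then 1 else 0)

lemma inv_all (y z : S × S) (L : List (S × S)) :
    ∃ p G r, Inv (L ++ [y, z]) p G r ∧ r + (L.map nz).sum = 2 * L.length + 1 := by
  induction L with
  | nil => exact ⟨_, _, 1, inv_base y z, by simp⟩
  | cons c L ih =>
    obtain ⟨p, G, r, h, hr⟩ := ih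
    have hr1 := h.hr
    by_cases h1 : c.1 = 0
    · by_cases h2 : c.2 = 0
      · obtain rfl : c = (0, 0) := Prod.ext h1 h2
        refine ⟨p, G, r, ⟨h.hr, h.Gz, h.pz, h.T, h.U, ?_, ?_, ?_⟩, ?_⟩
        · intro P hP hG j
          obtain ⟨e, he, he'⟩ := h.V1 P hP hG j
          exact ⟨e, by simp at he ⊢; tauto, he'⟩
        · intro P hP hG e he
          rcases List.mem_cons.1 he with rfl | he
          · exact ⟨r + 1, by rw [h.pz _ le_rfl]; exact cg_refl _ _⟩
          · exact h.V2 P hP hG e he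
        · intro P hP hL
          exact h.W P hP (fun a ha b hb => hL a (List.mem_cons_of_mem _ ha) b
            (List.mem_cons_of_mem _ hb))
        · simp [nz]; omega
      · refine ⟨_, _, r + 1, inv_step h c (G (r - 1), c.2) (fun i => if i = r - 1 then 0 else G i)
          (r + 1) (by omega) (by omega) ?_ ?_ ?_ ?_ (by omega), ?_⟩
        · intro i hi
          split_ifs with hh
          · rfl
          · exact h.Gz i (by omega)
        · intro P hP i hi
          split_ifs
          · exact zero_mem _
          · exact hi
        · intro P hP hc1 hc2 hG i
          by_cases hi : i = r - 1
          · rw [hi]; exact hc1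
          · have := hG i
            simpa [hi] using this
        · intro P hP hG
          exact ⟨by rw [h1, sub_zero]; exact hG _, by simp⟩
        · simp [nz, h1, h2]; omega
    · by_cases h2 : c.2 = 0
      · refine ⟨_, _, r + 1, inv_step h c (c.1, G (r - 1)) (fun i => if i = r - 1 then 0 else G i)
          (r + 1) (by omega) (by omega) ?_ ?_ ?_ ?_ (by omega), ?_⟩
        · intro i hi
          split_ifs with hh
          · rfl
          · exact h.Gz i (by omega)
        · intro P hP i hi
          split_ifs
          · exact zero_mem _
          · exact hi
        · intro P hP hc1 hc2 hG i
          by_cases hi : i = r - 1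
          · rw [hi]; exact hc2
          · have := hG i
            simpa [hi] using this
        · intro P hP hG
          exact ⟨by simp, by rw [h2, sub_zero]; exact hG _⟩
        · simp [nz, h1, h2]; omega
      · refine ⟨_, _, r + 2, inv_step h c c G
          (r + 2) (by omega) (by omega) ?_ ?_ ?_ ?_ (by omega), ?_⟩
        · intro i hi
          exact h.Gz i (by omega)
        · intro P hP i hi
          exact hi
        · intro P hP hc1 hc2 hG i
          exact hG i
        · intro P hP hG
          exact cg_refl _ _
        · simp [nz, h1, h2]; omega

/-- ideal of minors of a list of columns -/
def mI (L : List (S × S)) : Ideal S := Ideal.span {x | ∃ c ∈ L, ∃ c' ∈ L, x = mn c c'}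

lemma mI_le {L : List (S × S)} {P : Ideal S} : mI L ≤ P ↔ ∀ c ∈ L, ∀ c' ∈ L, mn c c' ∈ P := by
  rw [mI, Ideal.span_le]
  constructor
  · intro h c hc c' hc'
    exact h ⟨c, hc, c', hc', rfl⟩
  · rintro h x ⟨c, hc, c', hc', rfl⟩
    exact h c hc c' hc'

lemma radical_eq_of_primes {I J : Ideal S} (h : ∀ P : Ideal S, P.IsPrime → (I ≤ P ↔ J ≤ P)) :
    I.radical = J.radical := by
  rw [Ideal.radical_eq_sInf, Ideal.radical_eq_sInf]
  congr 1
  ext P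
  constructor
  · rintro ⟨h1, h2⟩; exact ⟨(h P h2).1 h1, h2⟩
  · rintro ⟨h1, h2⟩; exact ⟨(h P h2).2 h1, h2⟩

theorem ara_list (y z : S × S) (L : List (S × S)) :
    ∃ l : List S, l.length + (L.map nz).sum = 2 * L.length + 1 ∧
      (sp l).radical = (mI (L ++ [y, z])).radical := by
  obtain ⟨p, G, r, h, hr⟩ := inv_all y z L
  refine ⟨(List.range r).map G, by simpa using hr, radical_eq_of_primes ?_⟩
  intro P hP
  rw [mI_le]
  have h1 : sp ((List.range r).map G) ≤ P ↔ ∀ i, G i ∈ P := by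
    rw [sp, Ideal.span_le]
    constructor
    · intro hh i
      rcases Nat.lt_or_ge i r with hi | hi
      · exact hh (List.mem_map.2 ⟨i, List.mem_range.2 hi, rfl⟩)
      · rw [h.Gz i hi]; exact zero_mem _
    · rintro hh x hx
      obtain ⟨i, -, rfl⟩ := List.mem_map.1 hx
      exact hh i
  rw [h1]
  constructor
  · intro hG c hc c' hc'
    obtain ⟨j, hj⟩ := h.V2 P hP hG c hc
    obtain ⟨j', hj'⟩ := h.V2 P hP hG c' hc'
    exact mn_cg hj hj' (h.U P hP hG j j')
  · exact h.W P hP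

end ara
end LC

namespace LC
open MvPolynomial
set_option linter.unusedSectionVars false
set_option linter.unusedSimpArgs false
section rey
variable {K : Type*} [Field K] [CharZero K] {A : Type*} [CommRing A] [Algebra K A]

/-- weight -/
noncomputable def wt (K : Type*) [Field K] (a b c d : ℕ) : K :=
  if a = d ∧ b = c then (-1) ^ b * (a.factorial * b.factorial : K) / ((a + b + 1).factorial : K) else 0

lemma wt_rec (a b c d : ℕ) : wt K (a+1) b c (d+1) - wt K a (b+1) (c+1) d = wt K a b c d := by
  unfold wt
  by_cases h : a = d ∧ b = c
  · obtain ⟨rfl, rfl⟩ := h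
    simp only [and_self, if_true]
    rw [show a + 1 + b + 1 = (a+b+1)+1 by ring, show a + (b+1) + 1 = (a+b+1)+1 by ring]
    simp only [Nat.factorial_succ (a+b+1), Nat.factorial_succ a, Nat.factorial_succ b]
    have h1 : ((a+b+1).factorial : K) ≠ 0 := by exact_mod_cast Nat.factorial_ne_zero _
    have h2 : ((a : K)+b+1+1) ≠ 0 := by exact_mod_cast Nat.succ_ne_zero (a+b+1)
    push_cast
    field_simp
    ring
  · rw [if_neg h, if_neg (by omega), if_neg (by omega), sub_zero]

variable (K A) in
noncomputable def lam : MvPolynomial (Fin 4) A →ₗ[A] A :=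
  (MvPolynomial.basisMonomials (Fin 4) A).constr A
    (fun s => algebraMap K A (wt K (s 0) (s 1) (s 2) (s 3)))

lemma lam_mon (s : Fin 4 →₀ ℕ) (a : A) :
    lam K A (monomial s a) = a * algebraMap K A (wt K (s 0) (s 1) (s 2) (s 3)) := by
  have : monomial s a = a • (MvPolynomial.basisMonomials (Fin 4) A s) := by
    simp [MvPolynomial.smul_monomial]
  rw [this, map_smul, lam, Module.Basis.constr_basis, smul_eq_mul]

lemma lam_det (F : MvPolynomial (Fin 4) A) :
    lam K A ((X 0 * X 3 - X 1 * X 2) * F) = lam K A F := by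
  induction F using MvPolynomial.induction_on' with
  | monomial s a =>
    rw [sub_mul, map_sub]
    have e1 : (X 0 * X 3 * monomial s a : MvPolynomial (Fin 4) A) =
        monomial (Finsupp.single 0 1 + Finsupp.single 3 1 + s) a := by
      simp [X, monomial_mul]
    have e2 : (X 1 * X 2 * monomial s a : MvPolynomial (Fin 4) A) =
        monomial (Finsupp.single 1 1 + Finsupp.single 2 1 + s) a := by
      simp [X, monomial_mul]
    rw [e1, e2, lam_mon, lam_mon, lam_mon, ← mul_sub, ← map_sub, ← wt_rec (s 0) (s 1) (s 2) (s 3)]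
    simp [add_comm]
  | add p q hp hq => rw [mul_add, map_add, map_add, hp, hq]

lemma lam_pow (a b : ℕ) (x y z w : A) :
    lam K A ((X 0 * C x + X 1 * C y) ^ a * (X 2 * C z + X 3 * C w) ^ b) =
      if a = b then algebraMap K A (1 / (a + 1)) * (x * w - y * z) ^ a else 0 := by
  have key : ∀ i ∈ Finset.range (a+1), ∀ j ∈ Finset.range (b+1),
     lam K A ((X 0 * C x) ^ i * (X 1 * C y) ^ (a - i) * (a.choose i : MvPolynomial (Fin 4) A) *
        ((X 2 * C z) ^ j * (X 3 * C w) ^ (b - j) * (b.choose j : MvPolynomial (Fin 4) A))) =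
      x ^ i * y ^ (a-i) * z ^ j * w ^ (b-j) * (a.choose i) * (b.choose j) *
        algebraMap K A (wt K i (a - i) j (b - j)) := by
    intro i _ j _
    have : ((X 0 * C x) ^ i * (X 1 * C y) ^ (a - i) * (a.choose i : MvPolynomial (Fin 4) A) *
        ((X 2 * C z) ^ j * (X 3 * C w) ^ (b - j) * (b.choose j : MvPolynomial (Fin 4) A))) =
        monomial (Finsupp.single 0 i + Finsupp.single 1 (a-i) + Finsupp.single 2 j +
          Finsupp.single 3 (b-j)) (x ^ i * y ^ (a-i) * z ^ j * w ^ (b-j) * (a.choose i) * (b.choose j)) := by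
      rw [← mul_one (x ^ i * y ^ (a-i) * z ^ j * w ^ (b-j) * (a.choose i) * (b.choose j) : A),
        ← C_mul_monomial]
      simp only [monomial_add_single, ← X_pow_eq_monomial, map_mul, map_pow, map_natCast]
      ring
    rw [this, lam_mon]
    congr 3 <;> simp [Finsupp.single_apply]
  rw [add_pow, add_pow, Finset.sum_mul_sum, map_sum]
  simp only [map_sum]
  rw [Finset.sum_congr rfl (fun i hi => Finset.sum_congr rfl (key i hi))]
  split_ifs with hab
  · subst hab
    rw [sub_eq_add_neg, add_pow, Finset.mul_sum]
    refine Finset.sum_congr rfl fun i hi => ?_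
    rw [Finset.mem_range] at hi
    rw [Finset.sum_eq_single (a - i)]
    · have e1 : a - (a - i) = i := by omega
      have e2 : a.choose (a - i) = a.choose i := Nat.choose_symm (by omega)
      rw [e1, e2, wt, if_pos ⟨rfl, rfl⟩]
      have e3 : (-(y * z)) ^ (a - i) = algebraMap K A ((-1) ^ (a-i)) * (y^(a-i) * z^(a-i)) := by
        rw [neg_pow]; simp [mul_pow]
      have e4 : (a.choose i : A) = algebraMap K A (a.choose i) := by simp
      rw [e3, e4, mul_pow]
      have e5 : (a.choose i : K) * ((-1) ^ (a - i) * (↑i.factorial * ↑(a - i).factorial) / ↑(i + (a - i) + 1).factorial) =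
         1 / (a+1) * (-1) ^ (a-i) := by
        have := Nat.choose_mul_factorial_mul_factorial (show i ≤ a by omega)
        have h3 : (a.choose i : K) * i.factorial * (a-i).factorial = a.factorial := by exact_mod_cast this
        rw [show i + (a - i) + 1 = a + 1 by omega, Nat.factorial_succ]
        have h1 : (a.factorial : K) ≠ 0 := by exact_mod_cast Nat.factorial_ne_zero _
        have h2 : ((a : K)+1) ≠ 0 := by exact_mod_cast Nat.succ_ne_zero a
        push_cast
        field_simp
        linear_combination h3
      have e6 := congrArg (algebraMap K A) e5
      rw [map_mul, map_mul] at e6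
      linear_combination (x ^ i * y ^ (a-i) * z ^ (a-i) * w ^ i * algebraMap K A (a.choose i)) * e6
    · intro j hj hne
      rw [Finset.mem_range] at hj
      rw [wt, if_neg (by omega)]; simp
    · intro h; exact absurd (Finset.mem_range.2 (by omega)) h
  · refine Finset.sum_eq_zero fun i hi => Finset.sum_eq_zero fun j hj => ?_
    rw [Finset.mem_range] at hi hj
    rw [wt, if_neg (by omega)]; simp
end rey

section rho
variable {K : Type*} [Field K] [CharZero K] {ι : Type*}

/-- generic column -/
noncomputable def col (K : Type*) [Field K] {ι : Type*} (i : ι) :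
    MvPolynomial (Fin 2 × ι) K × MvPolynomial (Fin 2 × ι) K := (X (0, i), X (1, i))

noncomputable def theta (K : Type*) [Field K] (ι : Type*) :
    MvPolynomial (Fin 2 × ι) K →ₐ[K] MvPolynomial (Fin 4) (MvPolynomial (Fin 2 × ι) K) :=
  aeval (fun p => if p.1 = 0 then X 0 * C (X (0, p.2)) + X 1 * C (X (1, p.2)) else
    X 2 * C (X (0, p.2)) + X 3 * C (X (1, p.2)))

noncomputable def rey (K : Type*) [Field K] (ι : Type*) :
    MvPolynomial (Fin 2 × ι) K →ₗ[K] MvPolynomial (Fin 2 × ι) K :=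
  ((lam K (MvPolynomial (Fin 2 × ι) K)).restrictScalars K).comp (theta K ι).toLinearMap

lemma rey_apply (f : MvPolynomial (Fin 2 × ι) K) : rey K ι f = lam K _ (theta K ι f) := rfl

lemma theta_mn (i j : ι) : theta K ι (mn (col K i) (col K j)) =
    (X 0 * X 3 - X 1 * X 2) * C (mn (col K i) (col K j)) := by
  simp [theta, mn, col]; ring

lemma rey_mn (i j : ι) (f : MvPolynomial (Fin 2 × ι) K) :
    rey K ι (mn (col K i) (col K j) * f) = mn (col K i) (col K j) * rey K ι f := by
  rw [rey_apply, rey_apply, map_mul, theta_mn, mul_assoc, lam_det, C_mul', map_smul, smul_eq_mul]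

lemma rey_one : rey K ι 1 = 1 := by
  have := lam_mon (K := K) (A := MvPolynomial (Fin 2 × ι) K) 0 1
  rw [rey_apply, map_one]
  simpa [wt] using this

noncomputable def mA (K : Type*) [Field K] (ι : Type*) : Subalgebra K (MvPolynomial (Fin 2 × ι) K) :=
  Algebra.adjoin K {x | ∃ i j, x = mn (col K i) (col K j)}

lemma mn_mem_mA (i j : ι) : mn (col K i) (col K j) ∈ mA K ι := Algebra.subset_adjoin ⟨i, j, rfl⟩

lemma rey_mA {a : MvPolynomial (Fin 2 × ι) K} (ha : a ∈ mA K ι) :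
    ∀ f, rey K ι (a * f) = a * rey K ι f := by
  refine Algebra.adjoin_induction (p := fun a _ => ∀ f, rey K ι (a * f) = a * rey K ι f) ?_ ?_ ?_ ?_ ha
  · rintro _ ⟨i, j, rfl⟩ f; exact rey_mn i j f
  · intro r f; rw [← Algebra.smul_def, map_smul, ← Algebra.smul_def]
  · intro x y _ _ hx hy f; rw [add_mul, add_mul, map_add, hx, hy]
  · intro x y _ _ hx hy f; rw [mul_assoc, mul_assoc, hx, hy]

lemma poly_coeff_mem {M : Type*} [AddCommGroup M] [Module K M] (W : Submodule K M) (n : ℕ)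
    (v : ℕ → M) (h : ∀ c : K, ∑ j ∈ Finset.range n, c ^ j • v j ∈ W) (j : ℕ) (hj : j < n) : v j ∈ W := by
  by_contra hv
  obtain ⟨φ, hφ, hW⟩ := Submodule.exists_le_ker_of_notMem hv
  let p : Polynomial K := ∑ j ∈ Finset.range n, Polynomial.monomial j (φ (v j))
  have : p = 0 := by
    refine Polynomial.funext fun c => ?_
    have := hW (h c)
    rw [LinearMap.mem_ker, map_sum] at this
    simp only [p, Polynomial.eval_finsetSum, Polynomial.eval_monomial, Polynomial.eval_zero]
    rw [← this]
    exact Finset.sum_congr rfl fun i _ => by simp [mul_comm]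
  apply hφ
  have h2 := congrArg (fun q => Polynomial.coeff q j) this
  simp only [p, Polynomial.finsetSum_coeff, Polynomial.coeff_monomial, Polynomial.coeff_zero] at h2
  rw [Finset.sum_ite_eq' (Finset.range n) j] at h2
  simpa [hj] using h2

lemma polar {A : Type*} [CommRing A] [Algebra K A] (W V : Submodule K A) (y : A)
    (h : ∀ l ∈ V, ∀ a : ℕ, l ^ a * y ∈ W) (L : List A) (hL : ∀ l ∈ L, l ∈ V) :
    ∀ l ∈ V, ∀ a : ℕ, l ^ a * (L.prod * y) ∈ W := by
  induction L with
  | nil => simpa using h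
  | cons m L ih =>
    intro l hl a
    have ih := ih (fun x hx => hL x (List.mem_cons_of_mem _ hx))
    have := poly_coeff_mem W (a + 1 + 1)
      (fun j => l ^ (a + 1 - j) * m ^ j * ((a+1).choose j : A) * (L.prod * y)) (fun c => by
        have := ih (l + c • m) (V.add_mem hl (V.smul_mem c (hL m (by simp)))) (a+1)
        rw [add_comm l, add_pow, Finset.sum_mul] at this
        convert this using 2 with j hj
        rw [smul_pow, Algebra.smul_def, Algebra.smul_def]; ring) 1 (by omega)
    simp only [Nat.add_sub_cancel, pow_one, Nat.choose_one_right] at this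
    have h3 := W.smul_mem ((a+1 : ℕ) : K)⁻¹ this
    convert h3 using 1
    have h2 : algebraMap K A ((a+1 : ℕ) : K)⁻¹ * ((a+1 : ℕ) : A) = 1 := by
      rw [← map_natCast (algebraMap K A) (a+1), ← map_mul, inv_mul_cancel₀, map_one]
      exact_mod_cast Nat.succ_ne_zero a
    rw [List.prod_cons, Algebra.smul_def]
    linear_combination (-(l ^ a * m * L.prod * y)) * h2

lemma rey_mem [Fintype ι] (f : MvPolynomial (Fin 2 × ι) K) : rey K ι f ∈ mA K ι := by
  classical
  let A := MvPolynomial (Fin 2 × ι) K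
  let W : Submodule K A := (Subalgebra.toSubmodule (mA K ι)).comap (rey K ι)
  let V (r : Fin 2) : Submodule K A := Submodule.span K (Set.range fun i : ι => X (r, i))
  have hV : ∀ r, ∀ l ∈ V r, ∃ u : ι → K, l = ∑ i, u i • X (r, i) := by
    intro r l hl
    obtain ⟨u, hu⟩ := (Submodule.mem_span_range_iff_exists_fun K).1 hl
    exact ⟨u, hu.symm⟩
  have h0 : ∀ l ∈ V 0, ∀ a : ℕ, ∀ m ∈ V 1, ∀ b : ℕ, m ^ b * l ^ a ∈ W := by
    intro l hl a m hm b
    obtain ⟨u, rfl⟩ := hV 0 l hl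
    obtain ⟨w, rfl⟩ := hV 1 m hm
    change rey K ι _ ∈ mA K ι
    have e1 : theta K ι (∑ i, u i • X (0, i)) =
      X 0 * C (∑ i, u i • X (0, i)) + X 1 * C (∑ i, u i • X (1, i)) := by
      simp only [map_sum, map_smul, theta, aeval_X, Finset.mul_sum, ← Finset.sum_add_distrib, if_true]
      refine Finset.sum_congr rfl fun i _ => ?_
      simp only [← C_mul', smul_eq_C_mul, map_mul, Algebra.smul_def, algebraMap_eq, MvPolynomial.algebraMap_apply]
      ring
    have e2 : theta K ι (∑ i, w i • X (1, i)) =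
      X 2 * C (∑ i, w i • X (0, i)) + X 3 * C (∑ i, w i • X (1, i)) := by
      simp only [map_sum, map_smul, theta, aeval_X, Finset.mul_sum, ← Finset.sum_add_distrib, one_ne_zero, if_false]
      refine Finset.sum_congr rfl fun i _ => ?_
      simp only [← C_mul', smul_eq_C_mul, map_mul, Algebra.smul_def, algebraMap_eq, MvPolynomial.algebraMap_apply]
      ring
    rw [rey_apply, map_mul, map_pow, map_pow, e1, e2, mul_comm, lam_pow]
    split_ifs with hab
    · refine mul_mem (Subalgebra.algebraMap_mem _ _) (pow_mem ?_ _)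
      have : ((∑ i, u i • X (0, i)) * (∑ i, w i • X (1, i)) - (∑ i, u i • X (1, i)) * (∑ i, w i • X (0, i)) : A) =
         ∑ i, ∑ j, (u i * w j) • mn (col K i) (col K j) := by
        rw [Finset.sum_mul_sum, Finset.sum_mul_sum, ← Finset.sum_sub_distrib]
        refine Finset.sum_congr rfl fun i _ => ?_
        rw [← Finset.sum_sub_distrib]
        refine Finset.sum_congr rfl fun j _ => ?_
        simp only [mn, col, smul_eq_C_mul, map_mul]; ring
      rw [this]
      exact sum_mem fun i _ => sum_mem fun j _ => Subalgebra.smul_mem _ (mn_mem_mA i j) _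
    · exact zero_mem _
  have h1 : ∀ l ∈ V 0, ∀ a : ℕ, ∀ L : List A, (∀ x ∈ L, x ∈ V 1) → L.prod * l ^ a ∈ W := by
    intro l hl a L hL
    simpa using polar W (V 1) (l ^ a) (fun m hm b => h0 l hl a m hm b) L hL 0 (zero_mem _) 0
  have h2 : ∀ L' : List A, (∀ x ∈ L', x ∈ V 0) → ∀ L : List A, (∀ x ∈ L, x ∈ V 1) → L'.prod * L.prod ∈ W := by
    intro L' hL' L hL
    simpa using polar W (V 0) L.prod (fun m hm b => by rw [mul_comm]; exact h1 m hm b L hL) L' hL' 0 (zero_mem _) 0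
  have h3 : ∀ f : A, ∀ L' : List A, (∀ x ∈ L', x ∈ V 0) → ∀ L : List A, (∀ x ∈ L, x ∈ V 1) →
      f * (L'.prod * L.prod) ∈ W := by
    intro f
    induction f using MvPolynomial.induction_on with
    | C a => intro L' hL' L hL; rw [← smul_eq_C_mul]; exact W.smul_mem _ (h2 L' hL' L hL)
    | add p q hp hq => intro L' hL' L hL; rw [add_mul]; exact W.add_mem (hp L' hL' L hL) (hq L' hL' L hL)
    | mul_X p q hp =>
      intro L' hL' L hL
      obtain ⟨r, i⟩ := q
      have hm : ∀ r, (X (r, i) : A) ∈ V r := fun r => Submodule.subset_span ⟨i, rfl⟩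
      fin_cases r
      · have := hp (X (0, i) :: L') (by intro x hx; rcases List.mem_cons.1 hx with rfl | hx; exacts [hm 0, hL' x hx]) L hL
        rw [List.prod_cons] at this
        convert this using 1
        simp only [Fin.zero_eta]; ring
      · have := hp L' hL' (X (1, i) :: L) (by intro x hx; rcases List.mem_cons.1 hx with rfl | hx; exacts [hm 1, hL x hx])
        rw [List.prod_cons] at this
        convert this using 1
        simp only [Fin.mk_one]; ring
  have h4 : f ∈ W := by simpa using h3 f [] (by simp) [] (by simp)
  exact h4
end rho
end LC

namespace LC
open MvPolynomial
set_option linter.unusedSectionVars false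
set_option linter.unusedSimpArgs false
section tv
universe u
variable {A : Type u} [CommRing A]

lemma pw_append (l l' : List A) (M : ℕ) : pw (l ++ l') M = pw l M ⊔ pw l' M := by
  induction l with
  | nil => simp [pw]
  | cons f l ih => rw [List.cons_append, pw, pw, ih]; ac_rfl

lemma pw_map {B : Type*} [CommRing B] (φ : A →+* B) (l : List A) (M : ℕ) :
    pw (l.map φ) M = (pw l M).map φ := by
  induction l with
  | nil => simp [pw]
  | cons f l ih => rw [List.map_cons, pw, pw, ih, Ideal.map_sup, Ideal.map_span]; simp

variable {τ : Type*}

lemma coeff_pw (l : List τ) (M : ℕ) (J : Ideal A) (p : MvPolynomial τ A)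
    (hp : p ∈ pw (l.map X) M ⊔ J.map C) (s : τ →₀ ℕ) (hs : ∀ i, s i < M) : coeff s p ∈ J := by
  classical
  induction l generalizing p with
  | nil =>
    simp only [List.map_nil, pw, bot_sup_eq] at hp
    exact mem_map_C_iff.1 hp s
  | cons i l ih =>
    rw [List.map_cons, pw, sup_comm (pw _ _), sup_assoc] at hp
    obtain ⟨a, ha, b, hb, rfl⟩ := Submodule.mem_sup.1 hp
    obtain ⟨c, rfl⟩ := Ideal.mem_span_singleton.1 ha
    rw [coeff_add, X_pow_eq_monomial, coeff_monomial_mul', if_neg, zero_add]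
    · exact ih b hb
    · intro h
      have := h i
      have := hs i
      simp at *
      omega

lemma prod_X (l : List τ) (hl : l.Nodup) (hm : ∀ i, i ∈ l) (N : ℕ) :
    ∃ s : τ →₀ ℕ, (∀ i, s i = N) ∧ (((l.map X).prod : MvPolynomial τ A)) ^ N = monomial s 1 := by
  classical
  have : ∀ l : List τ, l.Nodup → ∃ s : τ →₀ ℕ, (∀ i, s i = if i ∈ l then N else 0) ∧
      (((l.map X).prod : MvPolynomial τ A)) ^ N = monomial s 1 := by
    intro l hl
    induction l with
    | nil => exact ⟨0, by simp, by simp⟩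
    | cons i l ih =>
      rw [List.nodup_cons] at hl
      obtain ⟨s, h1, h2⟩ := ih hl.2
      refine ⟨Finsupp.single i N + s, ?_, ?_⟩
      · intro j
        rw [Finsupp.add_apply, h1, Finsupp.single_apply]
        by_cases hj : i = j
        · subst hj; simp [hl.1]
        · simp [hj, Ne.symm hj]
      · rw [List.map_cons, List.prod_cons, mul_pow, h2, X_pow_eq_monomial, monomial_mul, one_mul]
  obtain ⟨s, h1, h2⟩ := this l hl
  exact ⟨s, fun i => by rw [h1, if_pos (hm i)], h2⟩

lemma tv_back (l : List τ) (hl : l.Nodup) (hm : ∀ i, i ∈ l) (f : List A)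
    (h : Q (l.map X ++ f.map C : List (MvPolynomial τ A)) 1 1) : Q f 1 1 := by
  classical
  obtain ⟨N, hN⟩ := h
  refine ⟨N, ?_⟩
  obtain ⟨s, h1, h2⟩ := prod_X (A := A) l hl hm N
  rw [pw_append, pw_map] at hN
  have := coeff_pw l (N+1) _ _ hN s (fun i => by rw [h1]; omega)
  rw [List.prod_append, mul_pow, h2, ← map_list_prod, ← map_pow, mul_one, mul_comm, coeff_C_mul, coeff_monomial,
    if_pos rfl] at this
  exact this

lemma tv_fwd [IsNoetherianRing A] [IsDomain A] (l : List τ) (f : List A)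
    (h : ∀ L x, Q f L x) (L : ℕ) (x : MvPolynomial τ A) :
    Q (l.map X ++ f.map C : List (MvPolynomial τ A)) L x := by
  classical
  choose n hn using fun m => h L (coeff m x)
  let N := x.support.sup n
  refine ⟨N, ?_⟩
  rw [pw_append, pw_map, List.prod_append, mul_pow, mul_assoc]
  refine Ideal.mul_mem_left _ _ (Ideal.mem_sup_right ?_)
  rw [mem_map_C_iff]
  intro m
  rw [← map_list_prod, ← map_pow, coeff_C_mul]
  by_cases hm : m ∈ x.support
  · have hle : n m ≤ N := Finset.le_sup hm
    have := pw_mul f _ (hn m) (N - n m)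
    rw [← mul_assoc, ← pow_add] at this
    have e1 : N - n m + n m = N := by omega
    have e2 : n m + L + (N - n m) = N + L := by omega
    rwa [e1, e2] at this
  · rw [notMem_support_iff.1 hm, mul_zero]; exact zero_mem _

lemma Q_equiv {B : Type*} [CommRing B] (φ : A ≃+* B) (l : List A) (h : ∀ L x, Q l L x) (L : ℕ) (x : B) :
    Q (l.map φ) L x := by
  obtain ⟨N, hN⟩ := h L (φ.symm x)
  refine ⟨N, ?_⟩
  have := Ideal.mem_map_of_mem (φ : A →+* B) hN
  rw [← pw_map, map_mul, map_pow, map_list_prod] at this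
  simpa using this
end tv

section base
variable {K : Type*} [Field K] [CharZero K]

noncomputable def hlist (K : Type*) [Field K] : List (MvPolynomial (Fin 2 × Fin 4) K) :=
  let p := fun i j : Fin 4 => mn (col K i) (col K j)
  [p 0 1, p 0 2, p 0 3 + p 1 2, p 1 3, p 2 3]

lemma transfer {A P F : Type*} [CommRing A] [CommRing P] [CommRing F] (ι : P →+* F) (T : A →+ F)
    (u : A → P) (l : List A) (h1 : ∀ f ∈ l, ∀ n x, T (f ^ n * x) = ι (u f) ^ n * T x) (h2 : ∀ x, ∃ y, T x = ι y)
    (M : ℕ) (x : A) (hx : x ∈ pw l M) : ∃ y ∈ pw (l.map u) M, T x = ι y := by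
  induction l generalizing x with
  | nil =>
    simp only [pw, Ideal.mem_bot] at hx
    exact ⟨0, zero_mem _, by simp [hx]⟩
  | cons f l ih =>
    obtain ⟨a, ha, b, hb, rfl⟩ := Submodule.mem_sup.1 hx
    obtain ⟨c, rfl⟩ := Ideal.mem_span_singleton.1 hb
    obtain ⟨y, hy, e⟩ := ih (fun g hg => h1 g (List.mem_cons_of_mem _ hg)) a ha
    obtain ⟨z, hz⟩ := h2 c
    refine ⟨y + u f ^ M * z, ?_, ?_⟩
    · rw [List.map_cons, pw]
      exact Submodule.add_mem_sup hy (Ideal.mul_mem_right _ _ (Ideal.mem_span_singleton_self _))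
    · rw [map_add, e, h1 f (by simp), hz]; simp

open QuadraticAlgebra in
lemma base_aux {P F : Type*} [CommRing P] [Field F] [CharZero F] [Algebra K F] (ι : P →+* F)
    (hι : Function.Injective ι) (κ : K →+* P) (hK : ∀ k, algebraMap K F k = ι (κ k)) (Y : Fin 5 → P)
    (hY : Function.Injective Y) (hY0 : ι (Y 0) ≠ 0) (N : ℕ)
    (hN : (hlist K).prod ^ N * 1 ∈ pw (hlist K) (N + 1)) :
    (([0,1,2,3,4] : List (Fin 5)).map Y).prod ^ N ∈ pw (([0,1,2,3,4] : List (Fin 5)).map Y) (N + 1) := by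
  obtain ⟨y, hy⟩ : ∃ y : Fin 5 → F, ∀ i, y i = ι (Y i) := ⟨_, fun _ => rfl⟩
  rw [← hy] at hY0
  obtain ⟨q, hq⟩ : ∃ q : F, q = y 2 ^ 2 - 4 * (y 1 * y 3 - y 0 * y 4) := ⟨_, rfl⟩
  have h2 : (2 : F) ≠ 0 := two_ne_zero
  obtain ⟨g, hg⟩ : ∃ g : Fin 2 × Fin 4 → QuadraticAlgebra F q 0, ∀ p, g p = 
    if p.1 = 0 then ![⟨1, 0⟩, ⟨0, 0⟩, ⟨-(y 2 / 2) / y 0, (1/2) / y 0⟩, ⟨-y 3 / y 0, 0⟩] p.2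
    else ![⟨0, 0⟩, ⟨y 0, 0⟩, ⟨y 1, 0⟩, ⟨y 2 / 2, 1/2⟩] p.2 := ⟨_, fun _ => rfl⟩
  obtain ⟨ψ, hψ⟩ : ∃ ψ : MvPolynomial (Fin 2 × Fin 4) K →ₐ[K] QuadraticAlgebra F q 0, ψ = aeval g := ⟨_, rfl⟩
  obtain ⟨pm, hpm⟩ : ∃ pm : Fin 4 → Fin 4 → QuadraticAlgebra F q 0, ∀ i j, pm i j = ψ (mn (col K i) (col K j)) :=
    ⟨_, fun _ _ => rfl⟩
  have e01 : pm 0 1 = ⟨y 0, 0⟩ := by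
    ext <;> simp [hpm, hψ, mn, col, hg]
  have e02 : pm 0 2 = ⟨y 1, 0⟩ := by
    ext <;> simp [hpm, hψ, mn, col, hg]
  have e03 : pm 0 3 = ⟨y 2 / 2, 1/2⟩ := by
    ext <;> simp [hpm, hψ, mn, col, hg]
  have e12 : pm 1 2 = ⟨y 2 / 2, -1/2⟩ := by
    ext <;> simp [hpm, hψ, mn, col, hg] <;> field_simp
  have e13 : pm 1 3 = ⟨y 3, 0⟩ := by
    ext <;> simp [hpm, hψ, mn, col, hg] <;> field_simp
  have e23 : pm 2 3 = ⟨y 4, 0⟩ := by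
    ext <;> simp [hpm, hψ, mn, col, hg] <;> field_simp <;> (try rw [hq]) <;> ring
  obtain ⟨Tp, hTp⟩ : ∃ Tp : QuadraticAlgebra F q 0 → Prop, ∀ x, Tp x ↔ (∃ a, x.re = ι a) ∧ (∃ a, x.im = ι a) :=
    ⟨_, fun _ => Iff.rfl⟩
  have T_add : ∀ x y, Tp x → Tp y → Tp (x + y) := by
    simp only [hTp]
    rintro x y ⟨⟨a, ha⟩, ⟨b, hb⟩⟩ ⟨⟨a', ha'⟩, ⟨b', hb'⟩⟩
    exact ⟨⟨a + a', by simp [ha, ha']⟩, ⟨b + b', by simp [hb, hb']⟩⟩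
  have hq' : q = ι (Y 2 ^ 2 - 4 * (Y 1 * Y 3 - Y 0 * Y 4)) := by
    have h4 : ι 4 = 4 := map_ofNat ι 4
    rw [hq]
    simp only [map_sub, map_mul, map_pow, h4, hy]
  have T_mul : ∀ x y, Tp x → Tp y → Tp (x * y) := by
    simp only [hTp]
    rintro x y ⟨⟨a, ha⟩, ⟨b, hb⟩⟩ ⟨⟨a', ha'⟩, ⟨b', hb'⟩⟩
    refine ⟨⟨a * a' + (Y 2 ^ 2 - 4 * (Y 1 * Y 3 - Y 0 * Y 4)) * b * b', ?_⟩, ⟨a * b' + b * a', ?_⟩⟩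
    · rw [re_mul, ha, ha', hb, hb', map_add, map_mul, map_mul, map_mul, ← hq']
    · rw [im_mul, ha, ha', hb, hb', map_add, map_mul, map_mul]; ring
  have T_K : ∀ k : K, Tp (algebraMap K _ k) := fun k => by
    rw [hTp]
    refine ⟨⟨κ k, ?_⟩, ⟨0, ?_⟩⟩
    · rw [← hK]; rfl
    · rw [map_zero]; rfl
  have half : (1 / 2 : F) = ι (κ (1/2)) := by
    have h3 : algebraMap K F 2 = 2 := map_ofNat _ 2
    rw [← hK, map_div₀, map_one, h3]
  have halfn : (-1 / 2 : F) = ι (κ (-1/2)) := by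
    have h3 : algebraMap K F 2 = 2 := map_ofNat _ 2
    rw [← hK, map_div₀, map_neg, map_one, h3]
  have hh : y 2 / 2 = ι (Y 2 * κ (1/2)) := by
    rw [map_mul, ← half, mul_one_div, hy]
  have T_12 : ∀ i j : Fin 4, i < j → Tp (pm i j) := by
    intro i j hij
    rw [hTp]
    fin_cases i <;> fin_cases j <;> first | exact absurd hij (by decide) | skip
    · exact ⟨⟨Y 0, by simp [e01, hy]⟩, ⟨0, by simp [e01]⟩⟩
    · exact ⟨⟨Y 1, by simp [e02, hy]⟩, ⟨0, by simp [e02]⟩⟩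
    · refine ⟨⟨_, (congrArg QuadraticAlgebra.re e03).trans hh⟩, ⟨_, (congrArg QuadraticAlgebra.im e03).trans half⟩⟩
    · refine ⟨⟨_, (congrArg QuadraticAlgebra.re e12).trans hh⟩, ⟨_, (congrArg QuadraticAlgebra.im e12).trans halfn⟩⟩
    · exact ⟨⟨Y 3, by simp [e13, hy]⟩, ⟨0, by simp [e13]⟩⟩
    · exact ⟨⟨Y 4, by simp [e23, hy]⟩, ⟨0, by simp [e23]⟩⟩
  have T_pm : ∀ i j : Fin 4, Tp (pm i j) := by
    intro i j
    rcases lt_trichotomy i j with h | h | h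
    · exact T_12 i j h
    · subst h
      have : pm i i = algebraMap K _ 0 := by simp [hpm, mn_self]
      rw [this]; exact T_K 0
    · have : pm i j = algebraMap K _ (-1) * pm j i := by
        rw [hpm, hpm, mn_anti]; simp
      rw [this]; exact T_mul _ _ (T_K _) (T_12 j i h)
  have T_mA : ∀ a ∈ mA K (Fin 4), Tp (ψ a) := by
    intro a ha
    refine Algebra.adjoin_induction (p := fun a _ => Tp (ψ a)) ?_ ?_ ?_ ?_ ha
    · rintro _ ⟨i, j, rfl⟩; rw [← hpm]; exact T_pm i j
    · intro r; rw [AlgHom.commutes]; exact T_K r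
    · intro x y _ _ hx hy; rw [map_add]; exact T_add _ _ hx hy
    · intro x y _ _ hx hy; rw [map_mul]; exact T_mul _ _ hx hy
  obtain ⟨T, hT⟩ : ∃ T : MvPolynomial (Fin 2 × Fin 4) K →+ F, ∀ f, T f = (ψ (rey K (Fin 4) f)).re :=
   ⟨{ toFun := fun f => (ψ (rey K (Fin 4) f)).re
      map_zero' := by simp
      map_add' := by intro a b; simp }, fun _ => rfl⟩
  have hTm : ∀ f ∈ mA K (Fin 4), ∀ i : Fin 5, ψ f = ⟨y i, 0⟩ → ∀ n x, T (f ^ n * x) = ι (Y i) ^ n * T x := by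
    intro f hf i hi n x
    rw [hT, hT, rey_mA (pow_mem hf n), map_mul, map_pow, hi]
    have : (⟨y i, 0⟩ : QuadraticAlgebra F q 0) = QuadraticAlgebra.C (y i) := rfl
    rw [this, ← QuadraticAlgebra.C_pow, re_mul, QuadraticAlgebra.re_C, QuadraticAlgebra.im_C, hy]
    ring
  have m := fun i j => mn_mem_mA (K := K) (ι := Fin 4) i j
  have e2 : ψ (mn (col K 0) (col K 3) + mn (col K 1) (col K 2)) = ⟨y 2, 0⟩ := by
    rw [map_add, ← hpm, ← hpm, e03, e12]
    ext <;> simp <;> ring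
  rw [hpm] at e01 e02 e13 e23
  have H : ∃ u : MvPolynomial (Fin 2 × Fin 4) K → P, (hlist K).map u = ([0,1,2,3,4] : List (Fin 5)).map Y ∧
      ∀ f ∈ hlist K, ∀ n x, T (f ^ n * x) = ι (u f) ^ n * T x := by
    have hdata : ∀ f ∈ hlist K, ∃ i : Fin 5, f ∈ mA K (Fin 4) ∧ ψ f = ⟨y i, 0⟩ := by
      intro f hf
      simp only [hlist, List.mem_cons, List.not_mem_nil, or_false] at hf
      rcases hf with rfl | rfl | rfl | rfl | rfl
      · exact ⟨0, m _ _, e01⟩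
      · exact ⟨1, m _ _, e02⟩
      · exact ⟨2, add_mem (m _ _) (m _ _), e2⟩
      · exact ⟨3, m _ _, e13⟩
      · exact ⟨4, m _ _, e23⟩
    have hex : ∀ f, ∃ w : P, ∀ i : Fin 5, ψ f = ⟨y i, 0⟩ → w = Y i := by
      intro f
      by_cases h : ∃ i : Fin 5, ψ f = ⟨y i, 0⟩
      · obtain ⟨i, hi⟩ := h
        refine ⟨Y i, fun j hj => ?_⟩
        have h3 : y i = y j := congrArg QuadraticAlgebra.re (hi.symm.trans hj)
        rw [hy, hy] at h3
        exact hι h3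
      · exact ⟨0, fun i hi => absurd ⟨i, hi⟩ h⟩
    choose u hu using hex
    refine ⟨u, ?_, ?_⟩
    · simp only [hlist, List.map_cons, List.map_nil]
      rw [hu _ 0 e01, hu _ 1 e02, hu _ 2 e2, hu _ 3 e13, hu _ 4 e23]
    · intro f hf n x
      obtain ⟨i, h1, h2⟩ := hdata f hf
      rw [hu f i h2]
      exact hTm f h1 i h2 n x
  obtain ⟨u, hu, hT2⟩ := H
  obtain ⟨z, hz, e⟩ := transfer ι T u (hlist K) hT2 (fun x => by
    rw [hT]; exact ((hTp _).1 (T_mA _ (rey_mem x))).1) _ _ hN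
  have hprod : (hlist K).prod ∈ mA K (Fin 4) ∧
      ψ (hlist K).prod = QuadraticAlgebra.C (ι (([0,1,2,3,4] : List (Fin 5)).map Y).prod) := by
    simp only [hlist, List.prod_cons, List.prod_nil, List.map_cons, List.map_nil]
    refine ⟨mul_mem (m _ _) (mul_mem (m _ _) (mul_mem (add_mem (m _ _) (m _ _))
      (mul_mem (m _ _) (mul_mem (m _ _) (one_mem _))))), ?_⟩
    rw [map_mul, map_mul, map_mul, map_mul, map_mul, e01, e02, e13, e23, e2]
    ext <;> simp [hy]
  have e' : T ((hlist K).prod ^ N * 1) = ι ((([0,1,2,3,4] : List (Fin 5)).map Y).prod ^ N) := by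
    rw [hT, rey_mA (pow_mem hprod.1 N), rey_one, mul_one, map_pow, hprod.2, ← QuadraticAlgebra.C_pow, map_pow]
    rfl
  rw [e'] at e
  rw [hu, ← hι e] at hz
  exact hz

lemma base_fail : ¬ Q (hlist K) 1 1 := by
  rintro ⟨N, hN⟩
  have hι := IsFractionRing.injective (MvPolynomial (Fin 5) K) (FractionRing (MvPolynomial (Fin 5) K))
  haveI : CharZero (FractionRing (MvPolynomial (Fin 5) K)) := charZero_of_injective_algebraMap hι
  have hz := base_aux (K := K) (algebraMap (MvPolynomial (Fin 5) K) (FractionRing (MvPolynomial (Fin 5) K))) hι C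
    (fun k => by rw [IsScalarTower.algebraMap_apply K (MvPolynomial (Fin 5) K)]; rfl) X (X_injective)
    (fun h => X_ne_zero (0 : Fin 5) (hι (h.trans (map_zero _).symm))) N hN
  have hQ : Q (([0,1,2,3,4] : List (Fin 5)).map X ++ ([] : List K).map C : List (MvPolynomial (Fin 5) K)) 1 1 :=
    ⟨N, by rw [List.map_nil, List.append_nil, mul_one]; exact hz⟩
  obtain ⟨M, hM⟩ := tv_back _ (by decide) (by decide) _ hQ
  simp [pw] at hM
end base
end LC

namespace LC
open MvPolynomial

section steps
variable {K : Type*} [Field K] {ι : Type*} [Fintype ι] [DecidableEq ι]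

/-- Minors of the generic matrix together with a set of entries. -/
noncomputable def Jid (K : Type*) [Field K] {ι : Type*} (S : Finset (Fin 2 × ι)) :
    Ideal (MvPolynomial (Fin 2 × ι) K) :=
  Ideal.span ({x | ∃ i j : ι, x = mn (col K i) (col K j)} ∪ {x | ∃ p ∈ S, x = X p})

lemma Jid_le {S : Finset (Fin 2 × ι)} {P : Ideal (MvPolynomial (Fin 2 × ι) K)} :
    Jid K S ≤ P ↔ (∀ i j, mn (col K i) (col K j) ∈ P) ∧ ∀ p ∈ S, X p ∈ P := by
  rw [Jid, Ideal.span_le, Set.union_subset_iff]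
  constructor
  · rintro ⟨h1, h2⟩
    exact ⟨fun i j => h1 ⟨i, j, rfl⟩, fun p hp => h2 ⟨p, hp, rfl⟩⟩
  · rintro ⟨h1, h2⟩
    refine ⟨?_, ?_⟩
    · rintro _ ⟨i, j, rfl⟩; exact h1 i j
    · rintro _ ⟨p, hp, rfl⟩; exact h2 p hp

lemma Jid_insert (p : Fin 2 × ι) (S : Finset (Fin 2 × ι)) :
    Jid K (insert p S) = Jid K S ⊔ Ideal.span {X p} := by
  apply eq_of_forall_ge_iff
  intro P
  rw [sup_le_iff, Jid_le, Jid_le, Ideal.span_singleton_le_iff_mem]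
  simp only [Finset.mem_insert, forall_eq_or_imp]
  tauto

lemma sp_le {R : Type*} [CommRing R] {l : List R} {P : Ideal R} : sp l ≤ P ↔ ∀ x ∈ l, x ∈ P := by
  rw [sp, Ideal.span_le]; rfl

noncomputable def gl (K : Type*) [Field K] {ι : Type*} [DecidableEq ι] (S : Finset (Fin 2 × ι)) (i l : ι) :
    List (MvPolynomial (Fin 2 × ι) K) :=
  if (0, l) ∈ S ∧ (1, l) ∈ S then [X (0, l), X (1, l)] else
    (if (0, l) ∈ S then [X (0, l)] else []) ++ (if (1, l) ∈ S then [X (1, l)] else []) ++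
      [mn (col K i) (col K l)]

lemma gl_len (S : Finset (Fin 2 × ι)) (i l : ι) : (gl K S i l).length ≤ 2 := by
  unfold gl; split_ifs <;> simp_all

lemma gl_len' (S : Finset (Fin 2 × ι)) (i l : ι) (h : ∀ r, (r, l) ∉ S) : (gl K S i l).length = 1 := by
  simp [gl, h]

lemma gl_mem (S : Finset (Fin 2 × ι)) (i l : ι) : ∀ x ∈ gl K S i l, x ∈ Jid K S := by
  obtain ⟨h1, h2⟩ := (Jid_le (K := K) (S := S)).1 le_rfl
  intro x hx
  unfold gl at hx
  split_ifs at hx <;> simp at hx <;> (try rcases hx with hx | hx | hx) <;> (try subst hx) <;>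
    first | exact h1 _ _ | exact h2 _ (by tauto)

lemma gl_prime (S : Finset (Fin 2 × ι)) (i l : ι) (P : Ideal (MvPolynomial (Fin 2 × ι) K))
    (h : ∀ x ∈ gl K S i l, x ∈ P) : mn (col K i) (col K l) ∈ P ∧ ∀ r, (r, l) ∈ S → X (r, l) ∈ P := by
  unfold gl at h
  split_ifs at h with h1 h2 h3
  · simp at h
    refine ⟨?_, fun r _ => ?_⟩
    · exact sub_mem (Ideal.mul_mem_left _ _ h.2) (Ideal.mul_mem_right _ _ h.1)
    · fin_cases r
      exacts [h.1, h.2]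
  all_goals
    simp at h
    refine ⟨by tauto, fun r hr => ?_⟩
    fin_cases r <;> simp at hr ⊢ <;> tauto

lemma stepVJ {I : IRes (MvPolynomial (Fin 2 × ι) K)} (S : Finset (Fin 2 × ι)) (p : Fin 2 × ι) (hp : p ∉ S)
    (E : Finset ι) (hE : p.2 ∉ E) (hES : ∀ l ∈ E, ∀ r, (r, l) ∉ S) (c : ℕ)
    (hc : (if (1 - p.1, p.2) ∈ S then 1 else 0) + 2 * Fintype.card ι < c + E.card + 2) :
    VJ I (Jid K S) (X p) c := by
  obtain ⟨r, i⟩ := p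
  simp only at hE hc
  obtain ⟨pl, hpl⟩ : ∃ pl : List (MvPolynomial (Fin 2 × ι) K),
    pl = if (1 - r, i) ∈ S then [X (1 - r, i)] else [] := ⟨_, rfl⟩
  obtain ⟨g, hg⟩ : ∃ g, g = (Finset.univ.erase i).toList.flatMap (gl K S i) ++ pl := ⟨_, rfl⟩
  have hlen : g.length < c := by
    have h1 : g.length = (∑ l ∈ Finset.univ.erase i, (gl K S i l).length) + pl.length := by
      rw [hg, List.length_append, List.length_flatMap, Finset.sum_map_toList]
    have h2 : pl.length = if (1 - r, i) ∈ S then 1 else 0 := by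
      rw [hpl]; split_ifs <;> rfl
    have h3 : (∑ l ∈ Finset.univ.erase i, (gl K S i l).length) + E.card ≤ 2 * (Fintype.card ι - 1) := by
      have hs : E ⊆ Finset.univ.erase i := fun x hx => by
        refine Finset.mem_erase.2 ⟨fun h => hE (h ▸ hx), Finset.mem_univ _⟩
      have h4 := Finset.sum_sdiff (f := fun l => (gl K S i l).length) hs
      have h5 : ∑ l ∈ E, (gl K S i l).length = E.card := by
        rw [Finset.sum_congr rfl (fun l hl => gl_len' S i l (hES l hl))]; simp
      have h6 : ∑ l ∈ (Finset.univ.erase i) \ E, (gl K S i l).length ≤ ((Finset.univ.erase i) \ E).card * 2 :=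
        Finset.sum_le_card_nsmul _ _ _ (fun l _ => gl_len S i l)
      have h7 := Finset.card_sdiff_add_card_eq_card hs
      rw [Finset.card_erase_of_mem (Finset.mem_univ _), Finset.card_univ] at h7
      omega
    have h8 : 0 < Fintype.card ι := Fintype.card_pos_iff.2 ⟨i⟩
    omega
  have hgm : ∀ x ∈ g, x ∈ Jid K S := by
    intro x hx
    rw [hg, List.mem_append, List.mem_flatMap] at hx
    rcases hx with ⟨l, _, hl⟩ | hx
    · exact gl_mem S i l x hl
    · rw [hpl] at hx
      split_ifs at hx with h
      · simp at hx; subst hx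
        exact ((Jid_le (K := K) (S := S)).1 le_rfl).2 _ h
      · simp at hx
  refine VJ_of (g := sp g) (sp_le.2 hgm) ?_ (van_list g c hlen)
  intro j hj
  rw [Ideal.radical_eq_sInf, Ideal.mem_sInf]
  rintro P ⟨hP, hPp⟩
  by_cases hz : (X (r, i) : MvPolynomial (Fin 2 × ι) K) ∈ P
  · exact Ideal.mul_mem_right _ _ hz
  refine Ideal.mul_mem_left _ _ ?_
  rw [sp_le] at hP
  have hall : ∀ l, l ≠ i → mn (col K i) (col K l) ∈ P ∧ ∀ r, (r, l) ∈ S → X (r, l) ∈ P := by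
    intro l hl
    refine gl_prime S i l P (fun x hx => hP x ?_)
    rw [hg, List.mem_append, List.mem_flatMap]
    exact Or.inl ⟨l, by simp [hl], hx⟩
  have hm : ∀ l, mn (col K i) (col K l) ∈ P := by
    intro l
    by_cases hl : l = i
    · rw [hl, mn_self]; exact zero_mem _
    · exact (hall l hl).1
  have hnc : ¬ ((col K i).1 ∈ P ∧ (col K i).2 ∈ P) := by
    rintro ⟨h1, h2⟩
    apply hz
    fin_cases r
    exacts [h1, h2]
  refine (Jid_le.2 ⟨fun a b => mn_of_col hnc (hm a) (hm b), ?_⟩ : Jid K S ≤ P) hj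
  rintro ⟨s, l⟩ hs
  by_cases hl : l = i
  · subst hl
    have : s = 1 - r := by
      have hne : s ≠ r := fun h => hp (h ▸ hs)
      revert hne; clear * -; revert s r; decide
    subst this
    apply hP
    rw [hg, hpl, if_pos hs]
    simp
  · exact (hall l hl).2 s hs

lemma phase1 {I : IRes (MvPolynomial (Fin 2 × ι) K)} (B : Finset ι) (hB : B.card = 4) (c : ℕ)
    (hc : c + 3 = 2 * Fintype.card ι) (S : Finset (Fin 2 × ι)) (hS : ∀ p ∈ S, p.2 ∉ B)
    (h : ¬ Van I (Jid K S) c) : ¬ Van I (Jid K ∅) c := by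
  induction S using Finset.induction_on with
  | empty => exact h
  | insert p T hp ih =>
    refine ih (fun q hq => hS q (Finset.mem_insert_of_mem hq)) (fun hv => h ?_)
    rw [Jid_insert]
    have : 4 ≤ Fintype.card ι := hB ▸ Finset.card_le_univ B
    obtain ⟨c', rfl⟩ : ∃ c', c = c' + 1 := ⟨c - 1, by omega⟩
    refine step_up (X_ne_zero _) (stepVJ T p hp B (hS p (Finset.mem_insert_self _ _)) ?_ c' ?_) hv
    · intro l hl r hr
      exact hS _ (Finset.mem_insert_of_mem hr) hl
    · split_ifs <;> omega

lemma phase2 {I : IRes (MvPolynomial (Fin 2 × ι) K)} (E : Finset ι) (hE : E.card = 3) (c : ℕ)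
    (hc : c + 3 = 2 * Fintype.card ι) (S : Finset (Fin 2 × ι)) (hS : ∀ p ∈ S, p.2 ∉ E)
    (h : ¬ Van I (Jid K ∅) c) : ¬ Van I (Jid K S) c := by
  induction S using Finset.induction_on with
  | empty => exact h
  | insert p T hp ih =>
    refine fun hv => ih (fun q hq => hS q (Finset.mem_insert_of_mem hq)) ?_
    rw [Jid_insert] at hv
    refine step_down (X_ne_zero _) (stepVJ T p hp E (hS p (Finset.mem_insert_self _ _)) ?_ c ?_) hv
    · intro l hl r hr
      exact hS _ (Finset.mem_insert_of_mem hr) hl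
    · split_ifs <;> omega

lemma phase3 {I : IRes (MvPolynomial (Fin 2 × ι) K)} (E : Finset ι) (hE : E.card = 2) (c : ℕ)
    (hc : c + 3 = 2 * Fintype.card ι) (S : Finset (Fin 2 × ι)) (hS : ∀ p ∈ S, p.2 ∉ E)
    (i0 : ι) (hi0 : i0 ∉ E) (hi : ∃ r, (r, i0) ∉ S)
    (h : ¬ Van I (Jid K ∅) c) : ¬ Van I (Jid K S) c := by
  have hE3 : (insert i0 E).card = 3 := by rw [Finset.card_insert_of_notMem hi0, hE]
  by_cases h0 : ∃ r, (r, i0) ∈ S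
  · obtain ⟨r, hr⟩ := h0
    obtain ⟨s, hs⟩ := hi
    have hsr : ∀ t, (t, i0) ∈ S → t = r := by
      intro t ht
      have h1 : s ≠ r := fun h => hs (h ▸ hr)
      have h2 : s ≠ t := fun h => hs (h ▸ ht)
      clear * - h1 h2; revert s r t; decide
    have hT := phase2 (K := K) (I := I) (insert i0 E) hE3 c hc (S.erase (r, i0)) (by
      rintro ⟨t, l⟩ hp
      rw [Finset.mem_erase] at hp
      rw [Finset.mem_insert, not_or]
      refine ⟨?_, hS _ hp.2⟩
      rintro rfl
      exact hp.1 (by rw [hsr t hp.2])) h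
    intro hv
    apply hT
    rw [← Finset.insert_erase hr, Jid_insert] at hv
    refine step_down (X_ne_zero _) (stepVJ _ _ (Finset.notMem_erase _ _) E hi0 ?_ c ?_) hv
    · intro l hl t ht
      exact hS _ (Finset.mem_of_mem_erase ht) hl
    · rw [if_neg]
      · omega
      · intro h
        have h1 := Finset.mem_of_mem_erase h
        have h2 := hsr _ h1
        simp only at h2
        clear * - h2; revert r; decide
  · push Not at h0
    refine phase2 (insert i0 E) hE3 c hc S ?_ h
    rintro ⟨t, l⟩ hp
    rw [Finset.mem_insert, not_or]
    refine ⟨?_, hS _ hp⟩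
    rintro rfl
    exact h0 t hp
end steps

section phi
variable {K : Type*} [Field K] {τ ρ σ : Type*}

noncomputable def Phi (K : Type*) [Field K] {τ ρ σ : Type*} (s : τ ⊕ ρ ≃ σ) :
    MvPolynomial τ (MvPolynomial ρ K) ≃+* MvPolynomial σ K :=
  (sumRingEquiv K τ ρ).symm.trans (renameEquiv K s).toRingEquiv

lemma Phi_X (s : τ ⊕ ρ ≃ σ) (t : τ) : Phi K s (X t) = X (s (Sum.inl t)) := by
  simp [Phi, sumRingEquiv_symm_X]

lemma Phi_C (s : τ ⊕ ρ ≃ σ) (r : ρ) : Phi K s (C (X r)) = X (s (Sum.inr r)) := by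
  simp [Phi, sumRingEquiv_symm_C_X]
end phi

section base2
variable {K : Type*} [Field K] [CharZero K] {ι : Type*} [Fintype ι] [DecidableEq ι]

lemma map_mn {A B : Type*} [CommRing A] [CommRing B] (φ : A →+* B) (a b : A × A) :
    φ (mn a b) = mn (φ a.1, φ a.2) (φ b.1, φ b.2) := by simp [mn]

lemma plu {A : Type*} [CommRing A] (P : Ideal A) [hP : P.IsPrime] (q : Fin 4 → A × A)
    (h01 : mn (q 0) (q 1) ∈ P) (h02 : mn (q 0) (q 2) ∈ P) (hh : mn (q 0) (q 3) + mn (q 1) (q 2) ∈ P)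
    (h13 : mn (q 1) (q 3) ∈ P) (h23 : mn (q 2) (q 3) ∈ P) (i j : Fin 4) : mn (q i) (q j) ∈ P := by
  have h12 : mn (q 1) (q 2) ∈ P := by
    refine hP.mem_of_pow_mem 2 ?_
    have e : mn (q 1) (q 2) ^ 2 = mn (q 1) (q 2) * (mn (q 0) (q 3) + mn (q 1) (q 2))
      + mn (q 0) (q 1) * mn (q 2) (q 3) - mn (q 0) (q 2) * mn (q 1) (q 3) := by
      simp only [mn]; ring
    rw [e]
    exact sub_mem (add_mem (Ideal.mul_mem_left _ _ hh) (Ideal.mul_mem_left _ _ h23)) (Ideal.mul_mem_left _ _ h13)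
  have h03 : mn (q 0) (q 3) ∈ P := by simpa using sub_mem hh h12
  have hlt : ∀ a b : Fin 4, a < b → mn (q a) (q b) ∈ P := by
    intro a b hab
    fin_cases a <;> fin_cases b <;> first | exact absurd hab (by decide) | assumption
  rcases lt_trichotomy i j with h | h | h
  · exact hlt _ _ h
  · rw [h, mn_self]; exact zero_mem _
  · rw [mn_anti]; exact neg_mem (hlt _ _ h)

lemma base2 {I : IRes (MvPolynomial (Fin 2 × ι) K)} {κ : Type*} [Fintype κ] (ε : Fin 4 ⊕ κ ≃ ι) (S : Finset (Fin 2 × ι))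
    (hS : ∀ p, p ∈ S ↔ ∃ b, p.2 = ε (Sum.inr b)) (c : ℕ) (hc : c + 3 = 2 * Fintype.card ι) :
    ¬ Van I (Jid K S) c := by
  intro hv
  obtain ⟨s, hs⟩ : ∃ s : (Fin 2 × κ) ⊕ (Fin 2 × Fin 4) ≃ Fin 2 × ι,
      (∀ r b, s (Sum.inl (r, b)) = (r, ε (Sum.inr b))) ∧ (∀ r a, s (Sum.inr (r, a)) = (r, ε (Sum.inl a))) :=
    ⟨((Equiv.prodSumDistrib _ _ _).symm.trans (Equiv.prodCongr (Equiv.refl _) ((Equiv.sumComm _ _).trans ε))),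
      fun _ _ => rfl, fun _ _ => rfl⟩
  obtain ⟨Y, hY⟩ : ∃ Y : List (MvPolynomial (Fin 2 × κ) (MvPolynomial (Fin 2 × Fin 4) K)),
    Y = (Finset.univ : Finset (Fin 2 × κ)).toList.map X ++ (hlist K).map C := ⟨_, rfl⟩
  have hlen : (Y.map (Phi K s)).length = c := by
    have := Fintype.card_congr ε
    simp [hY, hlist] at this ⊢
    omega
  have hcol : ∀ a b, Phi K s (C (mn (col K a) (col K b))) = mn (col K (ε (Sum.inl a))) (col K (ε (Sum.inl b))) := by
    intro a b
    have := map_mn ((Phi K s).toRingHom.comp C) (col K a) (col K b)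
    simp only [RingHom.comp_apply, RingEquiv.toRingHom_eq_coe, RingEquiv.coe_toRingHom, col, Phi_C, hs] at this
    exact this
  have hrad : (Jid K S).radical = (sp (Y.map (Phi K s))).radical := by
    apply radical_eq_of_primes
    intro P hP
    rw [Jid_le, sp_le, hY]
    simp only [List.map_append, List.map_map, List.mem_append, hlist, List.map_cons, List.map_nil, map_add, hcol]
    constructor
    · rintro ⟨h1, h2⟩ x (hx | hx)
      · obtain ⟨⟨r, b⟩, _, rfl⟩ := List.mem_map.1 hx
        rw [Function.comp_apply, Phi_X, hs.1]
        exact h2 _ ((hS _).2 ⟨b, rfl⟩)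
      · simp at hx
        rcases hx with hx | hx | hx | hx | hx
        · rw [hx]; exact h1 _ _
        · rw [hx]; exact h1 _ _
        · rw [hx]; exact add_mem (h1 _ _) (h1 _ _)
        · rw [hx]; exact h1 _ _
        · rw [hx]; exact h1 _ _
    · intro h
      have h2 : ∀ p ∈ S, X p ∈ P := by
        rintro ⟨r, l⟩ hp
        obtain ⟨b, hb⟩ := (hS _).1 hp
        simp only at hb
        refine h _ (Or.inl (List.mem_map.2 ⟨(r, b), by simp, ?_⟩))
        rw [Function.comp_apply, Phi_X, hs.1, hb]
      refine ⟨?_, h2⟩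
      obtain ⟨q, hq⟩ : ∃ q : Fin 4 → _ × _, ∀ a, q a = col K (ε (Sum.inl a)) := ⟨_, fun _ => rfl⟩
      simp only [← hq] at h
      have h01 : mn (q 0) (q 1) ∈ P := h _ (by simp)
      have h02 : mn (q 0) (q 2) ∈ P := h _ (by simp)
      have hh : mn (q 0) (q 3) + mn (q 1) (q 2) ∈ P := h _ (by simp)
      have h13 : mn (q 1) (q 3) ∈ P := h _ (by simp)
      have h23 : mn (q 2) (q 3) ∈ P := h _ (by simp)
      have hpl := plu P q h01 h02 hh h13 h23
      have hz : ∀ b x, mn (col K (ε (Sum.inr b))) x ∈ P := fun b x =>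
        sub_mem (Ideal.mul_mem_right _ _ (h2 (0, ε (Sum.inr b)) ((hS _).2 ⟨b, rfl⟩)))
          (Ideal.mul_mem_left _ _ (h2 (1, ε (Sum.inr b)) ((hS _).2 ⟨b, rfl⟩)))
      intro i j
      obtain ⟨i, rfl⟩ := ε.surjective i
      obtain ⟨j, rfl⟩ := ε.surjective j
      rcases i with i | i
      · rcases j with j | j
        · rw [← hq, ← hq]
          exact hpl i j
        · rw [mn_anti]; exact neg_mem (hz _ _)
      · exact hz _ _
  have hv2 := Van_congr hrad hv
  rw [← hlen] at hv2
  have hQ := Q_equiv (Phi K s).symm _ ((van_iff' _).1 hv2) 1 1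
  rw [List.map_map] at hQ
  have : (⇑(Phi K s).symm ∘ ⇑(Phi K s)) = id := by ext1 x; simp
  rw [this, List.map_id, hY] at hQ
  exact base_fail (tv_back _ (Finset.nodup_toList _) (by simp) _ hQ)

theorem main_fail {I : IRes (MvPolynomial (Fin 2 × ι) K)} (h4 : 4 ≤ Fintype.card ι) (E : Finset ι) (hE : E.card = 2) (c : ℕ)
    (hc : c + 3 = 2 * Fintype.card ι) (S : Finset (Fin 2 × ι)) (hS : ∀ p ∈ S, p.2 ∉ E)
    (i0 : ι) (hi0 : i0 ∉ E) (hi : ∃ r, (r, i0) ∉ S) : ¬ Van I (Jid K S) c := by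
  refine phase3 E hE c hc S hS i0 hi0 hi ?_
  obtain ⟨ε⟩ : Nonempty (Fin 4 ⊕ Fin (Fintype.card ι - 4) ≃ ι) := by
    rw [← Fintype.card_eq]; simp; omega
  refine phase1 (Finset.univ.map ⟨fun a => ε (Sum.inl a), fun a b h => by simpa using h⟩) (by simp) c hc
    (Finset.univ.filter fun p => ∃ b, p.2 = ε (Sum.inr b)) ?_ (base2 ε _ (by simp) c hc)
  intro p hp h
  obtain ⟨a, _, ha⟩ := Finset.mem_map.1 h
  obtain ⟨_, b, hb⟩ := Finset.mem_filter.1 hp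
  rw [hb] at ha
  exact Sum.inl_ne_inr (ε.injective ha)
end base2
end LC

namespace LC
open MvPolynomial
universe u

section assemble
variable {R : Type u} [CommRing R] [IsNoetherianRing R] [IsDomain R]

lemma sp_ofFn {r : ℕ} (f : Fin r → R) : sp (List.ofFn f) = Ideal.span (Set.range f) := by
  rw [sp]; congr 1; ext x; simp [List.mem_ofFn]

lemma assemble (J : Ideal R) (l : List R) (hl : (sp l).radical = J.radical) (hd : 0 < l.length)
    (hn : ¬ Van (theRes R) J l.length) : araRank J = l.length ∧ cohDim J = l.length := by
  have hvan : ∀ (l' : List R), (sp l').radical = J.radical → ∀ i, l'.length < i → Van (theRes R) J i :=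
    fun l' h i hi => Van_congr h (van_list l' i hi)
  constructor
  · unfold araRank
    have hmem : l.length ∈ { r | ∃ f : Fin r → R, (Ideal.span (Set.range f)).radical = J.radical } := by
      refine ⟨l.get, ?_⟩
      rw [← sp_ofFn, List.ofFn_get, hl]
    refine le_antisymm (Nat.sInf_le hmem) (le_csInf ⟨_, hmem⟩ ?_)
    rintro r ⟨f, hf⟩
    by_contra hr
    push Not at hr
    exact hn (hvan (List.ofFn f) (by rw [sp_ofFn, hf]) _ (by simpa using hr))
  · unfold cohDim
    have hmem : l.length ∈ { i | Nontrivial ((localCohomology J i).obj (ModuleCat.of R R)) } := by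
      obtain ⟨i, hi⟩ : ∃ i, l.length = i + 1 := ⟨l.length - 1, by omega⟩
      rw [hi] at hn ⊢
      rw [Set.mem_setOf_eq, ← not_subsingleton_iff_nontrivial, bridge]
      exact hn
    have hub : ∀ i ∈ { i | Nontrivial ((localCohomology J i).obj (ModuleCat.of R R)) }, i ≤ l.length := by
      intro i hi
      by_contra hlt
      push Not at hlt
      obtain ⟨j, rfl⟩ : ∃ j, i = j + 1 := ⟨i - 1, by omega⟩
      rw [Set.mem_setOf_eq, ← not_subsingleton_iff_nontrivial, bridge] at hi
      exact hi (hvan l hl _ hlt)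
    exact le_antisymm (csSup_le ⟨_, hmem⟩ hub) (le_csSup ⟨_, hub⟩ hmem)
end assemble

lemma minors_le {R : Type*} [CommRing R] {n : ℕ} (X : Matrix (Fin 2) (Fin n) R) (P : Ideal R) :
    minorsIdeal 2 X ≤ P ↔ ∀ i j, mn (X 0 i, X 1 i) (X 0 j, X 1 j) ∈ P := by
  rw [minorsIdeal, Ideal.span_le]
  constructor
  · intro h i j
    by_cases hij : i = j
    · rw [hij, mn_self]; exact zero_mem _
    · refine h ⟨id, ![i, j], Function.injective_id, ?_, ?_⟩
      · intro a b hab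
        fin_cases a <;> fin_cases b <;> simp_all
      · simp [Matrix.det_fin_two, mn]
  · rintro h _ ⟨r, c, hr, -, rfl⟩
    rw [SetLike.mem_coe, Matrix.det_fin_two]
    simp only [Matrix.submatrix_apply]
    have h01 : r 0 ≠ r 1 := fun h => absurd (hr h) (by decide)
    rcases (show (r 0 = 0 ∧ r 1 = 1) ∨ (r 0 = 1 ∧ r 1 = 0) by
      revert h01; generalize r 0 = a; generalize r 1 = b; revert a b; decide) with ⟨h0, h1⟩ | ⟨h0, h1⟩
    · rw [h0, h1]; exact h _ _
    · rw [h0, h1]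
      have := neg_mem (h (c 0) (c 1))
      simp only [mn] at this
      convert this using 1; ring

section transfer
variable {K : Type*} [Field K] {n k m : ℕ} (M : Matrix (Fin 2) (Fin n) (MvPolynomial (Fin m) K))
  (e : Fin 2 × Fin n ≃ (Fin k ⊕ Fin m))

lemma van_transfer
  (hX : ∀ p : Fin 2 × Fin n, M p.1 p.2 = Sum.elim (fun _ => 0) (fun l => MvPolynomial.X l) (e p))
    {I : IRes (MvPolynomial (Fin m) K)} {I' : IRes (MvPolynomial (Fin 2 × (Fin n ⊕ Unit)) K)}
    (l : List (MvPolynomial (Fin m) K)) (hl : (sp l).radical = (minorsIdeal 2 M).radical)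
    (hv : Van I (sp l) l.length) (S : Finset (Fin 2 × (Fin n ⊕ Unit)))
    (hS1 : ∀ r, (r, Sum.inr ()) ∈ S) (hS2 : ∀ r j, (r, Sum.inl j) ∈ S ↔ ∃ h, e (r, j) = Sum.inl h) :
    Van I' (Jid K S) (k + 2 + l.length) := by
  obtain ⟨s, hs1, hs2, hs3⟩ : ∃ s : (Fin k ⊕ Fin 2 × Unit) ⊕ Fin m ≃ Fin 2 × (Fin n ⊕ Unit),
      (∀ h, s (Sum.inl (Sum.inl h)) = ((e.symm (Sum.inl h)).1, Sum.inl (e.symm (Sum.inl h)).2)) ∧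
      (∀ r, s (Sum.inl (Sum.inr (r, ()))) = (r, Sum.inr ())) ∧
      (∀ h, s (Sum.inr h) = ((e.symm (Sum.inr h)).1, Sum.inl (e.symm (Sum.inr h)).2)) := by
    refine ⟨(((Equiv.sumAssoc _ _ _).trans ((Equiv.sumCongr (Equiv.refl _) (Equiv.sumComm _ _)).trans
      (Equiv.sumAssoc _ _ _).symm)).trans (Equiv.sumCongr e.symm (Equiv.refl _))).trans
      (Equiv.prodSumDistrib _ _ _).symm, ?_, ?_, ?_⟩ <;> intros <;> rfl
  obtain ⟨Y, hY⟩ : ∃ Y : List (MvPolynomial (Fin k ⊕ Fin 2 × Unit) (MvPolynomial (Fin m) K)),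
    Y = (Finset.univ : Finset (Fin k ⊕ Fin 2 × Unit)).toList.map MvPolynomial.X ++ l.map C := ⟨_, rfl⟩
  have hlen : (Y.map (Phi K s)).length = k + 2 + l.length := by
    simp [hY]
  have hQ : ∀ L x, Q (Y.map (Phi K s)) L x := by
    refine Q_equiv _ _ ?_
    rw [hY]
    exact tv_fwd _ _ ((van_iff' _).1 hv)
  have hv2 : Van I' (sp (Y.map (Phi K s))) (k + 2 + l.length) := by
    rw [← hlen]; exact (van_iff' _).2 hQ
  refine Van_congr ?_ hv2
  apply radical_eq_of_primes
  intro P hP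
  obtain ⟨φ, hφ⟩ : ∃ φ : MvPolynomial (Fin m) K →+* MvPolynomial (Fin 2 × (Fin n ⊕ Unit)) K,
    ∀ f, φ f = Phi K s (C f) := ⟨(Phi K s).toRingHom.comp C, fun _ => rfl⟩
  have hP' : (P.comap φ).IsPrime := Ideal.comap_isPrime φ P
  have h1 : sp (Y.map (Phi K s)) ≤ P ↔ (∀ t, MvPolynomial.X (s (Sum.inl t)) ∈ P) ∧ sp l ≤ P.comap φ := by
    rw [sp_le, sp_le, hY]
    constructor
    · intro h
      refine ⟨fun t => ?_, fun f hf => ?_⟩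
      · rw [← Phi_X]
        exact h _ (List.mem_map_of_mem (List.mem_append_left _ (List.mem_map_of_mem (by simp))))
      · rw [Ideal.mem_comap, hφ]
        exact h _ (List.mem_map_of_mem (List.mem_append_right _ (List.mem_map_of_mem hf)))
    · rintro ⟨h1, h2⟩ x hx
      obtain ⟨y, hy, rfl⟩ := List.mem_map.1 hx
      rcases List.mem_append.1 hy with hy | hy
      · obtain ⟨t, _, rfl⟩ := List.mem_map.1 hy
        rw [Phi_X]; exact h1 t
      · obtain ⟨f, hf, rfl⟩ := List.mem_map.1 hy
        rw [← hφ]; exact h2 f hf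
  have h2 : (∀ t, (MvPolynomial.X (s (Sum.inl t)) : MvPolynomial _ K) ∈ P) ↔ ∀ p ∈ S, MvPolynomial.X p ∈ P := by
    constructor
    · rintro h ⟨r, j | j⟩ hp
      · obtain ⟨t, ht⟩ := (hS2 r j).1 hp
        have := h (Sum.inl t)
        rw [hs1, ← ht, e.symm_apply_apply] at this
        exact this
      · have := h (Sum.inr (r, ()))
        rw [hs2] at this
        exact this
    · rintro h (t | ⟨r, u⟩)
      · rw [hs1]; exact h _ ((hS2 _ _).2 ⟨t, by simp⟩)
      · rw [hs2]; exact h _ (hS1 r)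
  have h3 : sp l ≤ P.comap φ ↔ ∀ i j, mn (φ (M 0 i), φ (M 1 i)) (φ (M 0 j), φ (M 1 j)) ∈ P := by
    rw [← hP'.radical_le_iff, hl, hP'.radical_le_iff, minors_le]
    simp only [Ideal.mem_comap, map_mn]
  rw [h1, h2, h3, Jid_le, and_comm]
  refine and_congr_left fun hp => ?_
  have hent : ∀ r i, φ (M r i) - MvPolynomial.X (r, Sum.inl i) ∈ P := by
    intro r i
    have h4 := hX (r, i)
    simp only at h4
    rcases h5 : e (r, i) with h | h
    · rw [h4, h5, Sum.elim_inl, map_zero, zero_sub]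
      exact neg_mem (hp _ ((hS2 _ _).2 ⟨h, h5⟩))
    · rw [h4, h5, Sum.elim_inr, hφ, Phi_C, hs3, ← h5, e.symm_apply_apply]
      simp
  have hcg : ∀ i, cg P (φ (M 0 i), φ (M 1 i)) (col K (Sum.inl i)) := fun i => ⟨hent 0 i, hent 1 i⟩
  have hz : ∀ x, mn (col K (Sum.inr ())) x ∈ P := fun x =>
    sub_mem (Ideal.mul_mem_right _ _ (hp (0, Sum.inr ()) (hS1 _)))
      (Ideal.mul_mem_left _ _ (hp (1, Sum.inr ()) (hS1 _)))
  constructor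
  · rintro h (i | i) (j | j)
    · exact mn_cg (hcg i) (hcg j) (h i j)
    · rw [mn_anti]; exact neg_mem (hz _)
    · exact hz _
    · exact hz _
  · intro h i j
    exact mn_cg (cg_symm (hcg i)) (cg_symm (hcg j)) (h _ _)

lemma nz_total
  (hX : ∀ p : Fin 2 × Fin n, M p.1 p.2 = Sum.elim (fun _ => 0) (fun l => MvPolynomial.X l) (e p))
    : ∑ j, nz (M 0 j, M 1 j) = k := by
  classical
  have h1 : ∑ p : Fin 2 × Fin n, (if M p.1 p.2 = 0 then 1 else 0) = k := by
    have : ∑ p : Fin 2 × Fin n, (if M p.1 p.2 = 0 then 1 else 0) =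
      ∑ q : Fin k ⊕ Fin m, (if (Sum.elim (fun _ => 0) (fun l => MvPolynomial.X l) q : MvPolynomial (Fin m) K) = 0 then 1 else 0) :=
      Fintype.sum_equiv e _ _ (fun p => by rw [hX p])
    rw [this, Fintype.sum_sum_type]
    simp
  rw [Fintype.sum_prod_type_right] at h1
  rw [← h1]
  refine Finset.sum_congr rfl fun j _ => ?_
  rw [Fin.sum_univ_two, nz]
  congr
end transfer

theorem main {K : Type*} [Field K] [CharZero K] (n k m : ℕ) (hn : 1 ≤ n)
    (M : Matrix (Fin 2) (Fin (n + 2)) (MvPolynomial (Fin m) K))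
    (e : Fin 2 × Fin (n + 2) ≃ (Fin k ⊕ Fin m))
    (hX : ∀ p, M p.1 p.2 = Sum.elim (fun _ => 0) (fun l => MvPolynomial.X l) (e p))
    (hcols : ∀ h : Fin k, ((e.symm (Sum.inl h)).2 : ℕ) < n) :
    araRank (minorsIdeal 2 M) = 2 * n + 1 - k ∧ cohDim (minorsIdeal 2 M) = 2 * n + 1 - k := by
  classical
  obtain ⟨cl, hcl⟩ : ∃ cl : Fin (n + 2) → _ × _, ∀ j, cl j = (M 0 j, M 1 j) := ⟨_, fun _ => rfl⟩
  have hinr : ∀ r (j : Fin (n+2)), n ≤ (j : ℕ) → ∃ t, e (r, j) = Sum.inr t := by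
    intro r j hj
    rcases h : e (r, j) with t | t
    · have := hcols t
      rw [← h, e.symm_apply_apply] at this
      simp at this; omega
    · exact ⟨t, rfl⟩
  have hne : ∀ r (j : Fin (n+2)), n ≤ (j : ℕ) → M r j ≠ 0 := by
    intro r j hj
    obtain ⟨t, ht⟩ := hinr r j hj
    have := hX (r, j)
    simp only at this
    rw [this, ht]
    exact X_ne_zero t
  have hnz0 : ∀ j : Fin (n+2), n ≤ (j : ℕ) → nz (cl j) = 0 := by
    intro j hj
    simp [nz, hcl, hne _ j hj]
  have htot := nz_total M e hX
  simp only [← hcl] at htot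
  rw [Fin.sum_univ_castSucc, Fin.sum_univ_castSucc, hnz0 _ (by simp), hnz0 _ (by simp)] at htot
  simp only [add_zero] at htot
  obtain ⟨l, hlen, hrad⟩ := ara_list (cl (Fin.last n).castSucc) (cl (Fin.last (n+1)))
    (List.ofFn fun j : Fin n => cl j.castSucc.castSucc)
  rw [List.map_ofFn, List.sum_ofFn] at hlen
  simp only [Function.comp_apply, List.length_ofFn] at hlen
  rw [htot] at hlen
  have hrad' : (sp l).radical = (minorsIdeal 2 M).radical := by
    rw [hrad]
    apply radical_eq_of_primes
    intro P hP
    rw [mI_le, minors_le]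
    simp only [← hcl]
    have hm : ∀ c, c ∈ (List.ofFn fun j : Fin n => cl j.castSucc.castSucc) ++
        [cl (Fin.last n).castSucc, cl (Fin.last (n+1))] ↔ ∃ j, c = cl j := by
      intro c
      rw [List.mem_append, List.mem_ofFn]
      constructor
      · rintro (⟨j, rfl⟩ | h)
        · exact ⟨_, rfl⟩
        · simp at h
          rcases h with h | h
          · exact ⟨_, h⟩
          · exact ⟨_, h⟩
      · rintro ⟨j, rfl⟩
        refine Fin.lastCases ?_ (fun j => ?_) j
        · right; simp
        · refine Fin.lastCases ?_ (fun j => ?_) j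
          · right; simp
          · left; exact ⟨j, rfl⟩
    constructor
    · intro h i j
      exact h _ ((hm _).2 ⟨i, rfl⟩) _ ((hm _).2 ⟨j, rfl⟩)
    · intro h c hc c' hc'
      obtain ⟨i, rfl⟩ := (hm _).1 hc
      obtain ⟨j, rfl⟩ := (hm _).1 hc'
      exact h i j
  have hnz2 : ∀ c : MvPolynomial (Fin m) K × MvPolynomial (Fin m) K, nz c ≤ 2 := by
    intro c; unfold nz; split_ifs <;> omega
  have hk : k ≤ 2 * n := by
    rw [← htot]
    refine (Finset.sum_le_card_nsmul _ _ 2 (fun j _ => hnz2 _)).trans ?_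
    simp [mul_comm]
  have hd : l.length = 2 * n + 1 - k := by omega
  rw [← hd]
  refine assemble _ l hrad' (by omega) ?_
  intro hv
  have hv' := Van_congr hrad'.symm hv
  by_cases hex : ∃ (r : Fin 2) (j : Fin n), ∃ t, e (r, j.castSucc.castSucc) = Sum.inr t
  · obtain ⟨r, j, t, ht⟩ := hex
    obtain ⟨S, hS⟩ : ∃ S : Finset (Fin 2 × (Fin (n+2) ⊕ Unit)), ∀ p, p ∈ S ↔
        p.2 = Sum.inr () ∨ ∃ j, p.2 = Sum.inl j ∧ ∃ h, e (p.1, j) = Sum.inl h :=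
      ⟨Finset.univ.filter (fun p => p.2 = Sum.inr () ∨ ∃ j, p.2 = Sum.inl j ∧ ∃ h, e (p.1, j) = Sum.inl h),
        fun p => by rw [Finset.mem_filter]; simp only [Finset.mem_univ, true_and]⟩
    have hS2 : ∀ r j, (r, Sum.inl j) ∈ S ↔ ∃ h, e (r, j) = Sum.inl h := by
      intro r j; rw [hS]; simp
    have hv2 := van_transfer M e hX (I' := theRes _) l hrad' hv' S (fun r => (hS _).2 (Or.inl rfl)) hS2
    refine main_fail (by simp; omega)
      ({Sum.inl (Fin.last n).castSucc, Sum.inl (Fin.last (n+1))} : Finset (Fin (n+2) ⊕ Unit)) ?_ _ ?_ S ?_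
      (Sum.inl j.castSucc.castSucc) ?_ ⟨r, ?_⟩ hv2
    · rw [Finset.card_pair]
      intro h
      have := congrArg Fin.val (Sum.inl.inj h)
      simp at this
    · simp; omega
    · rintro ⟨s, i⟩ hp hi
      rw [hS] at hp
      rcases hp with hp | ⟨i', hp, h, hh⟩
      · simp only at hp; subst hp; simp at hi
      · simp only at hp hh; subst hp
        have hge : n ≤ (i' : ℕ) := by
          rw [Finset.mem_insert, Finset.mem_singleton] at hi
          rcases hi with hi | hi
          · rw [Sum.inl.inj hi]; simp
          · rw [Sum.inl.inj hi]; simp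
        obtain ⟨t', ht'⟩ := hinr s i' hge
        rw [hh] at ht'; simp at ht'
    · intro hi
      rw [Finset.mem_insert, Finset.mem_singleton] at hi
      have hj := j.2
      rcases hi with hi | hi <;> have := congrArg Fin.val (Sum.inl.inj hi) <;> simp at this <;> omega
    · rw [hS2, ht]; simp
  · have hall : ∀ j : Fin n, nz (cl j.castSucc.castSucc) = 2 := by
      intro j
      have h0 : ∀ r, M r j.castSucc.castSucc = 0 := by
        intro r
        rcases h : e (r, j.castSucc.castSucc) with t | t
        · have := hX (r, j.castSucc.castSucc)
          simp only at this
          rw [this, h]; rfl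
        · exact absurd ⟨r, j, t, h⟩ hex
      simp [nz, hcl, h0]
    simp only [hall, Finset.sum_const, Finset.card_univ, Fintype.card_fin, smul_eq_mul] at htot
    have h1 : l.length = 1 := by omega
    obtain ⟨f, rfl⟩ := List.length_eq_one_iff.1 h1
    obtain ⟨N, hN⟩ := (van_iff' _).1 hv' 1 1
    simp only [pw, bot_sup_eq, List.prod_cons, List.prod_nil, mul_one] at hN
    obtain ⟨g, hg⟩ := Ideal.mem_span_singleton.1 hN
    have hsp : sp [f] = Ideal.span {f} := by rw [sp_cons, sp_nil, bot_sup_eq]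
    rw [hsp] at hrad'
    by_cases hf : f = 0
    · have hle : minorsIdeal 2 M ≤ ⊥ := by
        refine Ideal.le_radical.trans ?_
        rw [← hrad', hf, Ideal.span_singleton_eq_bot.2 rfl]
        exact (Ideal.isPrime_bot.radical_le_iff).2 le_rfl
      have hm := (minors_le _ _).1 hle (Fin.last n).castSucc (Fin.last (n+1))
      rw [Ideal.mem_bot] at hm
      obtain ⟨t0, h0⟩ := hinr 0 (Fin.last n).castSucc (by simp)
      obtain ⟨t1, h1⟩ := hinr 1 (Fin.last n).castSucc (by simp)
      obtain ⟨t2, h2⟩ := hinr 0 (Fin.last (n+1)) (by simp)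
      obtain ⟨t3, h3⟩ := hinr 1 (Fin.last (n+1)) (by simp)
      have x0 := hX (0, (Fin.last n).castSucc)
      have x1 := hX (1, (Fin.last n).castSucc)
      have x2 := hX (0, Fin.last (n+1))
      have x3 := hX (1, Fin.last (n+1))
      simp only [h0, h1, h2, h3, Sum.elim_inr] at x0 x1 x2 x3
      simp only [mn, x0, x1, x2, x3] at hm
      have ne1 : t1 ≠ t0 := fun h => by
        rw [h, ← h0] at h1
        simpa using e.injective h1
      have ne2 : t1 ≠ t3 := fun h => by
        rw [h, ← h3] at h1
        have := congrArg Prod.snd (e.injective h1)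
        have := congrArg Fin.val this
        simp at this
      have := congrArg (aeval (fun t => if t = t1 then (0 : K) else 1)) hm
      simp [ne1.symm, ne2.symm] at this
    · have hu : IsUnit f := by
        refine IsUnit.of_mul_eq_one g ?_
        have h2 : f ^ N * (f * g) = f ^ N * 1 := by rw [mul_one]; conv_rhs => rw [hg]
                                                    ring
        exact mul_left_cancel₀ (pow_ne_zero _ hf) h2
      have htop : minorsIdeal 2 M = ⊤ := by
        rw [← Ideal.radical_eq_top, ← hrad', Ideal.span_singleton_eq_top.2 hu, Ideal.radical_top]
      have hle : minorsIdeal 2 M ≤ RingHom.ker (constantCoeff : MvPolynomial (Fin m) K →+* K) := by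
        rw [minors_le]
        have h0 : ∀ r j, constantCoeff (M r j) = 0 := by
          intro r j
          have := hX (r, j)
          simp only at this
          rw [this]
          rcases e (r, j) with t | t <;> simp
        intro i j
        rw [RingHom.mem_ker]
        simp [mn, h0]
      rw [htop] at hle
      have : (1 : MvPolynomial (Fin m) K) ∈ RingHom.ker (constantCoeff : MvPolynomial (Fin m) K →+* K) :=
        hle Submodule.mem_top
      rw [RingHom.mem_ker] at this
      simp at this
end LC
/-- For a sparse generic `(2 × n)`-matrix `X` (`n ≥ 3`) with exactly `k` zero entries,
all lying outside the last two columns, whose remaining entries are pairwise distinct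
indeterminates, over an algebraically closed field of characteristic zero:
`ara I_2(X) = cd I_2(X) = 2n - 3 - k`. -/
theorem stmt10 {K : Type*} [Field K] [IsAlgClosed K] [CharZero K] (n k : ℕ) (hn : 3 ≤ n)
    (X : Matrix (Fin 2) (Fin n) (MvPolynomial (Fin (2 * n - k)) K))
    (e : Fin 2 × Fin n ≃ (Fin k ⊕ Fin (2 * n - k)))
    (hX : ∀ p : Fin 2 × Fin n,
      X p.1 p.2 = Sum.elim (fun _ => 0) (fun l => MvPolynomial.X l) (e p))
    (hcols : ∀ h : Fin k, ((e.symm (Sum.inl h)).2 : ℕ) < n - 2) :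
    araRank (minorsIdeal 2 X) = 2 * n - 3 - k ∧
      cohDim (minorsIdeal 2 X) = 2 * n - 3 - k := by

  obtain ⟨n', rfl⟩ : ∃ n', n = n' + 2 := ⟨n - 2, by omega⟩
  have h := LC.main n' k _ (by omega) X e hX (fun h => by simpa using hcols h)
  have h1 : 2 * (n' + 2) - 3 - k = 2 * n' + 1 - k := by omega
  rw [h1]
  exact h
end

section
/- Let K be an algebraically closed field of characteristic 0, R = K[x_1,…,x_{10}], and let X be the (3×4)-matrix with rows (0, x_1, x_2, x_3), (0, x_4, x_5, x_6), (x_7, x_8, x_9, x_{10}). Let I = I_3(X) be the ideal of R generated by the 3×3 minors of X. Then ara I = cd I = 3. -/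
/-- The `(3 × 4)`-matrix with rows `(0, x₁, x₂, x₃)`, `(0, x₄, x₅, x₆)`,
`(x₇, x₈, x₉, x₁₀)` over `K[x₁, …, x₁₀]`, where the variables `x₁, …, x₁₀` are
indexed by `Fin 10` starting from `0`. -/
noncomputable def exampleMatrix11 (K : Type*) [Field K] :
    Matrix (Fin 3) (Fin 4) (MvPolynomial (Fin 10) K) :=
  !![0, MvPolynomial.X 0, MvPolynomial.X 1, MvPolynomial.X 2;
     0, MvPolynomial.X 3, MvPolynomial.X 4, MvPolynomial.X 5;
     MvPolynomial.X 6, MvPolynomial.X 7, MvPolynomial.X 8, MvPolynomial.X 9]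

namespace Stmt11Aux

open CategoryTheory Limits Opposite Abelian

universe u

section Bridge

variable {R : Type u} [CommRing R]

/-- The chain complex in the opposite category computing the derived functor. -/
noncomputable def opCx {X : ModuleCat.{u} R} (P : ProjectiveResolution X) (Y : ModuleCat.{u} R) :
    ChainComplex (ModuleCat.{u} R)ᵒᵖ ℕ :=
  ((((linearYoneda R (ModuleCat.{u} R)).obj Y).rightOp).mapHomologicalComplex
    (ComplexShape.down ℕ)).obj P.complex

/-- The comparison isomorphism. -/
noncomputable def isoL {X : ModuleCat.{u} R} (P : ProjectiveResolution X) (Y : ModuleCat.{u} R)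
    (n : ℕ) : ((((linearYoneda R (ModuleCat.{u} R)).obj Y).rightOp).leftDerived n).obj X ≅
      (opCx P Y).homology n :=
  P.isoLeftDerivedObj ((linearYoneda R (ModuleCat.{u} R)).obj Y).rightOp n

/-- The map induced by a lift. -/
noncomputable def opCxMap {X X' : ModuleCat.{u} R} (P : ProjectiveResolution X)
    (P' : ProjectiveResolution X') (Y : ModuleCat.{u} R)
    (φ : P'.complex ⟶ P.complex) : opCx P' Y ⟶ opCx P Y :=
  ((((linearYoneda R (ModuleCat.{u} R)).obj Y).rightOp).mapHomologicalComplex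
    (ComplexShape.down ℕ)).map φ

lemma isoL_nat {X X' : ModuleCat.{u} R} (P : ProjectiveResolution X)
    (P' : ProjectiveResolution X') (Y : ModuleCat.{u} R) (n : ℕ) (g : X' ⟶ X)
    (φ : P'.complex ⟶ P.complex) (comm : φ.f 0 ≫ P.π.f 0 = P'.π.f 0 ≫ g) :
    ((((linearYoneda R (ModuleCat.{u} R)).obj Y).rightOp).leftDerived n).map g ≫
      (isoL P Y n).hom =
    (isoL P' Y n).hom ≫ HomologicalComplex.homologyMap (opCxMap P P' Y φ) n :=
  ProjectiveResolution.isoLeftDerivedObj_hom_naturality g P' P φ comm _ n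

/-- The map from opcycles to the old `Ext`. -/
noncomputable def clsMap {X : ModuleCat.{u} R} (P : ProjectiveResolution X) (Y : ModuleCat.{u} R)
    (n : ℕ) : ((opCx P Y).opcycles n).unop ⟶ ((_root_.Ext R (ModuleCat.{u} R) n).obj (op X)).obj Y :=
  ((isoL P Y n).hom ≫ (opCx P Y).homologyι n).unop

noncomputable def pMap {X : ModuleCat.{u} R} (P : ProjectiveResolution X) (Y : ModuleCat.{u} R)
    (n : ℕ) : ((opCx P Y).opcycles n).unop ⟶ ModuleCat.of R (P.complex.X n ⟶ Y) :=
  ((opCx P Y).pOpcycles n).unop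

lemma pMap_inj {X : ModuleCat.{u} R} (P : ProjectiveResolution X) (Y : ModuleCat.{u} R)
    (n : ℕ) : Function.Injective (pMap P Y n) := by
  have : Mono (pMap P Y n) := inferInstanceAs (Mono ((opCx P Y).pOpcycles n).unop)
  exact (ModuleCat.mono_iff_injective _).1 this

lemma clsMap_surj {X : ModuleCat.{u} R} (P : ProjectiveResolution X) (Y : ModuleCat.{u} R)
    (n : ℕ) : Function.Surjective (clsMap P Y n) := by
  have : Epi (clsMap P Y n) := by
    have : Mono ((isoL P Y n).hom ≫ (opCx P Y).homologyι n) := mono_comp _ _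
    exact inferInstanceAs (Epi ((isoL P Y n).hom ≫ (opCx P Y).homologyι n).unop)
  exact (ModuleCat.epi_iff_surjective _).1 this

lemma d_pMap {X : ModuleCat.{u} R} (P : ProjectiveResolution X) (Y : ModuleCat.{u} R)
    (n m : ℕ) (c : ((opCx P Y).opcycles n).unop) :
    P.complex.d m n ≫ (show P.complex.X n ⟶ Y from pMap P Y n c) = 0 := by
  have h := (opCx P Y).d_pOpcycles m n
  have h2 := congrArg Quiver.Hom.unop h
  have h3 := congrArg (fun φ => (ModuleCat.Hom.hom φ) c) h2
  exact h3

lemma pMap_exists {X : ModuleCat.{u} R} (P : ProjectiveResolution X) (Y : ModuleCat.{u} R)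
    (n : ℕ) (f : P.complex.X n ⟶ Y) (hf : P.complex.d (n+1) n ≫ f = 0) :
    ∃ c, pMap P Y n c = f := by
  let k0 : ModuleCat.of R R ⟶ ModuleCat.of R (P.complex.X n ⟶ Y) :=
    ModuleCat.ofHom (LinearMap.toSpanSingleton R _ f)
  let k : (opCx P Y).X n ⟶ op (ModuleCat.of R R) := k0.op
  have hk : (opCx P Y).d (n+1) n ≫ k = 0 := by
    apply Quiver.Hom.unop_inj
    ext
    change P.complex.d (n+1) n ≫ ((1 : R) • f) = 0
    rw [one_smul, hf]
  have h := (opCx P Y).p_descOpcycles k (n+1) (by simp) hk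
  refine ⟨((opCx P Y).descOpcycles k (n+1) (by simp) hk).unop (1 : R), ?_⟩
  have h2 := congrArg Quiver.Hom.unop h
  have h3 := congrArg (fun φ => (ModuleCat.Hom.hom φ) (1 : R)) h2
  refine h3.trans ?_
  change (1 : R) • f = f
  rw [one_smul]

lemma clsMap_eq_zero {X : ModuleCat.{u} R} (P : ProjectiveResolution X) (Y : ModuleCat.{u} R)
    (n : ℕ) (c : ((opCx P Y).opcycles (n+1)).unop) :
    clsMap P Y (n+1) c = 0 ↔
      ∃ h : P.complex.X n ⟶ Y, P.complex.d (n+1) n ≫ h = pMap P Y (n+1) c := by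
  have hex : (ShortComplex.mk _ _ ((opCx P Y).homologyι_comp_fromOpcycles (n+1) n)).Exact :=
    ShortComplex.exact_of_f_is_kernel _ ((opCx P Y).homologyIsKernel (n+1) n (by simp))
  have hex2 := hex.unop
  rw [ShortComplex.moduleCat_exact_iff] at hex2
  have hp : ∀ h : P.complex.X n ⟶ Y, pMap P Y (n+1) (((opCx P Y).fromOpcycles (n+1) n).unop h) =
      P.complex.d (n+1) n ≫ h := by
    intro h
    have h2 := congrArg Quiver.Hom.unop ((opCx P Y).p_fromOpcycles (n+1) n)
    exact congrArg (fun φ => (ModuleCat.Hom.hom φ) h) h2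
  have hcls : ∀ c, clsMap P Y (n+1) c = 0 ↔ ((opCx P Y).homologyι (n+1)).unop c = 0 := by
    intro c
    have e : clsMap P Y (n+1) = ((opCx P Y).homologyι (n+1)).unop ≫
      (isoL P Y (n+1)).hom.unop := rfl
    have hinj : Function.Injective
      (isoL P Y (n+1)).hom.unop :=
      (ModuleCat.mono_iff_injective _).1 inferInstance
    rw [e]
    constructor
    · intro h
      apply hinj
      rw [map_zero]
      exact h
    · intro h
      exact (congrArg (isoL P Y (n+1)).hom.unop h).trans (map_zero (isoL P Y (n+1)).hom.unop.hom)
  rw [hcls]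
  constructor
  · intro h
    obtain ⟨g, hg⟩ := hex2 c h
    refine ⟨g, ?_⟩
    rw [← hp g]
    exact congrArg _ hg
  · rintro ⟨h, hh⟩
    rw [← hp] at hh
    have := pMap_inj _ _ _ hh
    rw [← this]
    have h2 := congrArg Quiver.Hom.unop ((opCx P Y).homologyι_comp_fromOpcycles (n+1) n)
    exact congrArg (fun φ => (ModuleCat.Hom.hom φ) h) h2

lemma clsMap_nat {X X' : ModuleCat.{u} R} (P : ProjectiveResolution X)
    (P' : ProjectiveResolution X') (Y : ModuleCat.{u} R) (n : ℕ) (g : X' ⟶ X)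
    (φ : P'.complex ⟶ P.complex) (comm : φ.f 0 ≫ P.π.f 0 = P'.π.f 0 ≫ g)
    (c : ((opCx P Y).opcycles n).unop) :
    ∃ c' : ((opCx P' Y).opcycles n).unop,
      clsMap P' Y n c' = ((_root_.Ext R (ModuleCat.{u} R) n).map g.op).app Y (clsMap P Y n c) ∧
      pMap P' Y n c' = φ.f n ≫ (show P.complex.X n ⟶ Y from pMap P Y n c) := by
  refine ⟨(HomologicalComplex.opcyclesMap (opCxMap P P' Y φ) n).unop c, ?_, ?_⟩
  · have h := isoL_nat P P' Y n g φ comm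
    have h1 := HomologicalComplex.homologyι_naturality (opCxMap P P' Y φ) n
    have h2 : (isoL P' Y n).hom ≫ (opCx P' Y).homologyι n ≫
        HomologicalComplex.opcyclesMap (opCxMap P P' Y φ) n =
        ((((linearYoneda R (ModuleCat.{u} R)).obj Y).rightOp).leftDerived n).map g ≫
          (isoL P Y n).hom ≫ (opCx P Y).homologyι n := by
      rw [← h1, reassoc_of% h]
    have h3 := congrArg Quiver.Hom.unop h2
    exact congrArg (fun φ => (ModuleCat.Hom.hom φ) c) h3
  · have h3 := congrArg Quiver.Hom.unop (HomologicalComplex.p_opcyclesMap (opCxMap P P' Y φ) n)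
    exact congrArg (fun φ => (ModuleCat.Hom.hom φ) c) h3

lemma mapExt_eq_zero_iff {X : ModuleCat.{u} R} (P : ProjectiveResolution X) (Y : ModuleCat.{u} R)
    (n : ℕ) (c : ((opCx P Y).opcycles (n+1)).unop) {X' : ModuleCat.{u} R} (g : X' ⟶ X) :
    ((_root_.Ext R (ModuleCat.{u} R) (n+1)).map g.op).app Y (clsMap P Y (n+1) c) = 0 ↔
      (Ext.mk₀ g).comp (P.extMk (pMap P Y (n+1) c) (n+1+1) rfl (d_pMap P Y _ _ c))
        (zero_add _) = 0 := by
  let P' : ProjectiveResolution X' := Classical.choice (HasProjectiveResolution.out)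
  let φ : ProjectiveResolution.Hom P' P g :=
    ⟨ProjectiveResolution.lift g P' P, by exact ProjectiveResolution.lift_commutes_zero _ _ _⟩
  obtain ⟨c', h1, h2⟩ := clsMap_nat P P' Y (n+1) g φ.hom (by simpa using φ.2) c
  rw [← h1, clsMap_eq_zero, ProjectiveResolution.mk₀_comp_extMk _ _ _ _ φ,
    ProjectiveResolution.extMk_eq_zero_iff _ _ _ _ _ n rfl, h2]

/-- transition maps -/
noncomputable def tr (I : Ideal R) {t s : ℕ} (h : t ≤ s) :
    ModuleCat.of R (R ⧸ I ^ s) ⟶ ModuleCat.of R (R ⧸ I ^ t) :=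
  ModuleCat.ofHom (Submodule.mapQ _ _ LinearMap.id (Ideal.pow_le_pow_right h))

/-- Vanishing of local cohomology, in terms of the derived category `Ext`. -/
def LCZero (I : Ideal R) (i : ℕ) (M : ModuleCat.{u} R) : Prop :=
  ∀ (t : ℕ) (x : Abelian.Ext.{u} (ModuleCat.of R (R ⧸ I ^ t)) M i), ∃ (s : ℕ) (h : t ≤ s),
    (Ext.mk₀ (tr I h)).comp x (zero_add i) = 0

lemma subsingleton_iff_LCZero (I : Ideal R) (n : ℕ) (M : ModuleCat.{u} R) :
    Subsingleton ((localCohomology I (n+1)).obj M) ↔ LCZero I (n+1) M := by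
  let D := localCohomology.diagram (localCohomology.idealPowersDiagram I) (n+1)
  let e : (colimit D).obj M ≅ colimit (D.flip.obj M) :=
    colimitObjIsoColimitCompEvaluation D M
  have e1 : Subsingleton ((localCohomology I (n+1)).obj M) ↔
      Subsingleton (colimit (D.flip.obj M) : ModuleCat R) :=
    e.toLinearEquiv.toEquiv.subsingleton_congr
  rw [e1]
  let G := D.flip.obj M
  change Subsingleton (colimit G : ModuleCat R) ↔ _
  have : PreservesFilteredColimitsOfSize.{0,0} (forget (ModuleCat.{u} R)) :=
    preservesFilteredColimitsOfSize_shrink.{0,u,0,u} _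
  have key : Subsingleton (colimit G : ModuleCat R) ↔
      ∀ (t : ℕ) (x : ((_root_.Ext R (ModuleCat.{u} R) (n+1)).obj
        (op (ModuleCat.of R (R ⧸ I ^ t)))).obj M), ∃ (s : ℕ) (h : t ≤ s),
        ((_root_.Ext R (ModuleCat.{u} R) (n+1)).map (tr I h).op).app M x = 0 := by
    constructor
    · intro hs t x
      have h0 : colimit.ι G (op (op t)) x = 0 := Subsingleton.elim _ _
      obtain ⟨j, f, hj⟩ := Concrete.colimit_rep_eq_zero R G (op (op t)) x h0
      exact ⟨j.unop.unop, f.unop.unop.down.down, hj⟩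
    · intro H
      refine subsingleton_of_forall_eq 0 fun y => ?_
      obtain ⟨j, y, rfl⟩ := Concrete.colimit_exists_rep G y
      obtain ⟨s, h, hs⟩ := H j.unop.unop y
      let f : j ⟶ op (op s) := (homOfLE h).op.op
      rw [← colimit.w_apply G f]
      refine (congrArg _ ?_).trans (map_zero _)
      exact hs
  rw [key]
  constructor
  · intro H t x
    let P : ProjectiveResolution (ModuleCat.of R (R ⧸ I ^ t)) :=
      Classical.choice (HasProjectiveResolution.out)
    obtain ⟨f, hf, rfl⟩ := P.extMk_surjective x (n+1+1) rfl
    obtain ⟨c, rfl⟩ := pMap_exists P M (n+1) f hf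
    obtain ⟨s, h, hs⟩ := H t (clsMap P M (n+1) c)
    exact ⟨s, h, (mapExt_eq_zero_iff P M n c _).1 hs⟩
  · intro H t x
    let P : ProjectiveResolution (ModuleCat.of R (R ⧸ I ^ t)) :=
      Classical.choice (HasProjectiveResolution.out)
    obtain ⟨c, rfl⟩ := clsMap_surj P M (n+1) x
    obtain ⟨s, h, hs⟩ := H t (P.extMk (pMap P M (n+1) c) (n+1+1) rfl (d_pMap P M _ _ c))
    exact ⟨s, h, (mapExt_eq_zero_iff P M n c _).2 hs⟩

end Bridge

end Stmt11Aux

namespace Stmt11Aux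

open CategoryTheory Limits Opposite Abelian

universe u

section LC

variable {R : Type u} [CommRing R]

lemma tr_comp (I : Ideal R) {a b c : ℕ} (h1 : a ≤ b) (h2 : b ≤ c) :
    tr I h2 ≫ tr I h1 = tr I (h1.trans h2) := by
  refine ModuleCat.hom_ext (LinearMap.ext fun x => ?_)
  obtain ⟨x, rfl⟩ := Ideal.Quotient.mk_surjective x
  rfl

lemma res_res (I : Ideal R) {a b c : ℕ} (h1 : a ≤ b) (h2 : b ≤ c) {i : ℕ} {M : ModuleCat.{u} R}
    (x : Abelian.Ext.{u} (ModuleCat.of R (R ⧸ I ^ a)) M i) :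
    (Ext.mk₀ (tr I h2)).comp ((Ext.mk₀ (tr I h1)).comp x (zero_add i)) (zero_add i) =
      (Ext.mk₀ (tr I (h1.trans h2))).comp x (zero_add i) := by
  rw [Ext.mk₀_comp_mk₀_assoc, tr_comp]

lemma LCZero.mid {I : Ideal R} {i : ℕ} {S : ShortComplex (ModuleCat.{u} R)} (hS : S.ShortExact)
    (h1 : LCZero I i S.X₁) (h3 : LCZero I i S.X₃) : LCZero I i S.X₂ := by
  intro t x
  obtain ⟨s, hs, hz⟩ := h3 t (x.comp (Ext.mk₀ S.g) (add_zero i))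
  rw [← Ext.comp_assoc _ _ _ (zero_add i) (add_zero i) (by simp)] at hz
  obtain ⟨y, hy⟩ := Ext.covariant_sequence_exact₂ _ hS _ hz
  obtain ⟨s', hs', hz'⟩ := h1 s y
  refine ⟨s', hs.trans hs', ?_⟩
  rw [← res_res I hs hs', ← hy, ← Ext.comp_assoc _ _ _ (zero_add i) (add_zero i) (by simp),
    hz', Ext.zero_comp]

lemma LCZero.right {I : Ideal R} {i : ℕ} {S : ShortComplex (ModuleCat.{u} R)} (hS : S.ShortExact)
    (h2 : LCZero I i S.X₂) (h1 : LCZero I (i+1) S.X₁) : LCZero I i S.X₃ := by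
  intro t x
  obtain ⟨s, hs, hz⟩ := h1 t (x.comp hS.extClass rfl)
  rw [← Ext.comp_assoc _ _ _ (zero_add i) rfl (by simp)] at hz
  obtain ⟨y, hy⟩ := Ext.covariant_sequence_exact₃ _ hS _ rfl hz
  obtain ⟨s', hs', hz'⟩ := h2 s y
  refine ⟨s', hs.trans hs', ?_⟩
  rw [← res_res I hs hs', ← hy, ← Ext.comp_assoc _ _ _ (zero_add i) (add_zero i) (by simp),
    hz', Ext.zero_comp]

lemma LCZero.left {I : Ideal R} {i : ℕ} {S : ShortComplex (ModuleCat.{u} R)} (hS : S.ShortExact)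
    (h3 : LCZero I i S.X₃) (h2 : LCZero I (i+1) S.X₂) : LCZero I (i+1) S.X₁ := by
  intro t x
  obtain ⟨s, hs, hz⟩ := h2 t (x.comp (Ext.mk₀ S.f) (add_zero _))
  rw [← Ext.comp_assoc _ _ _ (zero_add _) (add_zero _) (by simp)] at hz
  obtain ⟨y, hy⟩ := Ext.covariant_sequence_exact₁ _ hS _ hz rfl
  obtain ⟨s', hs', hz'⟩ := h3 s y
  refine ⟨s', hs.trans hs', ?_⟩
  rw [← res_res I hs hs', ← hy, ← Ext.comp_assoc _ _ _ (zero_add i) rfl (by simp),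
    hz', Ext.zero_comp]

lemma LCZero.inj {I : Ideal R} {i : ℕ} {M : ModuleCat.{u} R} [Injective M] :
    LCZero I (i+1) M := fun t x => ⟨t, le_rfl, by rw [x.eq_zero_of_injective, Ext.comp_zero]⟩

lemma LCZero.of_bij {I : Ideal R} {i : ℕ} {M : ModuleCat.{u} R} {f : R} (hf : f ∈ I)
    (hb : Function.Bijective (fun m : M => f • m)) : LCZero I i M := by
  intro t x
  refine ⟨t, le_rfl, ?_⟩
  suffices x = 0 by rw [this, Ext.comp_zero]
  have h1 : f ^ t • x = 0 := by
    have e : x = (Ext.mk₀ (𝟙 _)).comp x (zero_add i) := by rw [Ext.mk₀_id_comp]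
    rw [e, ← Ext.smul_comp, ← Ext.mk₀_smul]
    have : f ^ t • 𝟙 (ModuleCat.of R (R ⧸ I ^ t)) = 0 := by
      refine ModuleCat.hom_ext (LinearMap.ext fun y => ?_)
      obtain ⟨y, rfl⟩ := Ideal.Quotient.mk_surjective y
      change Ideal.Quotient.mk (I ^ t) (f ^ t * y) = 0
      exact Ideal.Quotient.eq_zero_iff_mem.2 (Ideal.mul_mem_right _ _ (Ideal.pow_mem_pow hf t))
    rw [this, Ext.mk₀_zero, Ext.zero_comp]
  have hb' : Function.Bijective (fun m : M => f ^ t • m) := by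
    have := hb.iterate t
    rwa [smul_iterate] at this
  have : IsIso (f ^ t • 𝟙 M) := by
    have h1 : Mono (f ^ t • 𝟙 M) := (ModuleCat.mono_iff_injective _).2 hb'.1
    have h2 : Epi (f ^ t • 𝟙 M) := (ModuleCat.epi_iff_surjective _).2 hb'.2
    exact isIso_of_mono_of_epi _
  rw [Ext.smul_eq_comp_mk₀] at h1
  have h2 := congrArg (fun z => z.comp (Ext.mk₀ (inv (f ^ t • 𝟙 M))) (add_zero i)) h1
  simpa [Ext.comp_assoc_of_third_deg_zero] using h2

/-- the map `R/I^t → M` from an element killed by `I^t` -/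
noncomputable def elt (I : Ideal R) (t : ℕ) {M : ModuleCat.{u} R} (m : M)
    (h : ∀ a ∈ I ^ t, a • m = 0) : ModuleCat.of R (R ⧸ I ^ t) ⟶ M :=
  ModuleCat.ofHom (Submodule.liftQ (I ^ t) (LinearMap.toSpanSingleton R M m) (fun a ha => h a ha))

lemma elt_mk (I : Ideal R) (t : ℕ) {M : ModuleCat.{u} R} (m : M)
    (h : ∀ a ∈ I ^ t, a • m = 0) (r : R) : elt I t m h (Ideal.Quotient.mk _ r) = r • m := rfl

lemma hom_quot_ext (I : Ideal R) (t : ℕ) {M : ModuleCat.{u} R}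
    {f g : ModuleCat.of R (R ⧸ I ^ t) ⟶ M}
    (h : f (Ideal.Quotient.mk _ 1) = g (Ideal.Quotient.mk _ 1)) : f = g := by
  refine ModuleCat.hom_ext (LinearMap.ext fun x => ?_)
  obtain ⟨x, rfl⟩ := Ideal.Quotient.mk_surjective x
  have e : (Ideal.Quotient.mk (I ^ t) x) = x • (Ideal.Quotient.mk (I ^ t) 1) := by
    rw [← Ideal.Quotient.mk_eq_mk, ← Ideal.Quotient.mk_eq_mk, ← Submodule.Quotient.mk_smul]
    simp
  have h1 : f.hom (x • (Ideal.Quotient.mk (I ^ t) 1)) = x • f.hom (Ideal.Quotient.mk (I ^ t) 1) :=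
    map_smul f.hom x _
  have h2 : g.hom (x • (Ideal.Quotient.mk (I ^ t) 1)) = x • g.hom (Ideal.Quotient.mk (I ^ t) 1) :=
    map_smul g.hom x _
  rw [e]
  exact h1.trans ((congrArg _ h).trans h2.symm)

lemma hom_kill (I : Ideal R) (t : ℕ) {M : ModuleCat.{u} R}
    (f : ModuleCat.of R (R ⧸ I ^ t) ⟶ M) : ∀ a ∈ I ^ t, a • f (Ideal.Quotient.mk _ 1) = 0 := by
  intro a ha
  have h1 : f.hom (a • (Ideal.Quotient.mk (I ^ t) 1)) = a • f.hom (Ideal.Quotient.mk (I ^ t) 1) :=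
    map_smul f.hom a _
  have h2 : a • (Ideal.Quotient.mk (I ^ t) 1) = 0 := by
    rw [← Ideal.Quotient.mk_eq_mk, ← Submodule.Quotient.mk_smul, Submodule.Quotient.mk_eq_zero]
    simpa using ha
  exact h1.symm.trans ((congrArg _ h2).trans (map_zero f.hom))

lemma LCZero_zero_iff (I : Ideal R) (M : ModuleCat.{u} R) :
    LCZero I 0 M ↔ ∀ (t : ℕ) (m : M), (∀ a ∈ I ^ t, a • m = 0) → m = 0 := by
  constructor
  · intro H t m hm
    obtain ⟨s, h, hs⟩ := H t (Ext.mk₀ (elt I t m hm))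
    rw [Ext.mk₀_comp_mk₀, Ext.mk₀_eq_zero_iff] at hs
    have := congrArg (fun φ => (ModuleCat.Hom.hom φ) (Ideal.Quotient.mk _ 1)) hs
    have h2 : (1 : R) • m = 0 := this
    simpa using h2
  · intro H t x
    refine ⟨t, le_rfl, ?_⟩
    obtain ⟨f, rfl⟩ := (Ext.mk₀_bijective _ _).2 x
    have h := H t _ (hom_kill I t f)
    have : f = 0 := hom_quot_ext I t h
    rw [this, Ext.mk₀_zero, Ext.comp_zero]

lemma LCZero_one_iff (I : Ideal R) {S : ShortComplex (ModuleCat.{u} R)} (hS : S.ShortExact)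
    [Injective S.X₂] :
    LCZero I 1 S.X₁ ↔ ∀ (t : ℕ) (m : S.X₃), (∀ a ∈ I ^ t, a • m = 0) →
      ∃ (s : ℕ) (e : S.X₂), (∀ a ∈ I ^ s, a • e = 0) ∧ S.g e = m := by
  constructor
  · intro H t m hm
    obtain ⟨s, h, hs⟩ := H t ((Ext.mk₀ (elt I t m hm)).comp hS.extClass (zero_add 1))
    rw [Ext.mk₀_comp_mk₀_assoc] at hs
    obtain ⟨y, hy⟩ := Ext.covariant_sequence_exact₃ _ hS _ _ hs
    obtain ⟨k, rfl⟩ := (Ext.mk₀_bijective _ _).2 y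
    rw [Ext.mk₀_comp_mk₀] at hy
    have hy := (Ext.mk₀_bijective _ _).1 hy
    refine ⟨s, k (Ideal.Quotient.mk _ 1), hom_kill I s k, ?_⟩
    have := congrArg (fun φ => (ModuleCat.Hom.hom φ) (Ideal.Quotient.mk _ 1)) hy
    have h2 : S.g (k (Ideal.Quotient.mk _ 1)) = (1 : R) • m := this
    simpa using h2
  · intro H t x
    have h0 : x.comp (Ext.mk₀ S.f) (add_zero 1) = 0 := Ext.eq_zero_of_injective _
    obtain ⟨y, rfl⟩ := Ext.covariant_sequence_exact₁ _ hS _ h0 (zero_add 1)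
    obtain ⟨k, rfl⟩ := (Ext.mk₀_bijective _ _).2 y
    obtain ⟨s, e, he, hge⟩ := H t _ (hom_kill I t k)
    refine ⟨max s t, le_max_right _ _, ?_⟩
    rw [Ext.mk₀_comp_mk₀_assoc]
    have he' : ∀ a ∈ I ^ (max s t), a • e = 0 :=
      fun a ha => he a (Ideal.pow_le_pow_right (le_max_left _ _) ha)
    have : tr I (le_max_right s t) ≫ k = elt I (max s t) e he' ≫ S.g := by
      apply hom_quot_ext
      change k (Ideal.Quotient.mk _ 1) = S.g ((1 : R) • e)
      rw [one_smul, hge]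
    rw [this, ← Ext.mk₀_comp_mk₀_assoc, hS.comp_extClass, Ext.comp_zero]

end LC

end Stmt11Aux

namespace Stmt11Aux

open CategoryTheory Limits Opposite Abelian

universe u

section CC

variable {R : Type u} [CommRing R]

/-- the `f`-power torsion submodule -/
def tors (f : R) (E : Type u) [AddCommGroup E] [Module R E] : Submodule R E where
  carrier := {x | ∃ k : ℕ, f ^ k • x = 0}
  zero_mem' := ⟨0, by simp⟩
  add_mem' := by
    rintro a b ⟨k, hk⟩ ⟨l, hl⟩
    refine ⟨k + l, ?_⟩
    have h1 : f ^ (k + l) • a = 0 := by rw [add_comm, pow_add, mul_smul, hk, smul_zero]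
    have h2 : f ^ (k + l) • b = 0 := by rw [pow_add, mul_smul, hl, smul_zero]
    rw [smul_add, h1, h2, add_zero]
  smul_mem' := by
    rintro c x ⟨k, hk⟩
    exact ⟨k, by rw [smul_comm, hk, smul_zero]⟩

/-- every element is killed by a power of `f` -/
def IsTors (f : R) (E : Type u) [AddCommGroup E] [Module R E] : Prop :=
  ∀ x : E, ∃ k : ℕ, f ^ k • x = 0

lemma pow_smul_mono {f : R} {E : Type u} [AddCommGroup E] [Module R E] {x : E} {k l : ℕ}
    (h : k ≤ l) (hk : f ^ k • x = 0) : f ^ l • x = 0 := by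
  rw [← Nat.sub_add_cancel h, pow_add, mul_smul, hk, smul_zero]

lemma tors_isTors (f : R) (E : Type u) [AddCommGroup E] [Module R E] : IsTors f (tors f E) := by
  rintro ⟨x, k, hk⟩
  exact ⟨k, Subtype.ext hk⟩

lemma tors_injective [IsNoetherianRing R] (f : R) (E : Type u) [AddCommGroup E] [Module R E]
    [Module.Injective R E] : Module.Injective R (tors f E) := by
  refine Module.Baer.injective ?_
  intro I g
  let N : ℕ →o Submodule R I :=
    ⟨fun k => LinearMap.ker (f ^ k • g), fun k l h x hx => by
      rw [LinearMap.mem_ker] at hx ⊢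
      exact pow_smul_mono (f := f) (x := g x) h hx⟩
  let C : ℕ →o Submodule R R :=
    ⟨fun k => Submodule.comap (f ^ k • LinearMap.id : R →ₗ[R] R) I, fun k l h x hx => by
      rw [Submodule.mem_comap] at hx ⊢
      change f ^ k * x ∈ I at hx
      change f ^ l * x ∈ I
      rw [← Nat.sub_add_cancel h, pow_add, mul_assoc]
      exact I.mul_mem_left _ hx⟩
  obtain ⟨n, hn⟩ := monotone_stabilizes_iff_noetherian.2 (inferInstance : IsNoetherian R I) N
  obtain ⟨k, hk⟩ := monotone_stabilizes_iff_noetherian.2 (inferInstance : IsNoetherian R R) C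
  have hn' : ∀ x, f ^ n • g x = 0 := by
    intro x
    obtain ⟨j, hj⟩ := tors_isTors f E (g x)
    have h1 : x ∈ N (max n j) := by
      change f ^ (max n j) • g x = 0
      exact pow_smul_mono (le_max_right _ _) hj
    rw [← hn _ (le_max_left _ _)] at h1
    exact h1
  have hk' : ∀ x : I, (x : R) ∈ Ideal.span {f ^ (k + n)} → g x = 0 := by
    intro x hx
    obtain ⟨r, hr⟩ := Ideal.mem_span_singleton'.1 hx
    have h1 : r ∈ C (k + n) := by
      change f ^ (k + n) * r ∈ I
      rw [mul_comm, hr]; exact x.2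
    rw [← hk _ (by omega)] at h1
    have h2 : f ^ k * r ∈ I := h1
    have : x = f ^ n • (⟨f ^ k * r, h2⟩ : I) := by
      apply Subtype.ext
      change (x : R) = f ^ n * (f ^ k * r)
      rw [← hr]; ring
    rw [this, map_smul]
    exact hn' _
  let φ : I →ₗ[R] (R ⧸ Ideal.span {f ^ (k + n)}) := (Ideal.span {f ^ (k + n)}).mkQ ∘ₗ I.subtype
  have hker : LinearMap.ker φ ≤ LinearMap.ker ((tors f E).subtype ∘ₗ g) := by
    intro x hx
    have hx' : (x : R) ∈ Ideal.span {f ^ (k + n)} := by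
      have := LinearMap.mem_ker.1 hx
      exact (Submodule.Quotient.mk_eq_zero _).1 this
    rw [LinearMap.mem_ker, LinearMap.comp_apply, hk' x hx', map_zero]
  obtain ⟨h, hh⟩ := Module.Injective.out ((LinearMap.ker φ).liftQ φ le_rfl)
    (LinearMap.ker_eq_bot.1 (Submodule.ker_liftQ_eq_bot _ _ _ le_rfl))
    ((LinearMap.ker φ).liftQ ((tors f E).subtype ∘ₗ g) hker)
  refine ⟨LinearMap.codRestrict (tors f E) (h ∘ₗ (Ideal.span {f ^ (k + n)}).mkQ) ?_, ?_⟩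
  · intro c
    refine ⟨k + n, ?_⟩
    rw [← map_smul, LinearMap.comp_apply]
    have : (Ideal.span {f ^ (k + n)}).mkQ (f ^ (k + n) • c) = 0 := by
      refine (Submodule.Quotient.mk_eq_zero _).2 ?_
      exact Ideal.mul_mem_right _ _ (Ideal.mem_span_singleton_self _)
    rw [this, map_zero]
  · intro x mem
    apply Subtype.ext
    exact hh (Submodule.Quotient.mk ⟨x, mem⟩)

/-- short complex from linear maps -/
noncomputable def sc {A B C : Type u} [AddCommGroup A] [Module R A] [AddCommGroup B] [Module R B]
    [AddCommGroup C] [Module R C] (f : A →ₗ[R] B) (g : B →ₗ[R] C) (h : Function.Exact f g) :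
    ShortComplex (ModuleCat.{u} R) :=
  ShortComplex.mk (X₁ := ModuleCat.of R A) (X₂ := ModuleCat.of R B) (X₃ := ModuleCat.of R C)
    (ModuleCat.ofHom f) (ModuleCat.ofHom g) (by ext x; exact h.apply_apply_eq_zero x)

lemma sc_exact {A B C : Type u} [AddCommGroup A] [Module R A] [AddCommGroup B] [Module R B]
    [AddCommGroup C] [Module R C] (f : A →ₗ[R] B) (g : B →ₗ[R] C) (h : Function.Exact f g)
    (hf : Function.Injective f) (hg : Function.Surjective g) : (sc f g h).ShortExact where
  exact := by rw [ShortComplex.ShortExact.moduleCat_exact_iff_function_exact]; exact h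
  mono_f := (ModuleCat.mono_iff_injective _).2 hf
  epi_g := (ModuleCat.epi_iff_surjective _).2 hg

lemma tors_seq [IsNoetherianRing R] (f : R) (N : ModuleCat.{u} R) (hN : IsTors f N) :
    ∃ (E C : ModuleCat.{u} R) (i : N ⟶ E) (p : E ⟶ C) (w : i ≫ p = 0),
      (ShortComplex.mk i p w).ShortExact ∧ Injective E ∧ IsTors f E ∧ IsTors f C := by
  have h0 : Injective (ModuleCat.of R (Injective.under N : ModuleCat.{u} R)) :=
    (inferInstance : Injective (Injective.under N))
  have h1 : Module.Injective R (Injective.under N : ModuleCat.{u} R) :=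
    Module.injective_module_of_injective_object R _
  have h2 := tors_injective f (Injective.under N : ModuleCat.{u} R)
  let i : N →ₗ[R] tors f (Injective.under N : ModuleCat.{u} R) :=
    LinearMap.codRestrict _ (Injective.ι N).hom (fun x => by
      obtain ⟨k, hk⟩ := hN x
      exact ⟨k, by rw [← map_smul, hk, map_zero]⟩)
  have hi : Function.Injective i := by
    intro x y hxy
    exact (ModuleCat.mono_iff_injective (Injective.ι N)).1 inferInstance (congrArg Subtype.val hxy)
  have hex : Function.Exact i (LinearMap.range i).mkQ := LinearMap.exact_map_mkQ_range i
  refine ⟨_, _, _, _, _, sc_exact i (LinearMap.range i).mkQ hex hi (Submodule.mkQ_surjective _),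
    Module.injective_object_of_injective_module R _, tors_isTors _ _, ?_⟩
  intro x
  obtain ⟨x, rfl⟩ := Submodule.mkQ_surjective _ x
  obtain ⟨k, hk⟩ := tors_isTors _ _ x
  refine ⟨k, ?_⟩
  change f ^ k • (LinearMap.range i).mkQ x = 0
  rw [← map_smul, hk, map_zero]

lemma kill_iff {f : R} {I : Ideal R} {N : Type u} [AddCommGroup N] [Module R N]
    (hN : IsTors f N) (m : N) :
    (∃ t, ∀ a ∈ I ^ t, a • m = 0) ↔ ∃ t, ∀ a ∈ (Ideal.span {f} ⊔ I) ^ t, a • m = 0 := by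
  constructor
  · rintro ⟨t, ht⟩
    obtain ⟨k, hk⟩ := hN m
    refine ⟨k + t, fun a ha => ?_⟩
    have := Ideal.sup_pow_add_le_pow_sup_pow ha
    obtain ⟨b, hb, c, hc, rfl⟩ := Submodule.mem_sup.1 this
    rw [Ideal.span_singleton_pow] at hb
    obtain ⟨r, rfl⟩ := Ideal.mem_span_singleton'.1 hb
    rw [add_smul, ht c hc, mul_smul, hk, smul_zero, add_zero]
  · rintro ⟨t, ht⟩
    exact ⟨t, fun a ha => ht a (Ideal.pow_right_mono le_sup_right t ha)⟩

lemma LCZero_tors [IsNoetherianRing R] (f : R) (I : Ideal R) (i : ℕ) :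
    ∀ (N : ModuleCat.{u} R), IsTors f N →
      (LCZero (Ideal.span {f} ⊔ I) i N ↔ LCZero I i N) := by
  induction i using Nat.strong_induction_on with
  | _ i ih =>
    intro N hN
    match i with
    | 0 =>
      rw [LCZero_zero_iff, LCZero_zero_iff]
      constructor
      · intro H t m hm
        obtain ⟨s, hs⟩ := (kill_iff hN m).1 ⟨t, hm⟩
        exact H s m hs
      · intro H t m hm
        obtain ⟨s, hs⟩ := (kill_iff hN m).2 ⟨t, hm⟩
        exact H s m hs
    | 1 =>
      obtain ⟨E, C, a, p, w, hS, hE, hE', hC⟩ := tors_seq f N hN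
      have : Injective (ShortComplex.mk a p w).X₂ := hE
      have e1 := LCZero_one_iff I hS
      have e2 := LCZero_one_iff (Ideal.span {f} ⊔ I) hS
      refine e2.trans (Iff.trans ?_ e1.symm)
      constructor
      · intro H t m hm
        obtain ⟨t', hm'⟩ := (kill_iff (N := C) hC m).1 ⟨t, hm⟩
        obtain ⟨s, e, he, h⟩ := H t' m hm'
        obtain ⟨s', he'⟩ := (kill_iff (N := E) hE' e).2 ⟨s, he⟩
        exact ⟨s', e, he', h⟩
      · intro H t m hm
        obtain ⟨t', hm'⟩ := (kill_iff (N := C) hC m).2 ⟨t, hm⟩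
        obtain ⟨s, e, he, h⟩ := H t' m hm'
        obtain ⟨s', he'⟩ := (kill_iff (N := E) hE' e).1 ⟨s, he⟩
        exact ⟨s', e, he', h⟩
    | j + 2 =>
      obtain ⟨E, C, a, p, w, hS, hE, hE', hC⟩ := tors_seq f N hN
      have : Injective (ShortComplex.mk a p w).X₂ := hE
      have key := ih (j + 1) (by omega) C hC
      have e : ∀ J : Ideal R, LCZero J (j + 2) N ↔ LCZero J (j + 1) C := fun J =>
        ⟨fun h => LCZero.right hS LCZero.inj h, fun h => LCZero.left hS h LCZero.inj⟩
      rw [e, e, key]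

/-- the localization at powers of `f` -/
abbrev Lf (f : R) (M : ModuleCat.{u} R) := LocalizedModule (Submonoid.powers f) M

/-- localization map -/
noncomputable abbrev ell (f : R) (M : ModuleCat.{u} R) : M →ₗ[R] Lf f M :=
  LocalizedModule.mkLinearMap (Submonoid.powers f) M

lemma Lf_bij (f : R) (M : ModuleCat.{u} R) : Function.Bijective (fun m : Lf f M => f • m) := by
  have := IsLocalizedModule.map_units (ell f M) ⟨f, Submonoid.mem_powers f⟩
  exact (Module.End.isUnit_iff _).1 this

lemma ell_surj (f : R) (M : ModuleCat.{u} R) (y : Lf f M) :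
    ∃ (k : ℕ) (x : M), f ^ k • y = ell f M x := by
  obtain ⟨⟨x, ⟨_, k, rfl⟩⟩, h⟩ := IsLocalizedModule.surj (Submonoid.powers f) (ell f M) y
  exact ⟨k, x, h⟩

lemma ell_ker (f : R) (M : ModuleCat.{u} R) (x : M) (hx : ell f M x = 0) :
    ∃ (k : ℕ), f ^ k • x = 0 := by
  obtain ⟨⟨_, k, rfl⟩, h⟩ :=
    (IsLocalizedModule.eq_zero_iff (Submonoid.powers f) (ell f M)).1 hx
  exact ⟨k, h⟩

lemma ker_tors (f : R) (M : ModuleCat.{u} R) : IsTors f (LinearMap.ker (ell f M)) := by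
  rintro ⟨x, hx⟩
  obtain ⟨k, hk⟩ := ell_ker f M x hx
  exact ⟨k, Subtype.ext hk⟩

lemma coker_tors (f : R) (M : ModuleCat.{u} R) : IsTors f (Lf f M ⧸ LinearMap.range (ell f M)) := by
  intro x
  obtain ⟨x, rfl⟩ := Submodule.mkQ_surjective _ x
  obtain ⟨k, y, hk⟩ := ell_surj f M x
  refine ⟨k, ?_⟩
  rw [← map_smul, hk]
  exact (Submodule.Quotient.mk_eq_zero _).2 ⟨y, rfl⟩

lemma seq1 (f : R) (M : ModuleCat.{u} R) :
    ∃ h, (sc (LinearMap.ker (ell f M)).subtype (ell f M).rangeRestrict h).ShortExact := by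
  have h : Function.Exact (LinearMap.ker (ell f M)).subtype (ell f M).rangeRestrict := by
    rw [LinearMap.exact_iff, LinearMap.ker_rangeRestrict, Submodule.range_subtype]
  exact ⟨h, sc_exact _ _ _ (Submodule.injective_subtype _) (LinearMap.surjective_rangeRestrict _)⟩

lemma seq2 (f : R) (M : ModuleCat.{u} R) :
    ∃ h, (sc (LinearMap.range (ell f M)).subtype (LinearMap.range (ell f M)).mkQ h).ShortExact := by
  have h : Function.Exact (LinearMap.range (ell f M)).subtype (LinearMap.range (ell f M)).mkQ := by
    rw [LinearMap.exact_iff, Submodule.ker_mkQ, Submodule.range_subtype]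
  exact ⟨h, sc_exact _ _ _ (Submodule.injective_subtype _) (Submodule.mkQ_surjective _)⟩

lemma Lf_zero (f : R) (I : Ideal R) (M : ModuleCat.{u} R) (i : ℕ) :
    LCZero (Ideal.span {f} ⊔ I) i (ModuleCat.of R (Lf f M)) :=
  LCZero.of_bij (f := f) (Ideal.mem_sup_left (Ideal.mem_span_singleton_self f)) (Lf_bij f M)

lemma vanish_nil (i : ℕ) (M : ModuleCat.{u} R) : LCZero (⊥ : Ideal R) (i + 1) M := by
  intro t x
  refine ⟨t + 1, by omega, ?_⟩
  have h : (⊥ : Ideal R) ^ (t + 1) = ⊥ := by rw [← Ideal.zero_eq_bot, zero_pow (by omega)]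
  have : Projective (ModuleCat.of R (R ⧸ (⊥ : Ideal R) ^ (t + 1))) := by
    rw [← IsProjective.iff_projective]
    exact Module.Projective.of_equiv (Submodule.quotEquivOfEqBot _ h).symm
  exact Ext.eq_zero_of_projective _

theorem vanish [IsNoetherianRing R] (L : List R) :
    ∀ (i : ℕ), L.length ≤ i → ∀ M : ModuleCat.{u} R, LCZero (Ideal.ofList L) (i + 1) M := by
  induction L with
  | nil => intro i _ M; rw [Ideal.ofList_nil]; exact vanish_nil i M
  | cons f L ih =>
    intro i hi M
    rw [List.length_cons] at hi
    rw [Ideal.ofList_cons]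
    obtain ⟨i, rfl⟩ : ∃ j, i = j + 1 := ⟨i - 1, by omega⟩
    obtain ⟨_, h1⟩ := seq1 f M
    obtain ⟨_, h2⟩ := seq2 f M
    refine LCZero.mid h1 ?_ ?_
    · exact (LCZero_tors f _ _ _ (ker_tors f M)).2 (ih _ (by omega) _)
    · refine LCZero.left h2 ?_ (Lf_zero f _ M _)
      exact (LCZero_tors f _ _ _ (coker_tors f M)).2 (ih _ (by omega) _)

/-- the ideal generated by the powers -/
def Apow (L : List R) (k : ℕ) : Ideal R := Ideal.ofList (L.map (· ^ (k + 1)))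

lemma Apow_mul (L : List R) (k j : ℕ) : ∀ a ∈ Apow L k, L.prod ^ j * a ∈ Apow L (k + j) := by
  intro a ha
  unfold Apow Ideal.ofList at ha
  induction ha using Submodule.span_induction with
  | mem x hx =>
    obtain ⟨g, hg, rfl⟩ := List.mem_map.1 hx
    obtain ⟨c, hc⟩ := List.dvd_prod hg
    have : L.prod ^ j * g ^ (k + 1) = c ^ j * g ^ (k + j + 1) := by rw [hc]; ring
    rw [this]
    exact Ideal.mul_mem_left _ _ (Ideal.subset_span (List.mem_map.2 ⟨g, hg, rfl⟩))
  | zero => simp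
  | add x y _ _ hx hy => rw [mul_add]; exact add_mem hx hy
  | smul r x _ hx =>
    rw [smul_eq_mul, mul_left_comm]; exact Ideal.mul_mem_left _ _ hx

lemma clear_denom (f : R) (A : Ideal R) (M : ModuleCat.{u} R) (z : Lf f M)
    (hz : z ∈ A • (⊤ : Submodule R (Lf f M))) :
    ∃ (j : ℕ) (w : M), w ∈ A • (⊤ : Submodule R M) ∧ f ^ j • z = ell f M w := by
  induction hz using Submodule.smul_induction_on' with
  | smul r hr n _ =>
    obtain ⟨k, x, h⟩ := ell_surj f M n
    exact ⟨k, r • x, Submodule.smul_mem_smul hr trivial, by rw [smul_comm, h, map_smul]⟩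
  | add x _ y _ hx hy =>
    obtain ⟨j, w, hw, h⟩ := hx
    obtain ⟨j', w', hw', h'⟩ := hy
    refine ⟨j + j', f ^ j' • w + f ^ j • w',
      add_mem (Submodule.smul_mem _ _ hw) (Submodule.smul_mem _ _ hw'), ?_⟩
    rw [map_add, map_smul, map_smul, ← h, ← h', smul_smul, smul_smul, ← pow_add, ← pow_add,
      smul_add, add_comm j' j]

theorem top_vanish [IsNoetherianRing R] (L : List R) :
    ∀ M : ModuleCat.{u} R, LCZero (Ideal.ofList L) L.length M →
      ∀ x : M, ∃ k, L.prod ^ k • x ∈ Apow L k • (⊤ : Submodule R M) := by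
  induction L with
  | nil =>
    intro M h x
    rw [List.length_nil, LCZero_zero_iff] at h
    refine ⟨0, ?_⟩
    have : x = 0 := h 1 x (by
      intro a ha
      rw [Ideal.ofList_nil, pow_one, Ideal.mem_bot] at ha
      rw [ha, zero_smul])
    rw [this, smul_zero]
    exact zero_mem _
  | cons f L ih =>
    intro M h x
    rw [List.length_cons, Ideal.ofList_cons] at h
    obtain ⟨_, h1⟩ := seq1 f M
    obtain ⟨_, h2⟩ := seq2 f M
    have hk : LCZero (Ideal.span {f} ⊔ Ideal.ofList L) (L.length + 1 + 1)
        (ModuleCat.of R (LinearMap.ker (ell f M))) :=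
      (LCZero_tors f _ _ _ (ker_tors f M)).2 (vanish L _ (by omega) _)
    have hr := LCZero.right h1 h hk
    have hc := LCZero.right h2 (Lf_zero f _ M _) hr
    have hc' := (LCZero_tors f _ _ _ (coker_tors f M)).1 hc
    obtain ⟨y, hy⟩ := (Lf_bij f M).2 (ell f M x)
    have hy : f • y = ell f M x := hy
    obtain ⟨k, hk⟩ := ih _ hc' ((LinearMap.range (ell f M)).mkQ y)
    change L.prod ^ k • (LinearMap.range (ell f M)).mkQ y ∈
      Apow L k • (⊤ : Submodule R (Lf f M ⧸ LinearMap.range (ell f M))) at hk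
    have e : (⊤ : Submodule R (Lf f M ⧸ LinearMap.range (ell f M))) =
        Submodule.map (LinearMap.range (ell f M)).mkQ ⊤ := by
      rw [Submodule.map_top, Submodule.range_mkQ]
    rw [e, ← Submodule.map_smul'', ← map_smul] at hk
    obtain ⟨z, hz, hzy⟩ := hk
    have hu : L.prod ^ k • y - z ∈ LinearMap.range (ell f M) := by
      rw [← (LinearMap.range (ell f M)).ker_mkQ, LinearMap.mem_ker, map_sub, hzy, sub_self]
    obtain ⟨u, hu⟩ := hu
    obtain ⟨j, w, hw, hj⟩ := clear_denom f _ M z hz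
    have h0 : ell f M (f ^ j • L.prod ^ k • x - (f • w + f ^ (j + 1) • u)) = 0 := by
      rw [map_sub, map_add, map_smul, map_smul, map_smul, map_smul, hu, ← hj, ← hy]
      module
    obtain ⟨i, hi⟩ := ell_ker f M _ h0
    have h3 : f ^ (i + j) • L.prod ^ k • x = (f ^ (i + 1)) • w + f ^ (i + j + 1) • u := by
      rw [smul_sub, sub_eq_zero] at hi
      rw [pow_add, mul_smul, hi]; module
    refine ⟨i + j + k, ?_⟩
    have h4 : (f :: L).prod ^ (i + j + k) • x =
        L.prod ^ (i + j) • (f ^ (k + i + 1) • w) +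
        f ^ (i + j + k + 1) • (L.prod ^ (i + j) • u) := by
      have := congrArg (fun v => f ^ k • L.prod ^ (i + j) • v) h3
      simp only [smul_add, smul_smul] at this
      rw [List.prod_cons]
      simp only [smul_smul]
      convert this using 2 <;> ring_nf
    rw [h4]
    have e2 : Apow (f :: L) (i + j + k) = Ideal.span {f ^ (i + j + k + 1)} ⊔ Apow L (i + j + k) := by
      unfold Apow
      rw [List.map_cons, Ideal.ofList_cons]
    rw [e2, Submodule.sup_smul, add_comm (L.prod ^ (i + j) • (f ^ (k + i + 1) • w))]
    refine Submodule.add_mem_sup ?_ ?_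
    · exact Submodule.smul_mem_smul (Ideal.mem_span_singleton_self _) trivial
    · have hw' : f ^ (k + i + 1) • w ∈ Apow L k • (⊤ : Submodule R M) := Submodule.smul_mem _ _ hw
      generalize f ^ (k + i + 1) • w = v at hw'
      induction hw' using Submodule.smul_induction_on' with
      | smul r hr n _ =>
        rw [smul_smul]
        refine Submodule.smul_mem_smul ?_ trivial
        rw [add_comm (i + j) k]
        exact Apow_mul L k (i + j) r hr
      | add a _ b _ ha hb => rw [smul_add]; exact add_mem ha hb

end CC

end Stmt11Aux

namespace Stmt11Aux

section DD

set_option linter.unusedSimpArgs false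

open MvPolynomial

universe u

variable {K : Type u} [Field K]

lemma omega_aux {A : Type u} [CommRing A] (D1 D2 D4 D5 : Derivation ℤ A A)
    (x0 x1 x2 x3 x4 x5 m1 m2 m3 : A)
    (h1 : m1 = x1 * x5 - x2 * x4) (h2 : m2 = x2 * x3 - x0 * x5) (h3 : m3 = x0 * x4 - x1 * x3)
    (e10 : D1 x0 = 0) (e11 : D1 x1 = 1) (e12 : D1 x2 = 0) (e13 : D1 x3 = 0) (e14 : D1 x4 = 0)
    (e15 : D1 x5 = 0)
    (e20 : D2 x0 = 0) (e21 : D2 x1 = 0) (e22 : D2 x2 = 1) (e23 : D2 x3 = 0) (e24 : D2 x4 = 0)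
    (e25 : D2 x5 = 0)
    (e40 : D4 x0 = 0) (e41 : D4 x1 = 0) (e42 : D4 x2 = 0) (e43 : D4 x3 = 0) (e44 : D4 x4 = 1)
    (e45 : D4 x5 = 0)
    (e50 : D5 x0 = 0) (e51 : D5 x1 = 0) (e52 : D5 x2 = 0) (e53 : D5 x3 = 0) (e54 : D5 x4 = 0)
    (e55 : D5 x5 = 1) (b c : ℕ) :
    D5 (D1 (m2 ^ b * m3 ^ c)) - D4 (D2 (m2 ^ b * m3 ^ c)) = 0 ∧
    ∀ a : ℕ, D5 (D1 (m1 ^ (a + 1) * (m2 ^ b * m3 ^ c))) -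
      D4 (D2 (m1 ^ (a + 1) * (m2 ^ b * m3 ^ c))) =
      ((a + 1) * (a + b + c + 2) : A) * (m1 ^ a * (m2 ^ b * m3 ^ c)) := by
  have d11 : D1 m1 = x5 := by simp [h1, e11, e15, e12, e14]
  have d12 : D1 m2 = 0 := by simp [h2, e12, e13, e10, e15]
  have d13 : D1 m3 = -x3 := by simp [h3, e10, e14, e11, e13]
  have d21 : D2 m1 = -x4 := by simp [h1, e21, e25, e22, e24]
  have d22 : D2 m2 = x3 := by simp [h2, e22, e23, e20, e25]
  have d23 : D2 m3 = 0 := by simp [h3, e20, e24, e21, e23]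
  have d41 : D4 m1 = -x2 := by simp [h1, e41, e45, e42, e44]
  have d42 : D4 m2 = 0 := by simp [h2, e42, e43, e40, e45]
  have d43 : D4 m3 = x0 := by simp [h3, e40, e44, e41, e43]
  have d51 : D5 m1 = x1 := by simp [h1, e51, e55, e52, e54]
  have d52 : D5 m2 = -x0 := by simp [h2, e52, e53, e50, e55]
  have d53 : D5 m3 = 0 := by simp [h3, e50, e54, e51, e53]
  have p : ∀ (m : A) (n : ℕ), (n : A) * m ^ (n - 1) * m = n * m ^ n := by
    intro m n
    cases n with
    | zero => simp
    | succ n => simp; ring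
  have hb := p m2 b
  have hc := p m3 c
  constructor
  · simp only [Derivation.leibniz, Derivation.leibniz_pow, d11, d12, d13, d21, d22, d23, d41, d42,
      d43, d51, d52, d53, smul_eq_mul, nsmul_eq_mul, map_add, mul_zero, zero_mul, add_zero,
      zero_add, map_neg, map_zero, e53, e43, Derivation.map_natCast, mul_neg]
    ring
  · intro a
    have ha := p m1 a
    simp only [Derivation.leibniz, Derivation.leibniz_pow, d11, d12, d13, d21, d22, d23, d41, d42,
      d43, d51, d52, d53, smul_eq_mul, nsmul_eq_mul, map_add, mul_zero, zero_mul, add_zero,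
      zero_add, map_neg, map_zero, e53, e43, e55, e44, Derivation.map_natCast, mul_neg, mul_one,
      Nat.add_sub_cancel]
    push_cast
    generalize m1 ^ (a - 1) = u1 at *
    generalize m2 ^ (b - 1) = u2 at *
    generalize m3 ^ (c - 1) = u3 at *
    linear_combination ((a : A) + 1) * m2 ^ b * m3 ^ c * ha + ((a : A) + 1) * m1 ^ a * m3 ^ c * hb +
      ((a : A) + 1) * m1 ^ a * m2 ^ b * hc - ((a : A) + 1) * a * u1 * m2 ^ b * m3 ^ c * h1 -
      ((a : A) + 1) * m1 ^ a * b * u2 * m3 ^ c * h2 - ((a : A) + 1) * m1 ^ a * c * u3 * m2 ^ b * h3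

/-- the apolarity pairing -/
noncomputable def BB (q : MvPolynomial (Fin 10) K) : MvPolynomial (Fin 10) K →ₗ[K] K :=
  (basisMonomials (Fin 10) K).constr K
    (fun d => ((∏ j : Fin 10, (d j).factorial : ℕ) : K) * coeff d q)

lemma BB_monomial (q : MvPolynomial (Fin 10) K) (d : Fin 10 →₀ ℕ) :
    BB q (monomial d 1) = ((∏ j : Fin 10, (d j).factorial : ℕ) : K) * coeff d q := by
  have := (basisMonomials (Fin 10) K).constr_basis K
    (fun d => ((∏ j : Fin 10, (d j).factorial : ℕ) : K) * coeff d q) d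
  rwa [coe_basisMonomials] at this

lemma BB_X (q p : MvPolynomial (Fin 10) K) (i : Fin 10) : BB q (X i * p) = BB (pderiv i q) p := by
  suffices BB q ∘ₗ LinearMap.mulLeft K (X i) = BB (pderiv i q) from LinearMap.congr_fun this p
  refine (basisMonomials (Fin 10) K).ext fun d => ?_
  rw [coe_basisMonomials, LinearMap.comp_apply, LinearMap.mulLeft_apply, BB_monomial]
  have : (X i : MvPolynomial (Fin 10) K) * monomial d 1 = monomial (d + Finsupp.single i 1) 1 := by
    rw [X, monomial_mul, one_mul, add_comm]
  rw [this, BB_monomial, coeff_pderiv]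
  have hf : (∏ j : Fin 10, ((d + Finsupp.single i 1 : Fin 10 →₀ ℕ) j).factorial) =
      (∏ j : Fin 10, (d j).factorial) * (d i + 1) := by
    rw [← Finset.mul_prod_erase _ _ (Finset.mem_univ i),
      ← Finset.mul_prod_erase _ (fun j => (d j).factorial) (Finset.mem_univ i)]
    have : ∀ j ∈ Finset.univ.erase i, ((d + Finsupp.single i 1 : Fin 10 →₀ ℕ) j).factorial = (d j).factorial := by
      intro j hj
      have := Finset.ne_of_mem_erase hj
      simp [Finsupp.single_apply, this.symm]
    rw [Finset.prod_congr rfl this]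
    simp [Nat.factorial_succ]; ring
  rw [hf]; push_cast; ring

lemma BB_sub (q q' p : MvPolynomial (Fin 10) K) : BB (q - q') p = BB q p - BB q' p := by
  suffices BB (q - q') = BB q - BB q' by rw [this]; rfl
  refine (basisMonomials (Fin 10) K).ext fun d => ?_
  rw [coe_basisMonomials, LinearMap.sub_apply, BB_monomial, BB_monomial, BB_monomial, coeff_sub]
  ring

lemma BB_C (c : K) (q p : MvPolynomial (Fin 10) K) : BB (C c * q) p = c * BB q p := by
  suffices BB (C c * q) = c • BB q by rw [this]; rfl
  refine (basisMonomials (Fin 10) K).ext fun d => ?_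
  rw [coe_basisMonomials, LinearMap.smul_apply, BB_monomial, BB_monomial, coeff_C_mul, smul_eq_mul]
  ring

lemma iter_zero {P : Type u} [CommRing P] [Algebra K P] (B : P → P →ₗ[K] K) (m w : P) (κ : ℕ → K)
    (h0 : ∀ p, B w (m * p) = 0) (hs : ∀ a p, B (m ^ (a + 1) * w) (m * p) = κ a * B (m ^ a * w) p)
    (a : ℕ) : ∀ p, B (m ^ a * w) (m ^ (a + 1) * p) = 0 := by
  induction a with
  | zero => intro p; simpa using h0 p
  | succ a ih =>
    intro p
    rw [pow_succ' m (a + 1), mul_assoc m, pow_succ m a] at *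
    rw [← pow_succ m a] at *
    rw [hs, ih, mul_zero]

lemma iter_ne {P : Type u} [CommRing P] [Algebra K P] (B : P → P →ₗ[K] K) (m w : P) (κ : ℕ → K)
    (hκ : ∀ a, κ a ≠ 0)
    (hs : ∀ a p, B (m ^ (a + 1) * w) (m * p) = κ a * B (m ^ a * w) p)
    (a : ℕ) : ∀ p, B w p ≠ 0 → B (m ^ a * w) (m ^ a * p) ≠ 0 := by
  induction a with
  | zero => intro p; simp
  | succ a ih =>
    intro p hp
    have : m ^ (a + 1) * p = m * (m ^ a * p) := by ring
    rw [this, hs]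
    exact mul_ne_zero (hκ a) (ih p hp)

lemma BB_omega [CharZero K] (i0 i1 i2 i3 i4 i5 : Fin 10) (h : List.Nodup [i0, i1, i2, i3, i4, i5])
    (m1 m2 m3 : MvPolynomial (Fin 10) K)
    (h1 : m1 = X i1 * X i5 - X i2 * X i4) (h2 : m2 = X i2 * X i3 - X i0 * X i5)
    (h3 : m3 = X i0 * X i4 - X i1 * X i3) (b c : ℕ) :
    (∀ a p, BB (m1 ^ a * (m2 ^ b * m3 ^ c)) (m1 ^ (a + 1) * p) = 0) ∧
    (∀ a p, BB (m2 ^ b * m3 ^ c) p ≠ 0 → BB (m1 ^ a * (m2 ^ b * m3 ^ c)) (m1 ^ a * p) ≠ 0) := by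
  simp only [List.nodup_cons, List.mem_cons, List.not_mem_nil, or_false, not_or,
    List.nodup_nil, and_true, not_false_eq_true] at h
  obtain ⟨⟨n01, n02, n03, n04, n05⟩, ⟨n12, n13, n14, n15⟩, ⟨n23, n24, n25⟩, ⟨n34, n35⟩, n45⟩ := h
  have key := omega_aux ((pderiv (R := K) i1).restrictScalars ℤ) ((pderiv i2).restrictScalars ℤ)
    ((pderiv i4).restrictScalars ℤ) ((pderiv i5).restrictScalars ℤ)
    (X i0) (X i1) (X i2) (X i3) (X i4) (X i5) m1 m2 m3 h1 h2 h3
    (pderiv_X_of_ne n01) (pderiv_X_self _) (pderiv_X_of_ne (Ne.symm n12))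
    (pderiv_X_of_ne (Ne.symm n13)) (pderiv_X_of_ne (Ne.symm n14)) (pderiv_X_of_ne (Ne.symm n15))
    (pderiv_X_of_ne n02) (pderiv_X_of_ne n12) (pderiv_X_self _)
    (pderiv_X_of_ne (Ne.symm n23)) (pderiv_X_of_ne (Ne.symm n24)) (pderiv_X_of_ne (Ne.symm n25))
    (pderiv_X_of_ne n04) (pderiv_X_of_ne n14) (pderiv_X_of_ne n24)
    (pderiv_X_of_ne n34) (pderiv_X_self _) (pderiv_X_of_ne (Ne.symm n45))
    (pderiv_X_of_ne n05) (pderiv_X_of_ne n15) (pderiv_X_of_ne n25)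
    (pderiv_X_of_ne n35) (pderiv_X_of_ne n45) (pderiv_X_self _) b c
  obtain ⟨k0, k1⟩ := key
  have hB : ∀ q p : MvPolynomial (Fin 10) K,
      BB q (m1 * p) = BB (pderiv i5 (pderiv i1 q) - pderiv i4 (pderiv i2 q)) p := by
    intro q p
    rw [h1, sub_mul, map_sub, mul_assoc, mul_assoc, BB_X, BB_X, BB_X, BB_X, BB_sub]
  let κ : ℕ → K := fun a => ((a + 1) * (a + b + c + 2) : ℕ)
  have hκ : ∀ a, κ a ≠ 0 := fun a => Nat.cast_ne_zero.2 (by positivity)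
  have hs : ∀ a p, BB (m1 ^ (a + 1) * (m2 ^ b * m3 ^ c)) (m1 * p) =
      κ a * BB (m1 ^ a * (m2 ^ b * m3 ^ c)) p := by
    intro a p
    rw [hB]
    refine (congrArg (fun z => BB z p) (k1 a)).trans ?_
    rw [← BB_C]
    congr 3
    simp only [κ]
    push_cast
    simp only [map_mul, map_add, map_natCast, map_one, map_ofNat]
  have h0 : ∀ p, BB (m2 ^ b * m3 ^ c) (m1 * p) = 0 := by
    intro p
    rw [hB]
    refine (congrArg (fun z => BB z p) k0).trans ?_
    have := BB_C (0 : K) 0 p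
    simpa using this
  exact ⟨iter_zero BB m1 _ κ h0 hs, iter_ne BB m1 _ κ hκ hs⟩

lemma minors_notMem [CharZero K] (m1 m2 m3 : MvPolynomial (Fin 10) K)
    (h1 : m1 = X 1 * X 5 - X 2 * X 4) (h2 : m2 = X 2 * X 3 - X 0 * X 5)
    (h3 : m3 = X 0 * X 4 - X 1 * X 3) (k : ℕ) (g1 g2 g3 : MvPolynomial (Fin 10) K) :
    m1 ^ k * (m2 ^ k * m3 ^ k) ≠ m1 ^ (k + 1) * g1 + m2 ^ (k + 1) * g2 + m3 ^ (k + 1) * g3 := by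
  intro h
  have H1 := fun b c => BB_omega 0 1 2 3 4 5 (by decide) m1 m2 m3 h1 h2 h3 b c
  have H2 := fun b c => BB_omega 1 2 0 4 5 3 (by decide) m2 m3 m1 h2 h3 h1 b c
  have H3 := fun b c => BB_omega 2 0 1 5 3 4 (by decide) m3 m1 m2 h3 h1 h2 b c
  have e2 : m1 ^ k * (m2 ^ k * m3 ^ k) = m2 ^ k * (m3 ^ k * m1 ^ k) := by ring
  have e3 : m1 ^ k * (m2 ^ k * m3 ^ k) = m3 ^ k * (m1 ^ k * m2 ^ k) := by ring
  have hz : BB (m1 ^ k * (m2 ^ k * m3 ^ k)) (m1 ^ k * (m2 ^ k * m3 ^ k)) = 0 := by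
    conv_lhs => arg 2; rw [h]
    rw [map_add, map_add, (H1 k k).1]
    conv_lhs => arg 2; rw [e3, (H3 k k).1]
    rw [e2, (H2 k k).1]
    simp
  refine (H1 k k).2 k _ ?_ hz
  have := (H2 k 0).2 k (m3 ^ k) ?_
  · simpa using this
  have := (H3 0 0).2 k 1 ?_
  · simpa using this
  have := BB_monomial (1 : MvPolynomial (Fin 10) K) 0
  have e : (monomial 0 1 : MvPolynomial (Fin 10) K) = 1 := rfl
  rw [e] at this
  simp [this]

end DD

end Stmt11Aux

namespace Stmt11Aux

open CategoryTheory Limits Opposite Abelian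

universe u

section EE

lemma subs_congr {R : Type u} [CommRing R] [IsNoetherianRing R] {I J : Ideal R}
    (h : J.radical = I.radical) (i : ℕ) (M : ModuleCat.{u} R) :
    Subsingleton ((localCohomology I i).obj M) ↔ Subsingleton ((localCohomology J i).obj M) :=
  (((localCohomology.isoOfSameRadical h i).app M).toLinearEquiv.toEquiv.subsingleton_congr).symm

lemma span_range_eq {R : Type u} [CommRing R] {r : ℕ} (f : Fin r → R) :
    Ideal.span (Set.range f) = Ideal.ofList (List.ofFn f) := by
  unfold Ideal.ofList
  congr 1
  ext x
  simp [List.mem_ofFn]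

lemma subs_of_gens {R : Type u} [CommRing R] [IsNoetherianRing R] {I : Ideal R} {r : ℕ}
    (f : Fin r → R) (h : (Ideal.span (Set.range f)).radical = I.radical) (n : ℕ) (hn : r ≤ n)
    (M : ModuleCat.{u} R) : Subsingleton ((localCohomology I (n + 1)).obj M) := by
  rw [subs_congr h, subsingleton_iff_LCZero, span_range_eq]
  exact vanish _ _ (by simpa using hn) M

lemma top_ring0 {R : Type u} [CommRing R] [IsNoetherianRing R] (f : Fin 3 → R)
    (H : LCZero (Ideal.ofList (List.ofFn f)) 3 (ModuleCat.of R R)) :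
    ∃ (k : ℕ), (List.ofFn f).prod ^ k ∈ Apow (List.ofFn f) k := by
  have hl : (List.ofFn f).length = 3 := List.length_ofFn
  have H' : LCZero (Ideal.ofList (List.ofFn f)) (List.ofFn f).length (ModuleCat.of R R) := by
    rw [hl]; exact H
  generalize List.ofFn f = L at *
  obtain ⟨k, hk⟩ := top_vanish L (ModuleCat.of R R) H' (1 : R)
  refine ⟨k, ?_⟩
  have hk : L.prod ^ k • (1 : R) ∈ Apow L k • (⊤ : Submodule R R) := hk
  have e : L.prod ^ k • (1 : R) = L.prod ^ k := by rw [smul_eq_mul, mul_one]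
  rw [e] at hk
  rw [← Ideal.mul_top (Apow L k)]
  exact hk

lemma top_ring1 {R : Type u} [CommRing R] (f : Fin 3 → R) (k : ℕ)
    (hk : (List.ofFn f).prod ^ k ∈ Apow (List.ofFn f) k) :
    ∃ (g1 g2 g3 : R), (f 0 * (f 1 * f 2)) ^ k =
      g1 * f 0 ^ (k + 1) + (g2 * f 1 ^ (k + 1) + g3 * f 2 ^ (k + 1)) := by
  have el : List.ofFn f = [f 0, f 1, f 2] := by simp [List.ofFn_succ]
  rw [el] at hk
  have e : Apow [f 0, f 1, f 2] k = Ideal.span {f 0 ^ (k + 1)} ⊔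
      (Ideal.span {f 1 ^ (k + 1)} ⊔ Ideal.span {f 2 ^ (k + 1)}) := by
    simp [Apow, Ideal.ofList_cons]
  have ep : [f 0, f 1, f 2].prod = f 0 * (f 1 * f 2) := by simp
  rw [e, ep] at hk
  generalize (f 0 * (f 1 * f 2)) ^ k = z at hk ⊢
  generalize f 0 ^ (k + 1) = y0 at hk ⊢
  generalize f 1 ^ (k + 1) = y1 at hk ⊢
  generalize f 2 ^ (k + 1) = y2 at hk ⊢
  obtain ⟨a1, h1, a2, h2, h⟩ := Submodule.mem_sup.1 hk
  obtain ⟨a3, h3, a4, h4, h'⟩ := Submodule.mem_sup.1 h2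
  obtain ⟨g1, e1⟩ := Ideal.mem_span_singleton'.1 h1
  obtain ⟨g2, e2⟩ := Ideal.mem_span_singleton'.1 h3
  obtain ⟨g3, e3⟩ := Ideal.mem_span_singleton'.1 h4
  exact ⟨g1, g2, g3, by rw [e1, e2, e3, h', h]⟩

open MvPolynomial

variable (K : Type u) [Field K]

/-- minors of the generic part -/
noncomputable def mm : Fin 3 → MvPolynomial (Fin 10) K :=
  ![X 1 * X 5 - X 2 * X 4, X 2 * X 3 - X 0 * X 5, X 0 * X 4 - X 1 * X 3]

/-- the minor without the first column -/
noncomputable def dl : MvPolynomial (Fin 10) K :=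
  X 7 * (X 1 * X 5 - X 2 * X 4) + X 8 * (X 2 * X 3 - X 0 * X 5) + X 9 * (X 0 * X 4 - X 1 * X 3)

/-- auxiliary cross product -/
noncomputable def hh : Fin 3 → MvPolynomial (Fin 10) K :=
  ![X 8 * X 2 - X 9 * X 1, X 9 * X 0 - X 7 * X 2, X 7 * X 1 - X 8 * X 0]

/-- the three generators up to radical -/
noncomputable def ff (i : Fin 3) : MvPolynomial (Fin 10) K := X 6 * mm K i + dl K * hh K i

lemma minor_mem (J : Ideal (MvPolynomial (Fin 10) K)) (hd : dl K ∈ J)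
    (hm : ∀ i, X 6 * mm K i ∈ J) : minorsIdeal 3 (exampleMatrix11 K) ≤ J := by
  refine Ideal.span_le.2 ?_
  rintro _ ⟨r, c, hr, hc, rfl⟩
  have hr' : Function.Bijective r := Finite.injective_iff_bijective.1 hr
  have e : (exampleMatrix11 K).submatrix r c =
      ((exampleMatrix11 K).submatrix id c).submatrix (Equiv.ofBijective r hr') id := rfl
  rw [SetLike.mem_coe, e, Matrix.det_permute]
  refine Ideal.mul_mem_left _ _ ?_
  have h0 := hm 0
  have h1 := hm 1
  have h2 := hm 2
  simp only [mm, dl, Matrix.cons_val] at h0 h1 h2 hd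
  have n01 : c 0 ≠ c 1 := fun h => by simpa using hc h
  have n02 : c 0 ≠ c 2 := fun h => by simpa using hc h
  have n12 : c 1 ≠ c 2 := fun h => by simpa using hc h
  rw [Matrix.det_fin_three]
  simp only [Matrix.submatrix_apply, id]
  generalize c 0 = i at *
  generalize c 1 = j at *
  generalize c 2 = k at *
  clear e hr hr' hc hm
  fin_cases i <;> fin_cases j <;> first | (exact absurd rfl n01) | skip
  all_goals fin_cases k <;> first | (exact absurd rfl n02) | (exact absurd rfl n12) | skip
  all_goals
    simp only [exampleMatrix11, Fin.zero_eta, Fin.mk_one, Fin.reduceFinMk, Matrix.of_apply,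
      Matrix.cons_val]
    first
    | (convert hd using 1; ring1)
    | (convert neg_mem hd using 1; ring1)
    | (convert h0 using 1; ring1)
    | (convert neg_mem h0 using 1; ring1)
    | (convert h1 using 1; ring1)
    | (convert neg_mem h1 using 1; ring1)
    | (convert h2 using 1; ring1)
    | (convert neg_mem h2 using 1; ring1)

lemma mem_minor (c : Fin 3 → Fin 4) (hc : Function.Injective c) :
    ((exampleMatrix11 K).submatrix id c).det ∈ minorsIdeal 3 (exampleMatrix11 K) :=
  Ideal.subset_span ⟨id, c, Function.injective_id, hc, rfl⟩

lemma ff_mem (i : Fin 3) : ff K i ∈ minorsIdeal 3 (exampleMatrix11 K) := by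
  have hd : dl K ∈ minorsIdeal 3 (exampleMatrix11 K) := by
    convert mem_minor K ![1, 2, 3] (by decide) using 1
    rw [Matrix.det_fin_three]
    simp [exampleMatrix11, dl]
    ring
  refine add_mem ?_ (Ideal.mul_mem_right _ _ hd)
  fin_cases i
  · convert mem_minor K ![0, 2, 3] (by decide) using 1
    rw [Matrix.det_fin_three]
    simp [exampleMatrix11, mm]
    ring
  · convert mem_minor K ![0, 3, 1] (by decide) using 1
    rw [Matrix.det_fin_three]
    simp [exampleMatrix11, mm]
    ring
  · convert mem_minor K ![0, 1, 2] (by decide) using 1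
    rw [Matrix.det_fin_three]
    simp [exampleMatrix11, mm]
    ring

lemma ff_rad : (Ideal.span (Set.range (ff K))).radical =
    (minorsIdeal 3 (exampleMatrix11 K)).radical := by
  apply le_antisymm
  · refine Ideal.radical_mono (Ideal.span_le.2 ?_)
    rintro _ ⟨i, rfl⟩
    exact ff_mem K i
  · refine Ideal.radical_le_radical_iff.2 ?_
    have hf : ∀ i, ff K i ∈ Ideal.span (Set.range (ff K)) := fun i =>
      Ideal.subset_span ⟨i, rfl⟩
    have hd : dl K ∈ (Ideal.span (Set.range (ff K))).radical := by
      refine ⟨2, ?_⟩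
      have : dl K ^ 2 = X 3 * ff K 0 + X 4 * ff K 1 + X 5 * ff K 2 := by
        simp only [ff, mm, hh, dl, Matrix.cons_val]
        ring
      rw [this]
      exact add_mem (add_mem (Ideal.mul_mem_left _ _ (hf _)) (Ideal.mul_mem_left _ _ (hf _)))
        (Ideal.mul_mem_left _ _ (hf _))
    refine minor_mem K _ hd fun i => ?_
    have : X 6 * mm K i = ff K i - dl K * hh K i := by rw [ff]; ring
    rw [this]
    exact sub_mem (Ideal.le_radical (hf i)) (Ideal.mul_mem_right _ _ hd)

/-- the specialization -/
noncomputable def spec : MvPolynomial (Fin 10) K →ₐ[K] MvPolynomial (Fin 10) K :=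
  aeval ![X 0, X 1, X 2, X 3, X 4, X 5, 1, 0, 0, 0]

lemma spec_ff (i : Fin 3) : spec K (ff K i) = mm K i := by
  have hd : spec K (dl K) = 0 := by simp [spec, dl]
  rw [ff, map_add, map_mul, map_mul, hd, zero_mul, add_zero]
  fin_cases i <;> simp [spec, mm]

lemma ff_top [CharZero K] : ¬ LCZero (Ideal.ofList (List.ofFn (ff K))) 3
    (ModuleCat.of (MvPolynomial (Fin 10) K) (MvPolynomial (Fin 10) K)) := by
  intro H
  obtain ⟨k, hk⟩ := top_ring0 (ff K) H
  obtain ⟨g1, g2, g3, h⟩ := top_ring1 (ff K) k hk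
  have h' := congrArg (spec K) h
  simp only [map_add, map_mul, map_pow, spec_ff] at h'
  refine minors_notMem (mm K 0) (mm K 1) (mm K 2) rfl rfl rfl k (spec K g1) (spec K g2)
    (spec K g3) ?_
  rw [mul_pow, mul_pow] at h'
  rw [h']
  ring

end EE

end Stmt11Aux

/-- For the above matrix over an algebraically closed field of characteristic zero,
the ideal `I = I_3(X)` of maximal minors satisfies `ara I = cd I = 3`. -/
theorem stmt11 {K : Type*} [Field K] [IsAlgClosed K] [CharZero K] :
    araRank (minorsIdeal 3 (exampleMatrix11 K)) = 3 ∧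
      cohDim (minorsIdeal 3 (exampleMatrix11 K)) = 3 := by
  have hrad := Stmt11Aux.ff_rad K
  have htop : ¬ Subsingleton ((localCohomology (minorsIdeal 3 (exampleMatrix11 K)) 3).obj
      (ModuleCat.of (MvPolynomial (Fin 10) K) (MvPolynomial (Fin 10) K))) := by
    rw [Stmt11Aux.subs_congr hrad, Stmt11Aux.subsingleton_iff_LCZero _ 2, Stmt11Aux.span_range_eq]
    exact Stmt11Aux.ff_top K
  constructor
  · apply le_antisymm
    · exact Nat.sInf_le ⟨_, hrad⟩
    · refine le_csInf ⟨3, _, hrad⟩ ?_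
      rintro r ⟨f, hf⟩
      by_contra hlt
      exact htop (Stmt11Aux.subs_of_gens f hf 2 (by omega) _)
  · refine IsGreatest.csSup_eq ⟨not_subsingleton_iff_nontrivial.1 htop, ?_⟩
    intro i hi
    by_contra hlt
    obtain ⟨j, rfl⟩ : ∃ j, i = j + 1 := ⟨i - 1, by omega⟩
    exact not_subsingleton_iff_nontrivial.2 hi (Stmt11Aux.subs_of_gens _ hrad j (by omega) _)
end
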